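/- arXiv:2605.10849 — 7 statements merged into one kernel-verified Lean document; each statement's English description precedes it below -/
import Mathlib

section
/- For every Schwartz function φ : ℝ → ℂ, the limit as ε → 0⁺ of ∫_{|x| ≥ ε} (𝓕⁻¹φ)(x)/x dx exists and equals (i/2) ∫_ℝ sgn(x) φ(x) dx, where sgn(x) = 1 for x > 0, sgn(0) = 0, sgn(x) = −1 for x < 0. (Equivalently: the inverse Fourier transform of the principal-value distribution pv x⁻¹ is (i/2)·sgn as tempered distributions.) -/
open MeasureTheory Filter Topology

/-- The inverse Fourier transform `𝓕⁻¹φ(x) = (2π)⁻¹ ∫ e^{ixτ} φ(τ) dτ`. -/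
noncomputable def invFourierInt (φ : ℝ → ℂ) (x : ℝ) : ℂ :=
  (2 * Real.pi : ℂ)⁻¹ * ∫ τ : ℝ, Complex.exp (Complex.I * (x : ℂ) * (τ : ℂ)) * φ τ

open scoped FourierTransform

theorem SchwartzMap.exists_norm_le_inv_one_add_sq (φ : SchwartzMap ℝ ℂ) :
    ∃ C : ℝ, 0 < C ∧ ∀ s, ‖φ s‖ ≤ C * ((1 + s ^ 2)⁻¹ * (1 + s ^ 2)⁻¹) := by
  obtain ⟨A, hA, h0⟩ := φ.decay 0 0
  obtain ⟨B, hB, h2⟩ := φ.decay 4 0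
  refine ⟨2 * (A + B), by positivity, fun s => ?_⟩
  have h0 := h0 s
  have h2 := h2 s
  simp only [norm_iteratedFDeriv_zero, pow_zero, one_mul, Real.norm_eq_abs] at h0 h2
  rw [show |s| ^ 4 = s ^ 4 by exact Even.pow_abs (by decide) s] at h2
  rw [← mul_inv, ← div_eq_mul_inv, le_div_iff₀ (by positivity)]
  nlinarith [mul_nonneg (norm_nonneg (φ s)) (sq_nonneg (s ^ 2 - 1))]

theorem Real.continuous_fourier {f : ℝ → ℂ} (hf : Integrable f) : Continuous (𝓕 f) :=
  VectorFourier.fourierIntegral_continuous Real.continuous_fourierChar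
    (L := innerₗ ℝ) continuous_inner hf

theorem invFourierInt_eq_fourier (f : ℝ → ℂ) (x : ℝ) :
    invFourierInt f x = (2 * Real.pi : ℂ)⁻¹ * 𝓕 f (-(2 * Real.pi)⁻¹ * x) := by
  rw [invFourierInt, Real.fourier_real_eq_integral_exp_smul]
  congr 1
  refine integral_congr_ae (.of_forall fun t => ?_)
  have : (Real.pi : ℂ) ≠ 0 := by exact_mod_cast Real.pi_ne_zero
  simp only [smul_eq_mul]
  congr 2
  push_cast
  field_simp

theorem hasDerivAt_integral_Iic {f : ℝ → ℂ} (hf : Continuous f) (hfi : Integrable f) (t : ℝ) :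
    HasDerivAt (fun t => ∫ s in Set.Iic t, f s) (f t) t := by
  have h : (fun t => ∫ s in Set.Iic t, f s)
      = fun t => (∫ s in Set.Iic 0, f s) + ∫ s in (0 : ℝ)..t, f s := by
    funext u
    rw [← intervalIntegral.integral_Iic_sub_Iic hfi.integrableOn hfi.integrableOn]
    ring
  rw [h]
  exact (intervalIntegral.integral_hasDerivAt_right (hf.intervalIntegrable _ _)
    (hf.stronglyMeasurableAtFilter _ _) hf.continuousAt).const_add _

theorem integrable_integral_Iic (φ : SchwartzMap ℝ ℂ) (h0 : ∫ s, φ s = 0) :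
    Integrable (fun t => ∫ s in Set.Iic t, φ s) := by
  obtain ⟨C, hC, hφ⟩ := φ.exists_norm_le_inv_one_add_sq
  have hcont : Continuous (fun t => ∫ s in Set.Iic t, φ s) :=
    continuous_iff_continuousAt.2 fun t =>
      (hasDerivAt_integral_Iic φ.continuous φ.integrable t).continuousAt
  have key (t : ℝ) (S : Set ℝ) (hS : MeasurableSet S) (hSt : ∀ s ∈ S, t ^ 2 ≤ s ^ 2) :
      ‖∫ s in S, φ s‖ ≤ C * Real.pi * (1 + t ^ 2)⁻¹ := by
    have hi : Integrable (fun s : ℝ => C * (1 + t ^ 2)⁻¹ * (1 + s ^ 2)⁻¹) :=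
      integrable_inv_one_add_sq.const_mul _
    calc ‖∫ s in S, φ s‖ ≤ ∫ s in S, C * (1 + t ^ 2)⁻¹ * (1 + s ^ 2)⁻¹ := by
          refine norm_integral_le_of_norm_le hi.integrableOn ?_
          refine (ae_restrict_iff' hS).2 (.of_forall fun s hs => (hφ s).trans ?_)
          rw [mul_assoc]
          have := hSt s hs
          gcongr
      _ ≤ ∫ s : ℝ, C * (1 + t ^ 2)⁻¹ * (1 + s ^ 2)⁻¹ :=
          setIntegral_le_integral hi (.of_forall fun s => by positivity)
      _ = C * Real.pi * (1 + t ^ 2)⁻¹ := by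
          rw [integral_const_mul, integral_univ_inv_one_add_sq]; ring
  refine (integrable_inv_one_add_sq.const_mul (C * Real.pi)).mono'
    hcont.aestronglyMeasurable (.of_forall fun t => ?_)
  rcases le_total t 0 with ht | ht
  · exact key t _ measurableSet_Iic fun s hs => by
      have : s ≤ t := hs
      nlinarith
  · have h := intervalIntegral.integral_Iic_add_Ioi (b := t) (μ := volume)
      φ.integrable.integrableOn φ.integrable.integrableOn
    rw [h0] at h
    rw [eq_neg_of_add_eq_zero_left h, norm_neg]
    exact key t _ measurableSet_Ioi fun s hs => by
      have : t < s := hs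
      nlinarith

theorem aecover_le_abs : AECover volume (𝓝[>] (0 : ℝ)) fun ε => {x : ℝ | ε ≤ |x|} where
  ae_eventually_mem := by
    filter_upwards [compl_mem_ae_iff.2 (measure_singleton (0 : ℝ))] with x hx
    exact nhdsWithin_le_nhds (eventually_le_nhds (abs_pos.2 hx))
  measurableSet _ := measurableSet_le measurable_const continuous_abs.measurable

theorem integrable_invFourierInt (φ : SchwartzMap ℝ ℂ) :
    Integrable (invFourierInt (fun t => φ t)) := by
  have h : Integrable (𝓕 (fun t => φ t)) := by
    simpa only [SchwartzMap.fourier_coe] using (𝓕 φ).integrable (μ := volume)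
  rw [funext (invFourierInt_eq_fourier _)]
  exact (h.comp_mul_left' (by simp [Real.pi_ne_zero])).const_mul _

theorem integrableOn_invFourierInt_div (φ : SchwartzMap ℝ ℂ) {ε : ℝ} (hε : 0 < ε) :
    IntegrableOn (fun x : ℝ => invFourierInt (fun t => φ t) x / (x : ℂ)) {x | ε ≤ |x|} := by
  have hg := integrable_invFourierInt φ
  refine (hg.norm.mul_const ε⁻¹).integrableOn.mono' ?_ ?_
  · exact (hg.aestronglyMeasurable.div₀
      Complex.continuous_ofReal.aestronglyMeasurable).restrict
  · refine (ae_restrict_iff' (aecover_le_abs.measurableSet ε)).2 (.of_forall fun x hx => ?_)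
    have hx : ε ≤ |x| := hx
    rw [norm_div, Complex.norm_real, Real.norm_eq_abs, div_eq_mul_inv]
    gcongr

theorem integral_sign_mul {f : ℝ → ℂ} (hf : Integrable f) :
    ∫ x, (Real.sign x : ℂ) * f x = (∫ x in Set.Ioi 0, f x) - ∫ x in Set.Iic 0, f x := by
  have h1 : ∀ᵐ x ∂volume.restrict (Set.Ioi (0 : ℝ)), f x = (Real.sign x : ℂ) * f x :=
    (ae_restrict_iff' measurableSet_Ioi).2 (.of_forall fun x hx => by
      simp [Real.sign_of_pos hx])
  have h2 : ∀ᵐ x ∂volume.restrict (Set.Iic (0 : ℝ)), -f x = (Real.sign x : ℂ) * f x := by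
    rw [← restrict_Iio_eq_restrict_Iic]
    exact (ae_restrict_iff' measurableSet_Iio).2 (.of_forall fun x hx => by
      simp [Real.sign_of_neg hx])
  rw [← intervalIntegral.integral_Iic_add_Ioi (b := 0) (μ := volume)
    (hf.integrableOn.neg.congr h2) (hf.integrableOn.congr h1),
    ← integral_congr_ae h1, ← integral_congr_ae h2, integral_neg]
  ring

theorem tendsto_setIntegral_invFourierInt_div_of_integral_eq_zero (φ : SchwartzMap ℝ ℂ)
    (h0 : ∫ s, φ s = 0) :
    Tendsto (fun ε : ℝ =>
        ∫ x in {x : ℝ | ε ≤ |x|}, invFourierInt (fun t => φ t) x / (x : ℂ))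
      (𝓝[>] 0)
      (𝓝 ((Complex.I / 2) * ∫ x : ℝ, (Real.sign x : ℂ) * φ x)) := by
  set F : ℝ → ℂ := fun t => ∫ s in Set.Iic t, φ s with hF
  have hFd : ∀ t, HasDerivAt F (φ t) t := hasDerivAt_integral_Iic φ.continuous φ.integrable
  have hFi : Integrable F := integrable_integral_Iic φ h0
  have hderiv : deriv F = fun t => φ t := funext fun t => (hFd t).deriv
  have hdiff : Differentiable ℝ F := fun t => (hFd t).differentiableAt
  have hfour : 𝓕 (fun t => φ t) = fun x : ℝ => (2 * Real.pi * Complex.I * x) • 𝓕 F x := by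
    rw [← hderiv]
    exact Real.fourier_deriv hFi hdiff (by rw [hderiv]; exact φ.integrable)
  have hcont := Real.continuous_fourier hFi
  have hFFi : Integrable (𝓕 F) := by
    have hφ : Integrable (𝓕 (fun t => φ t)) := by
      simpa only [SchwartzMap.fourier_coe] using (𝓕 φ).integrable (μ := volume)
    refine LocallyIntegrable.integrable_of_isBigO_cocompact hcont.locallyIntegrable
      (g := 𝓕 (fun t => φ t)) ?_ (hφ.integrableAtFilter _)
    refine Asymptotics.IsBigO.of_bound 1 ?_
    filter_upwards [(isCompact_Icc (a := (-1 : ℝ)) (b := 1)).compl_mem_cocompact] with x hx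
    have hx1 : 1 ≤ |x| := by
      by_contra! h
      exact hx ⟨(abs_lt.1 h).1.le, (abs_lt.1 h).2.le⟩
    have : 1 ≤ 2 * Real.pi * |x| := by nlinarith [Real.pi_gt_three]
    rw [hfour, norm_smul]
    simp only [norm_mul, Complex.norm_I, Complex.norm_real, Real.norm_eq_abs,
      abs_of_pos Real.pi_pos, Complex.norm_ofNat, mul_one, one_mul]
    exact le_mul_of_one_le_left (norm_nonneg _) this
  have hinv : ∫ w, 𝓕 F w = F 0 := by
    have := congrFun (hdiff.continuous.fourierInv_fourier_eq hFi hFFi) 0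
    simpa [Real.fourierInv_eq] using this
  have hpi : (Real.pi : ℂ) ≠ 0 := by exact_mod_cast Real.pi_ne_zero
  have hc : -(2 * Real.pi)⁻¹ ≠ 0 := by simp [Real.pi_ne_zero]
  set H : ℝ → ℂ := fun x =>
    -(Complex.I * (2 * Real.pi : ℂ)⁻¹) * 𝓕 F (-(2 * Real.pi)⁻¹ * x) with hH
  have hHi : Integrable H := (hFFi.comp_mul_left' hc).const_mul _
  have hHint : ∫ x, H x = (Complex.I / 2) * ∫ x : ℝ, (Real.sign x : ℂ) * φ x := by
    have hsum := intervalIntegral.integral_Iic_add_Ioi (b := 0) (μ := volume)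
      φ.integrable.integrableOn φ.integrable.integrableOn
    rw [h0] at hsum
    rw [integral_sign_mul φ.integrable, eq_neg_of_add_eq_zero_right hsum, hH,
      integral_const_mul, Measure.integral_comp_mul_left (𝓕 F), hinv, inv_neg, inv_inv, abs_neg,
      abs_of_pos Real.two_pi_pos, Complex.real_smul]
    push_cast
    field_simp
    simp only [hF]
    ring
  rw [← hHint]
  refine (aecover_le_abs.integral_tendsto_of_countably_generated hHi).congr' ?_
  filter_upwards [self_mem_nhdsWithin] with ε hε
  refine setIntegral_congr_fun (aecover_le_abs.measurableSet ε) fun x hx => ?_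
  have hx0 : (x : ℂ) ≠ 0 := by
    exact_mod_cast abs_pos.1 (lt_of_lt_of_le (Set.mem_Ioi.1 hε) hx)
  simp only [hH, invFourierInt_eq_fourier, hfour, smul_eq_mul]
  push_cast
  field_simp

theorem invFourierInt_comp_neg (f : ℝ → ℂ) (x : ℝ) :
    invFourierInt (fun t => f (-t)) x = invFourierInt f (-x) := by
  unfold invFourierInt
  rw [← integral_neg_eq_self]
  simp

/-- For every Schwartz function `φ : ℝ → ℂ`, the principal value
`lim_{ε → 0⁺} ∫_{|x| ≥ ε} (𝓕⁻¹φ)(x)/x dx` exists and equals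
`(i/2) ∫ sgn(x) φ(x) dx`; i.e. `𝓕⁻¹(pv x⁻¹) = (i/2)·sgn` as tempered distributions. -/
theorem inv_fourier_pv_inv_eq_half_I_sgn (φ : SchwartzMap ℝ ℂ) :
    Tendsto (fun ε : ℝ =>
        ∫ x in {x : ℝ | ε ≤ |x|}, invFourierInt (fun t => φ t) x / (x : ℂ))
      (𝓝[>] 0)
      (𝓝 ((Complex.I / 2) * ∫ x : ℝ, (Real.sign x : ℂ) * φ x)) := by
  let φn : SchwartzMap ℝ ℂ :=
    SchwartzMap.compCLMOfContinuousLinearEquiv ℝ (ContinuousLinearEquiv.neg ℝ) φ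
  have hφn : ∀ t, φn t = φ (-t) := fun t => rfl
  have hψ0 : ∫ s, (φ - φn) s = 0 := by
    simp only [sub_apply]
    rw [integral_sub φ.integrable φn.integrable, sub_eq_zero]
    simp only [hφn]
    exact (integral_neg_eq_self (fun t => φ t) volume).symm
  have hinv (x : ℝ) : invFourierInt (fun t => (φ - φn) t) x
      = invFourierInt (fun t => φ t) x - invFourierInt (fun t => φ t) (-x) := by
    rw [← invFourierInt_comp_neg, invFourierInt_eq_fourier, invFourierInt_eq_fourier,
      invFourierInt_eq_fourier, ← mul_sub]
    congr 1
    have hsub : 𝓕 (φ - φn) = 𝓕 φ - 𝓕 φn :=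
      map_sub (FourierTransform.fourierCLM ℂ (SchwartzMap ℝ ℂ)) φ φn
    have := congrArg (fun f : SchwartzMap ℝ ℂ => f (-(2 * Real.pi)⁻¹ * x)) hsub
    simp only [sub_apply, SchwartzMap.fourier_coe] at this
    exact this
  have hsgn : ∫ x : ℝ, (Real.sign x : ℂ) * (φ - φn) x
      = 2 * ∫ x : ℝ, (Real.sign x : ℂ) * φ x := by
    rw [integral_sign_mul (φ - φn).integrable, integral_sign_mul φ.integrable]
    simp only [sub_apply]
    rw [integral_sub φ.integrable.integrableOn φn.integrable.integrableOn,
      integral_sub φ.integrable.integrableOn φn.integrable.integrableOn]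
    simp only [hφn]
    rw [integral_comp_neg_Iic 0 (fun t => φ t), integral_comp_neg_Ioi 0 (fun t => φ t), neg_zero]
    ring
  have h := (tendsto_setIntegral_invFourierInt_div_of_integral_eq_zero _ hψ0).const_mul (1 / 2 : ℂ)
  rw [hsgn] at h
  convert h.congr' ?_ using 2
  · ring
  filter_upwards [self_mem_nhdsWithin] with ε hε
  have hi := integrableOn_invFourierInt_div φ hε
  have hS := aecover_le_abs.measurableSet ε
  have hodd : ∫ x in {x : ℝ | ε ≤ |x|}, invFourierInt (fun t => φ t) (-x) / ((-x : ℝ) : ℂ)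
      = ∫ x in {x : ℝ | ε ≤ |x|}, invFourierInt (fun t => φ t) x / (x : ℂ) := by
    rw [← integral_indicator hS, ← integral_indicator hS, ← integral_neg_eq_self _ volume]
    refine integral_congr_ae (.of_forall fun x => ?_)
    simp [Set.indicator]
  have hi' : IntegrableOn (fun x : ℝ => invFourierInt (fun t => φ t) (-x) / ((-x : ℝ) : ℂ))
      {x | ε ≤ |x|} := by
    rw [← integrable_indicator_iff hS] at hi ⊢
    refine hi.comp_neg.congr (.of_forall fun x => ?_)
    simp [Set.indicator]
  have hsum : ∫ x in {x : ℝ | ε ≤ |x|}, invFourierInt (fun t => (φ - φn) t) x / (x : ℂ)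
      = ∫ x in {x : ℝ | ε ≤ |x|}, (invFourierInt (fun t => φ t) x / (x : ℂ)
        + invFourierInt (fun t => φ t) (-x) / ((-x : ℝ) : ℂ)) := by
    refine integral_congr_ae (.of_forall fun x => ?_)
    simp only [hinv]
    push_cast
    rw [div_neg]
    ring
  rw [hsum, integral_add hi hi', hodd]
  ring
end

section
/- Let χ₀ : ℝ → ℝ be smooth, compactly supported, even, and equal to 1 on a neighborhood of 0. For t ∈ ℝ define W(t) := lim_{R→∞} (2π)⁻¹ ∫_{−R}^{R} e^{itx} (1−χ₀(x))/x dx. Then: (a) this limit exists for every t ∈ ℝ; (b) W is infinitely differentiable on (0,∞) and on (−∞,0); (c) W(t) → i/2 as t → 0⁺ and W(t) → −i/2 as t → 0⁻; (d) for all j, k ∈ ℕ there is a constant C_{j,k} ≥ 0 such that for all x ≠ 0, the j-th derivative of W (taken within (0,∞) for x > 0 and within (−∞,0) for x < 0) satisfies |W^{(j)}(x)| ≤ C_{j,k} ⟨x⟩^{−k}. -/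
open MeasureTheory Filter Topology

lemma intervalIntegral_sin_mul_exp_neg (R s : ℝ) :
    ∫ x in (0 : ℝ)..R, Real.sin x * Real.exp (-(x * s)) =
      (1 - Real.exp (-(R * s)) * (Real.cos R + s * Real.sin R)) / (1 + s ^ 2) := by
  have hs : (1 + s ^ 2) ≠ 0 := by positivity
  have hderiv (x : ℝ) : HasDerivAt
      (fun x ↦ -(Real.exp (-(x * s)) * (Real.cos x + s * Real.sin x)) / (1 + s ^ 2))
      (Real.sin x * Real.exp (-(x * s))) x := by
    have h := ((((hasDerivAt_id x).mul_const s).neg.exp.mul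
      ((Real.hasDerivAt_cos x).add ((Real.hasDerivAt_sin x).const_mul s))).neg.div_const (1 + s ^ 2))
    refine HasDerivAt.congr_deriv h ?_
    simp only [id, Pi.neg_apply, Pi.add_apply]
    field_simp
    ring
  rw [intervalIntegral.integral_eq_sub_of_hasDerivAt (fun x _ ↦ hderiv x)
    (Continuous.intervalIntegrable (by fun_prop) _ _)]
  simp
  ring

lemma integral_sin_mul_exp_neg_Ioi {x : ℝ} (hx : 0 < x) :
    ∫ s in Set.Ioi (0 : ℝ), Real.sin x * Real.exp (-(x * s)) = Real.sinc x := by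
  have h := integral_exp_mul_Ioi (neg_lt_zero.mpr hx) 0
  simp only [neg_mul, mul_zero, Real.exp_zero] at h
  rw [integral_const_mul, h, Real.sinc_of_ne_zero hx.ne']
  simp [div_eq_mul_inv]

lemma integrable_sin_mul_exp_neg_prod (R : ℝ) :
    Integrable (Function.uncurry fun x s : ℝ ↦ Real.sin x * Real.exp (-(x * s)))
      ((volume.restrict (Set.Ioc 0 R)).prod (volume.restrict (Set.Ioi 0))) := by
  have hmeas : Continuous (Function.uncurry fun x s : ℝ ↦ Real.sin x * Real.exp (-(x * s))) := by
    fun_prop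
  rw [integrable_prod_iff hmeas.aestronglyMeasurable]
  constructor
  · filter_upwards [ae_restrict_mem measurableSet_Ioc] with x hx
    have h := integrableOn_exp_mul_Ioi (neg_lt_zero.mpr hx.1) 0
    simp only [neg_mul] at h
    exact Integrable.const_mul h (Real.sin x)
  · have hint : IntegrableOn (fun x ↦ |Real.sinc x|) (Set.Ioc 0 R) :=
      (Real.continuous_sinc.abs.integrableOn_Icc).mono_set Set.Ioc_subset_Icc_self
    refine hint.congr ?_
    filter_upwards [ae_restrict_mem measurableSet_Ioc] with x hx
    have h := integral_exp_mul_Ioi (neg_lt_zero.mpr hx.1) 0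
    simp only [neg_mul, mul_zero, Real.exp_zero] at h
    simp only [Function.uncurry_apply_pair, norm_mul, Real.norm_eq_abs, Real.abs_exp]
    rw [integral_const_mul, h, Real.sinc_of_ne_zero hx.1.ne', abs_div, abs_of_pos hx.1]
    simp [div_eq_mul_inv]

lemma intervalIntegral_sinc_eq {R : ℝ} (hR : 0 ≤ R) :
    ∫ x in (0 : ℝ)..R, Real.sinc x = ∫ s in Set.Ioi (0 : ℝ),
      (1 - Real.exp (-(R * s)) * (Real.cos R + s * Real.sin R)) / (1 + s ^ 2) := by
  simp_rw [← intervalIntegral_sin_mul_exp_neg, intervalIntegral.integral_of_le hR]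
  rw [← integral_integral_swap (integrable_sin_mul_exp_neg_prod R)]
  exact setIntegral_congr_fun measurableSet_Ioc fun x hx ↦ (integral_sin_mul_exp_neg_Ioi hx.1).symm

/-- The Dirichlet integral. -/
lemma tendsto_intervalIntegral_sinc_atTop :
    Tendsto (fun R : ℝ ↦ ∫ x in (0 : ℝ)..R, Real.sinc x) atTop (𝓝 (Real.pi / 2)) := by
  have hlim : ∫ s in Set.Ioi (0 : ℝ), (1 + s ^ 2)⁻¹ = Real.pi / 2 := by
    simp [integral_Ioi_inv_one_add_sq]
  rw [← hlim]
  refine Tendsto.congr' (EventuallyEq.symm (eventually_atTop.mpr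
    ⟨0, fun R hR ↦ intervalIntegral_sinc_eq hR⟩)) ?_
  have hbound {R s : ℝ} (hs : 0 < s) : |Real.cos R + s * Real.sin R| ≤ 1 + s := by
    refine (abs_add_le _ _).trans (add_le_add (Real.abs_cos_le_one R) ?_)
    rw [abs_mul, abs_of_pos hs]
    exact mul_le_of_le_one_right hs.le (Real.abs_sin_le_one R)
  refine tendsto_integral_filter_of_dominated_convergence (fun s ↦ 2 * (1 + s ^ 2)⁻¹) ?_ ?_ ?_ ?_
  · refine Eventually.of_forall fun R ↦ Continuous.aestronglyMeasurable ?_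
    exact Continuous.div (by fun_prop) (by fun_prop) fun s ↦ by positivity
  · filter_upwards [eventually_ge_atTop 1] with R hR
    filter_upwards [ae_restrict_mem measurableSet_Ioi] with s (hs : 0 < s)
    rw [norm_div, div_eq_mul_inv, Real.norm_of_nonneg (by positivity : 0 ≤ 1 + s ^ 2)]
    gcongr
    refine (norm_sub_le _ _).trans ?_
    rw [norm_one, norm_mul, Real.norm_eq_abs, Real.norm_eq_abs, Real.abs_exp]
    have h₁ : Real.exp (-(R * s)) ≤ Real.exp (-s) :=
      Real.exp_le_exp.mpr (by nlinarith)
    have h₂ : 1 + s ≤ Real.exp s := by linarith [Real.add_one_le_exp s]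
    have h₃ : Real.exp (-(R * s)) * |Real.cos R + s * Real.sin R| ≤ Real.exp (-s) * Real.exp s :=
      mul_le_mul h₁ ((hbound hs).trans h₂) (abs_nonneg _) (Real.exp_nonneg _)
    rw [← Real.exp_add, neg_add_cancel, Real.exp_zero] at h₃
    linarith
  · exact (integrable_inv_one_add_sq.const_mul 2).integrableOn
  · filter_upwards [ae_restrict_mem measurableSet_Ioi] with s (hs : 0 < s)
    have h₁ : Tendsto (fun R : ℝ ↦ Real.exp (-(R * s)) * (1 + s)) atTop (𝓝 0) := by
      have := (Real.tendsto_exp_neg_atTop_nhds_zero.comp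
        (tendsto_id.atTop_mul_const hs)).mul_const (1 + s)
      simpa using this
    have h₂ : Tendsto (fun R : ℝ ↦ Real.exp (-(R * s)) * (Real.cos R + s * Real.sin R))
        atTop (𝓝 0) := by
      refine squeeze_zero_norm (fun R ↦ ?_) h₁
      rw [norm_mul, Real.norm_eq_abs, Real.norm_eq_abs, Real.abs_exp]
      gcongr
      exact hbound hs
    simpa using (h₂.const_sub 1).div_const (1 + s ^ 2)

lemma tendsto_intervalIntegral_mul_sinc (t : ℝ) :
    Tendsto (fun R : ℝ ↦ ∫ x in (-R)..R, t * Real.sinc (t * x)) atTop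
      (𝓝 (Real.pi * SignType.sign t)) := by
  have hscale (t R : ℝ) : ∫ x in (-R)..R, t * Real.sinc (t * x) =
      2 * ∫ x in (0 : ℝ)..(t * R), Real.sinc x := by
    rw [intervalIntegral.integral_const_mul, intervalIntegral.mul_integral_comp_mul_left]
    have hc (a b : ℝ) : IntervalIntegrable Real.sinc volume a b :=
      Real.continuous_sinc.intervalIntegrable a b
    rw [← intervalIntegral.integral_add_adjacent_intervals (hc _ 0) (hc 0 _), mul_neg]
    have := intervalIntegral.integral_comp_neg (a := -(t * R)) (b := 0) Real.sinc
    simp only [Real.sinc_neg, neg_neg, neg_zero] at this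
    rw [this]; ring
  have hpos {t : ℝ} (ht : 0 < t) : Tendsto (fun R : ℝ ↦ ∫ x in (-R)..R, t * Real.sinc (t * x))
      atTop (𝓝 Real.pi) := by
    simp_rw [hscale]
    have := (tendsto_intervalIntegral_sinc_atTop.comp
      (tendsto_id.const_mul_atTop ht)).const_mul 2
    rwa [mul_div_cancel₀ _ two_ne_zero] at this
  rcases lt_trichotomy t 0 with ht | rfl | ht
  · have := (hpos (neg_pos.mpr ht)).neg
    simpa [ht, neg_mul, Real.sinc_neg] using this
  · simp
  · simpa [ht] using hpos ht

open scoped SchwartzMap FourierTransform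

lemma SchwartzMap.exists_norm_iteratedDeriv_le (f : 𝓢(ℝ, ℂ)) (j k : ℕ) :
    ∃ C : ℝ, 0 ≤ C ∧ ∀ x : ℝ, ‖iteratedDeriv j f x‖ ≤ C * (1 + x ^ 2) ^ (-(k : ℝ) / 2) := by
  refine ⟨2 ^ k * (Finset.Iic (k, j)).sup (fun m ↦ SchwartzMap.seminorm ℝ m.1 m.2) f,
    mul_nonneg (by positivity) (apply_nonneg _ _), fun x ↦ ?_⟩
  have h := SchwartzMap.one_add_le_sup_seminorm_apply (𝕜 := ℝ) (m := (k, j)) le_rfl le_rfl f x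
  rw [norm_iteratedFDeriv_eq_norm_iteratedDeriv] at h
  have hpos : 0 < 1 + x ^ 2 := by positivity
  have hle : (1 + x ^ 2) ^ ((k : ℝ) / 2) ≤ (1 + ‖x‖) ^ k := by
    rw [div_eq_inv_mul, Real.rpow_mul hpos.le, Real.rpow_natCast, ← one_div,
      ← Real.sqrt_eq_rpow]
    gcongr
    simpa using sqrt_one_add_norm_sq_le x
  rw [neg_div, Real.rpow_neg hpos.le, ← div_eq_mul_inv, le_div_iff₀ (by positivity), mul_comm]
  exact (mul_le_mul_of_nonneg_right hle (norm_nonneg _)).trans h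

lemma SchwartzMap.exists_norm_integral_Ioi_le (f : 𝓢(ℝ, ℂ)) (k : ℕ) :
    ∃ C : ℝ, 0 ≤ C ∧ ∀ x : ℝ, 0 < x →
      ‖∫ s in Set.Ioi x, f s‖ ≤ C * (1 + x ^ 2) ^ (-(k : ℝ) / 2) := by
  obtain ⟨C, hC, h⟩ := f.exists_norm_iteratedDeriv_le 0 (k + 2)
  refine ⟨C * Real.pi, by positivity, fun x hx ↦ ?_⟩
  set D := C * (1 + x ^ 2) ^ (-(k : ℝ) / 2)
  have hint : Integrable fun s : ℝ ↦ D * (1 + s ^ 2)⁻¹ := integrable_inv_one_add_sq.const_mul D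
  have hD : 0 ≤ D := by positivity
  calc ‖∫ s in Set.Ioi x, f s‖ ≤ ∫ s in Set.Ioi x, D * (1 + s ^ 2)⁻¹ := by
        refine norm_integral_le_of_norm_le hint.integrableOn ?_
        filter_upwards [ae_restrict_mem measurableSet_Ioi] with s (hs : x < s)
        have hpos : 0 < 1 + s ^ 2 := by positivity
        have h' := h s
        rw [iteratedDeriv_zero, show -((k + 2 : ℕ) : ℝ) / 2 = -(k : ℝ) / 2 + -1 by push_cast; ring,
          Real.rpow_add hpos, Real.rpow_neg_one, ← mul_assoc] at h'
        refine h'.trans ?_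
        refine mul_le_mul_of_nonneg_right (mul_le_mul_of_nonneg_left ?_ hC) (by positivity)
        refine Real.rpow_le_rpow_of_nonpos (by positivity) (by gcongr) ?_
        have : (0 : ℝ) ≤ k := k.cast_nonneg
        linarith
    _ ≤ ∫ s, D * (1 + s ^ 2)⁻¹ :=
        setIntegral_le_integral hint (ae_of_all _ fun s ↦ by positivity)
    _ = C * Real.pi * (1 + x ^ 2) ^ (-(k : ℝ) / 2) := by
        rw [integral_const_mul, integral_univ_inv_one_add_sq]
        ring

lemma SchwartzMap.hasDerivAt_const_add_primitive (h : 𝓢(ℝ, ℂ)) (c : ℂ) (x : ℝ) :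
    HasDerivAt (fun x ↦ c + ∫ s in (0 : ℝ)..x, h s) (h x) x :=
  (intervalIntegral.integral_hasDerivAt_right (h.continuous.intervalIntegrable _ _)
    h.continuous.aestronglyMeasurable.stronglyMeasurableAtFilter h.continuous.continuousAt).const_add c

lemma SchwartzMap.contDiff_const_add_primitive (h : 𝓢(ℝ, ℂ)) (c : ℂ) :
    ContDiff ℝ (⊤ : ℕ∞) (fun x ↦ c + ∫ s in (0 : ℝ)..x, h s) := by
  rw [contDiff_infty_iff_deriv]
  refine ⟨fun x ↦ (h.hasDerivAt_const_add_primitive c x).differentiableAt, ?_⟩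
  rw [deriv_eq (h.hasDerivAt_const_add_primitive c)]
  exact h.smooth ⊤

/-- If `W` agrees on an open set with a primitive of a Schwartz function and decays rapidly there,
then so do all its derivatives. -/
lemma SchwartzMap.exists_norm_iteratedDerivWithin_le_of_eqOn_primitive (h : 𝓢(ℝ, ℂ)) {c : ℂ}
    {s : Set ℝ} (hs : IsOpen s) {W : ℝ → ℂ} (hW : s.EqOn W fun x ↦ c + ∫ y in (0 : ℝ)..x, h y)
    (hdecay : ∀ k : ℕ, ∃ C : ℝ, 0 ≤ C ∧ ∀ x ∈ s, ‖W x‖ ≤ C * (1 + x ^ 2) ^ (-(k : ℝ) / 2))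
    (j k : ℕ) :
    ∃ C : ℝ, 0 ≤ C ∧ ∀ x ∈ s,
      ‖iteratedDerivWithin j W s x‖ ≤ C * (1 + x ^ 2) ^ (-(k : ℝ) / 2) := by
  cases j with
  | zero => simpa using hdecay k
  | succ j =>
    obtain ⟨C, hC, hb⟩ := h.exists_norm_iteratedDeriv_le j k
    refine ⟨C, hC, fun x hx ↦ ?_⟩
    rw [iteratedDerivWithin_congr hW hx, iteratedDerivWithin_of_isOpen hs hx, iteratedDeriv_succ',
      deriv_eq (h.hasDerivAt_const_add_primitive c)]
    exact hb x

/-- The inverse Fourier transform, with the convention `(2π)⁻¹ ∫ e^{itx} χ(x) dx`, of a Schwartz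
function is a Schwartz function of integral `χ 0`. -/
lemma SchwartzMap.exists_inv_fourier (χ : 𝓢(ℝ, ℂ)) :
    ∃ f : 𝓢(ℝ, ℂ),
      (∀ t : ℝ, f t = (2 * Real.pi : ℂ)⁻¹ * ∫ x : ℝ, Complex.exp (Complex.I * t * x) * χ x) ∧
      ∫ t, f t = χ 0 := by
  have hpi : (2 * Real.pi)⁻¹ ≠ 0 := by positivity
  refine ⟨(2 * Real.pi : ℂ)⁻¹ • SchwartzMap.compCLMOfContinuousLinearEquiv ℂ
    (ContinuousLinearEquiv.unitsEquivAut ℝ (Units.mk0 _ hpi)) (𝓕⁻ χ), fun t ↦ ?_, ?_⟩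
  · simp only [smul_apply, SchwartzMap.compCLMOfContinuousLinearEquiv_apply,
      Function.comp_apply, SchwartzMap.fourierInv_coe, Real.fourierInv_eq', smul_eq_mul]
    congr! 5 with x
    simp
    field_simp
  · have h₁ : ∫ t, (𝓕⁻ χ) t = χ 0 := by
      have h : 𝓕 (𝓕⁻ χ) 0 = χ 0 := by rw [FourierTransform.fourier_fourierInv_eq]
      rw [SchwartzMap.fourier_coe, Real.fourier_eq'] at h
      simpa using h
    simp only [smul_apply, SchwartzMap.compCLMOfContinuousLinearEquiv_apply,
      Function.comp_apply, smul_eq_mul, integral_const_mul,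
      ContinuousLinearEquiv.unitsEquivAut_apply, Units.val_mk0]
    rw [Measure.integral_comp_mul_right (𝓕⁻ χ : 𝓢(ℝ, ℂ)), h₁, inv_inv,
      abs_of_pos (by positivity)]
    simp
    field_simp

lemma intervalIntegral_symm_eq_zero_of_odd {g : ℝ → ℂ} (hg : ∀ x, g (-x) = -g x) (R : ℝ) :
    ∫ x in (-R)..R, g x = 0 := by
  have h := intervalIntegral.integral_comp_neg (a := -R) (b := R) g
  simp only [hg, intervalIntegral.integral_neg, neg_neg] at h
  exact self_eq_neg.mp h.symm

lemma intervalIntegral_zero_neg_of_even {g : ℝ → ℂ} (hg : ∀ x, g (-x) = g x) (t : ℝ) :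
    ∫ x in (0 : ℝ)..(-t), g x = -∫ x in (0 : ℝ)..t, g x := by
  have h := intervalIntegral.integral_comp_neg (a := 0) (b := t) g
  simp only [hg, neg_zero] at h
  rw [h, intervalIntegral.integral_symm]

lemma integral_Ioi_zero_of_even {g : ℝ → ℂ} (hg : ∀ x, g (-x) = g x) (hint : Integrable g) :
    ∫ x in Set.Ioi (0 : ℝ), g x = (∫ x, g x) / 2 := by
  have h := integral_comp_neg_Iic 0 g
  simp only [hg, neg_zero] at h
  rw [← intervalIntegral.integral_Iic_add_Ioi hint.integrableOn hint.integrableOn (b := 0), h]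
  ring

lemma intervalIntegral_exp_symm (t x : ℝ) :
    ∫ s in (-t)..t, Complex.exp (Complex.I * s * x) = 2 * (t * Real.sinc (t * x) : ℝ) := by
  rcases eq_or_ne x 0 with rfl | hx
  · simp; ring
  · have h := intervalIntegral.integral_comp_mul_right (a := -t) (b := t)
      (fun s : ℝ ↦ Complex.exp (s * Complex.I)) hx
    rw [neg_mul, integral_exp_mul_I_eq_sinc] at h
    convert! h using 1
    · refine intervalIntegral.integral_congr fun s _ ↦ ?_
      congr 1; push_cast; ring
    · rw [Complex.real_smul]; push_cast
      have : (x : ℂ) ≠ 0 := by exact_mod_cast hx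
      field_simp

lemma intervalIntegral_inv_fourier_eq {χ f : 𝓢(ℝ, ℂ)}
    (hf : ∀ t : ℝ, f t = (2 * Real.pi : ℂ)⁻¹ * ∫ x : ℝ, Complex.exp (Complex.I * t * x) * χ x)
    (hf_even : ∀ t, f (-t) = f t) (t : ℝ) :
    ∫ s in (0 : ℝ)..t, f s =
      (2 * Real.pi : ℂ)⁻¹ * ∫ x : ℝ, (t * Real.sinc (t * x) : ℝ) * χ x := by
  have hc (a b : ℝ) : IntervalIntegrable f volume a b := f.continuous.intervalIntegrable a b
  have hsymm : ∫ s in (-t)..t, f s = 2 * ∫ s in (0 : ℝ)..t, f s := by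
    rw [← intervalIntegral.integral_add_adjacent_intervals (hc _ 0) (hc 0 _),
      intervalIntegral.integral_symm, intervalIntegral_zero_neg_of_even hf_even]
    ring
  have hswap : ∫ s in (-t)..t, ∫ x : ℝ, Complex.exp (Complex.I * s * x) * χ x =
      ∫ x : ℝ, ∫ s in (-t)..t, Complex.exp (Complex.I * s * x) * χ x := by
    refine intervalIntegral_integral_swap ?_
    have : IsFiniteMeasure (volume.restrict (Set.uIoc (-t) t)) := by
      unfold Set.uIoc
      infer_instance
    have hχ : Integrable (fun p : ℝ × ℝ ↦ χ p.2)
        ((volume.restrict (Set.uIoc (-t) t)).prod volume) := χ.integrable.comp_snd _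
    refine hχ.mono (Continuous.aestronglyMeasurable ?_) (ae_of_all _ fun p ↦ ?_)
    · have := χ.continuous
      unfold Function.uncurry
      fun_prop
    · simp [Function.uncurry, Complex.norm_exp]
  have h : 2 * ∫ s in (0 : ℝ)..t, f s =
      2 * ((2 * Real.pi : ℂ)⁻¹ * ∫ x : ℝ, (t * Real.sinc (t * x) : ℝ) * χ x) := by
    rw [← hsymm]
    simp_rw [hf, intervalIntegral.integral_const_mul, hswap, intervalIntegral.integral_mul_const,
      intervalIntegral_exp_symm, mul_assoc, integral_const_mul]
    ring
  exact mul_left_cancel₀ two_ne_zero h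

lemma intervalIntegral_exp_mul_one_sub_div {χ : ℝ → ℝ} (hχ : Continuous χ)
    (hχ_even : ∀ x, χ (-x) = χ x) (hχ_one : ∀ᶠ x in 𝓝 (0 : ℝ), χ x = 1) (t R : ℝ) :
    ∫ x in (-R)..R, Complex.exp (Complex.I * t * x) * (((1 - χ x) / x : ℝ) : ℂ) =
      Complex.I * ∫ x in (-R)..R, ((t * Real.sinc (t * x) * (1 - χ x) : ℝ) : ℂ) := by
  have hq : Continuous fun x ↦ (1 - χ x) / x := by
    refine continuous_iff_continuousAt.mpr fun x ↦ ?_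
    rcases eq_or_ne x 0 with rfl | hx
    · refine (continuousAt_const (y := (0 : ℝ))).congr ?_
      filter_upwards [hχ_one] with x hx
      simp [hx]
    · exact ContinuousAt.div (by fun_prop) continuousAt_id hx
  have hsplit (x : ℝ) : Complex.exp (Complex.I * t * x) * (((1 - χ x) / x : ℝ) : ℂ) =
      ((Real.cos (t * x) * ((1 - χ x) / x) : ℝ) : ℂ) +
        Complex.I * ((t * Real.sinc (t * x) * (1 - χ x) : ℝ) : ℂ) := by
    have hsin : Real.sin (t * x) * ((1 - χ x) / x) = t * Real.sinc (t * x) * (1 - χ x) := by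
      rcases eq_or_ne x 0 with rfl | hx
      · simp [hχ_one.self_of_nhds]
      rcases eq_or_ne t 0 with rfl | ht
      · simp
      rw [Real.sinc_of_ne_zero (mul_ne_zero ht hx)]
      field_simp
    rw [← hsin, show Complex.I * t * x = ((t * x : ℝ) : ℂ) * Complex.I by push_cast; ring,
      Complex.exp_mul_I, ← Complex.ofReal_cos, ← Complex.ofReal_sin]
    push_cast
    ring
  have hsinc := Real.continuous_sinc
  simp_rw [hsplit]
  rw [intervalIntegral.integral_add (Continuous.intervalIntegrable (by fun_prop) _ _)
    (Continuous.intervalIntegrable (by fun_prop) _ _), intervalIntegral_symm_eq_zero_of_odd, zero_add,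
    intervalIntegral.integral_const_mul]
  intro x
  rw [mul_neg, Real.cos_neg, hχ_even, div_neg, mul_neg, Complex.ofReal_neg]

lemma tendsto_inv_fourier_one_sub_div {χ : ℝ → ℝ} (hχ : Continuous χ)
    (hχ_supp : HasCompactSupport χ) (hχ_even : ∀ x, χ (-x) = χ x)
    (hχ_one : ∀ᶠ x in 𝓝 (0 : ℝ), χ x = 1) (t : ℝ) :
    Tendsto (fun R : ℝ ↦ (2 * Real.pi : ℂ)⁻¹ *
        ∫ x in (-R)..R, Complex.exp (Complex.I * t * x) * (((1 - χ x) / x : ℝ) : ℂ)) atTop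
      (𝓝 ((SignType.sign t : ℂ) * (Complex.I / 2) - Complex.I * ((2 * Real.pi : ℂ)⁻¹ *
        ∫ x : ℝ, ((t * Real.sinc (t * x) : ℝ) : ℂ) * (χ x : ℂ)))) := by
  have hsinc := Real.continuous_sinc
  have hcont : Continuous fun x ↦ t * Real.sinc (t * x) * χ x := by fun_prop
  have hlim := ((tendsto_intervalIntegral_mul_sinc t).sub
    (intervalIntegral_tendsto_integral (μ := volume)
      (hcont.integrable_of_hasCompactSupport hχ_supp.mul_left)
      tendsto_neg_atTop_atBot tendsto_id)).ofReal
  have hlim' := (hlim.const_mul Complex.I).const_mul (2 * Real.pi : ℂ)⁻¹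
  convert hlim' using 2 with R
  · rw [intervalIntegral_exp_mul_one_sub_div hχ hχ_even hχ_one, intervalIntegral.integral_ofReal]
    simp_rw [mul_sub, mul_one]
    rw [intervalIntegral.integral_sub (Continuous.intervalIntegrable (by fun_prop) _ _)
      (Continuous.intervalIntegrable (by fun_prop) _ _)]
    rfl
  · rw [Complex.ofReal_sub, ← integral_complex_ofReal]
    have hpi : (Real.pi : ℂ) ≠ 0 := by exact_mod_cast Real.pi_ne_zero
    have hsign : (((SignType.sign t : ℝ)) : ℂ) = (SignType.sign t : ℂ) := by
      cases SignType.sign t <;> simp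
    push_cast
    rw [hsign]
    field_simp

/-- Let `χ₀ : ℝ → ℝ` be smooth, compactly supported, even, and equal to `1` near `0`.
Then the symmetric improper integrals `W(t) := lim_{R→∞} (2π)⁻¹ ∫_{−R}^{R} e^{itx}(1−χ₀(x))/x dx`
(the inverse Fourier transform of the regularized principal value `(1−χ₀)·pv x⁻¹`) define a
function `W` that: exists everywhere; is smooth on `(0,∞)` and on `(−∞,0)`; has the one-sided
limits `±i/2` at `0`; and all of whose one-sided derivatives have rapid decay:
`|W^{(j)}(x)| ≤ C_{j,k} ⟨x⟩^{−k}` for all `j, k`. -/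
theorem inv_fourier_regularized_pv (χ₀ : ℝ → ℝ)
    (hχ_smooth : ContDiff ℝ (⊤ : ℕ∞) χ₀) (hχ_supp : HasCompactSupport χ₀)
    (hχ_even : ∀ x : ℝ, χ₀ (-x) = χ₀ x) (hχ_one : ∀ᶠ x in 𝓝 (0 : ℝ), χ₀ x = 1) :
    ∃ W : ℝ → ℂ,
      (∀ t : ℝ, Tendsto (fun R : ℝ => (2 * Real.pi : ℂ)⁻¹ *
            ∫ x in (-R)..R, Complex.exp (Complex.I * (t : ℂ) * (x : ℂ)) * (((1 - χ₀ x) / x : ℝ) : ℂ))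
          atTop (𝓝 (W t))) ∧
      ContDiffOn ℝ (⊤ : ℕ∞) W (Set.Ioi 0) ∧
      ContDiffOn ℝ (⊤ : ℕ∞) W (Set.Iio 0) ∧
      Tendsto W (𝓝[>] 0) (𝓝 (Complex.I / 2)) ∧
      Tendsto W (𝓝[<] 0) (𝓝 (-(Complex.I / 2))) ∧
      (∀ j k : ℕ, ∃ C : ℝ, 0 ≤ C ∧
        (∀ x : ℝ, 0 < x →
          ‖iteratedDerivWithin j W (Set.Ioi 0) x‖ ≤ C * (1 + x ^ 2) ^ (-(k : ℝ) / 2)) ∧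
        (∀ x : ℝ, x < 0 →
          ‖iteratedDerivWithin j W (Set.Iio 0) x‖ ≤ C * (1 + x ^ 2) ^ (-(k : ℝ) / 2))) := by
  set χ : 𝓢(ℝ, ℂ) := HasCompactSupport.toSchwartzMap (f := fun x ↦ (χ₀ x : ℂ))
    (hχ_supp.comp_left Complex.ofReal_zero) (Complex.ofRealCLM.contDiff.comp hχ_smooth)
  have hχ_apply (x : ℝ) : χ x = χ₀ x := rfl
  have hχ_even' (x : ℝ) : χ (-x) = χ x := by rw [hχ_apply, hχ_apply, hχ_even]
  obtain ⟨f, hf, hf_int⟩ := χ.exists_inv_fourier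
  have hf_even (t : ℝ) : f (-t) = f t := by
    rw [hf, hf, ← integral_neg_eq_self]
    simp [hχ_even']
  rw [hχ_apply, hχ_one.self_of_nhds, Complex.ofReal_one] at hf_int
  set h : 𝓢(ℝ, ℂ) := -Complex.I • f
  have hh (t : ℝ) : h t = -Complex.I * f t := rfl
  have hh_even (t : ℝ) : h (-t) = h t := by rw [hh, hh, hf_even]
  have hh_Ioi : ∫ s in Set.Ioi (0 : ℝ), h s = -(Complex.I / 2) := by
    rw [integral_Ioi_zero_of_even hh_even h.integrable]
    simp_rw [hh]
    rw [integral_const_mul, hf_int]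
    ring
  set W : ℝ → ℂ := fun t ↦ (SignType.sign t : ℂ) * (Complex.I / 2) + ∫ s in (0 : ℝ)..t, h s
  have hW_pos : (Set.Ioi 0).EqOn W fun x ↦ Complex.I / 2 + ∫ s in (0 : ℝ)..x, h s := by
    intro x (hx : 0 < x)
    simp [W, hx]
  have hW_neg : (Set.Iio 0).EqOn W fun x ↦ -(Complex.I / 2) + ∫ s in (0 : ℝ)..x, h s := by
    intro x (hx : x < 0)
    simp [W, hx]
  have hW_odd (x : ℝ) : W (-x) = -W x := by
    simp only [W, Left.sign_neg, intervalIntegral_zero_neg_of_even hh_even]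
    push_cast
    ring
  have hW_tail {x : ℝ} (hx : 0 < x) : W x = -∫ s in Set.Ioi x, h s := by
    rw [hW_pos hx]
    have := intervalIntegral.integral_interval_add_Ioi
      (h.integrable (μ := volume)).integrableOn (h.integrable (μ := volume)).integrableOn
      (a := 0) (b := x)
    rw [hh_Ioi] at this
    linear_combination this
  have hdecay_pos (k : ℕ) : ∃ C : ℝ, 0 ≤ C ∧
      ∀ x ∈ Set.Ioi (0 : ℝ), ‖W x‖ ≤ C * (1 + x ^ 2) ^ (-(k : ℝ) / 2) := by
    obtain ⟨C, hC, hb⟩ := h.exists_norm_integral_Ioi_le k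
    refine ⟨C, hC, fun x hx ↦ ?_⟩
    rw [hW_tail hx, norm_neg]
    exact hb x hx
  have hdecay_neg (k : ℕ) : ∃ C : ℝ, 0 ≤ C ∧
      ∀ x ∈ Set.Iio (0 : ℝ), ‖W x‖ ≤ C * (1 + x ^ 2) ^ (-(k : ℝ) / 2) := by
    obtain ⟨C, hC, hb⟩ := hdecay_pos k
    refine ⟨C, hC, fun x (hx : x < 0) ↦ ?_⟩
    have := hb (-x) (Set.mem_Ioi.mpr (neg_pos.mpr hx))
    rwa [hW_odd, norm_neg, neg_sq] at this
  have hlim (c : ℂ) (s : Set ℝ) : Tendsto (fun x ↦ c + ∫ y in (0 : ℝ)..x, h y) (𝓝[s] 0) (𝓝 c) := by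
    have := (h.contDiff_const_add_primitive c).continuous.continuousWithinAt (s := s) (x := 0)
    simpa [ContinuousWithinAt] using this
  refine ⟨W, fun t ↦ ?_, (h.contDiff_const_add_primitive _).contDiffOn.congr hW_pos,
    (h.contDiff_const_add_primitive _).contDiffOn.congr hW_neg,
    (hlim _ _).congr' (eventuallyEq_nhdsWithin_of_eqOn hW_pos).symm,
    (hlim _ _).congr' (eventuallyEq_nhdsWithin_of_eqOn hW_neg).symm, fun j k ↦ ?_⟩
  · convert tendsto_inv_fourier_one_sub_div hχ_smooth.continuous hχ_supp hχ_even hχ_one t using 2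
    simp only [W, hh, intervalIntegral.integral_const_mul,
      intervalIntegral_inv_fourier_eq hf hf_even, hχ_apply]
    ring
  · obtain ⟨C₁, hC₁, hb₁⟩ :=
      h.exists_norm_iteratedDerivWithin_le_of_eqOn_primitive isOpen_Ioi hW_pos hdecay_pos j k
    obtain ⟨C₂, hC₂, hb₂⟩ :=
      h.exists_norm_iteratedDerivWithin_le_of_eqOn_primitive isOpen_Iio hW_neg hdecay_neg j k
    refine ⟨max C₁ C₂, le_max_of_le_left hC₁, fun x hx ↦ (hb₁ x hx).trans ?_,
      fun x hx ↦ (hb₂ x hx).trans ?_⟩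
    · gcongr
      exact le_max_left _ _
    · gcongr
      exact le_max_right _ _
end

section
/- Let L ∈ ℝ and let u : ℝ → ℝ be continuous such that there exist constants C ≥ 0 and ε > 0 with ⟨x⟩^ε |x·u(x) − L| ≤ C for all x ∈ ℝ. Then: (a) the function x ↦ u(x) + u(−x) is Lebesgue integrable on ℝ; (b) x·u(x) → L as x → +∞ and as x → −∞; (c) for every t ∈ ℝ the symmetric limit v(t) := lim_{R→∞} (2π)⁻¹ ∫_{−R}^{R} e^{itx} u(x) dx exists in ℂ; (d) v(t) → i·L/2 + (4π)⁻¹ ∫_ℝ (u(x) + u(−x)) dx as t → 0⁺, and v(t) → −i·L/2 + (4π)⁻¹ ∫_ℝ (u(x) + u(−x)) dx as t → 0⁻. In particular the one-sided limits of v at 0 differ by i·L. -/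
open MeasureTheory Filter Topology

lemma integral_exp_neg_mul_sin (R s : ℝ) :
    ∫ x in (0 : ℝ)..R, Real.exp (-(s * x)) * Real.sin x =
      (1 + s ^ 2)⁻¹ - Real.exp (-(s * R)) * (Real.cos R + s * Real.sin R) / (1 + s ^ 2) := by
  have hs : 1 + s ^ 2 ≠ 0 := by positivity
  have hderiv (x : ℝ) : HasDerivAt
      (fun x => -(Real.exp (-(s * x)) * (Real.cos x + s * Real.sin x) / (1 + s ^ 2)))
      (Real.exp (-(s * x)) * Real.sin x) x := by
    have h1 : HasDerivAt (fun x => Real.exp (-(s * x))) (Real.exp (-(s * x)) * (-(s * 1))) x :=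
      ((hasDerivAt_id x).const_mul s).neg.exp
    have h2 : HasDerivAt (fun x => Real.cos x + s * Real.sin x)
        (-Real.sin x + s * Real.cos x) x :=
      (Real.hasDerivAt_cos x).add ((Real.hasDerivAt_sin x).const_mul s)
    refine ((h1.mul h2).div_const (1 + s ^ 2)).neg.congr_deriv ?_
    field_simp
    ring
  rw [intervalIntegral.integral_eq_sub_of_hasDerivAt (fun x _ => hderiv x)
    (Continuous.intervalIntegrable (by fun_prop) _ _)]
  simp
  ring

lemma integrableOn_exp_neg_mul {R : ℝ} (hR : 0 < R) :
    IntegrableOn (fun s : ℝ => Real.exp (-(s * R))) (Set.Ioi 0) := by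
  simpa [mul_comm] using exp_neg_integrableOn_Ioi 0 hR

lemma integral_exp_neg_mul {R : ℝ} (hR : 0 < R) :
    ∫ s in Set.Ioi (0 : ℝ), Real.exp (-(s * R)) = R⁻¹ := by
  have := integral_exp_mul_Ioi (a := -R) (by linarith) 0
  simpa [mul_comm, neg_div] using this

lemma abs_exp_neg_mul_cos_add_sin_le (R s : ℝ) (hs : 0 ≤ s) :
    |Real.exp (-(s * R)) * (Real.cos R + s * Real.sin R) / (1 + s ^ 2)| ≤
      2 * Real.exp (-(s * R)) := by
  have hpos : 0 < 1 + s ^ 2 := by positivity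
  rw [abs_div, abs_of_pos hpos, div_le_iff₀ hpos, abs_mul, abs_of_pos (Real.exp_pos _)]
  have h : |Real.cos R + s * Real.sin R| ≤ 1 + s := by
    refine (abs_add_le _ _).trans (add_le_add (Real.abs_cos_le_one R) ?_)
    rw [abs_mul, abs_of_nonneg hs]
    exact mul_le_of_le_one_right hs (Real.abs_sin_le_one R)
  have h' : |Real.cos R + s * Real.sin R| ≤ 2 * (1 + s ^ 2) :=
    h.trans (by nlinarith [sq_nonneg (s - 1)])
  nlinarith [Real.exp_pos (-(s * R))]

lemma integrable_exp_neg_mul_sin_prod (R : ℝ) :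
    Integrable (Function.uncurry fun x s : ℝ => Real.exp (-(s * x)) * Real.sin x)
      ((volume.restrict (Set.Ioc 0 R)).prod (volume.restrict (Set.Ioi 0))) := by
  refine (integrable_prod_iff (Continuous.aestronglyMeasurable
    (by unfold Function.uncurry; fun_prop))).2 ⟨?_, ?_⟩
  · filter_upwards [ae_restrict_mem measurableSet_Ioc] with x hx
    exact (integrableOn_exp_neg_mul hx.1).mul_const (Real.sin x)
  · refine Integrable.congr (f := fun x => |Real.sinc x|)
      (Real.continuous_sinc.abs.integrableOn_Ioc) ?_
    filter_upwards [ae_restrict_mem measurableSet_Ioc] with x hx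
    simp only [Function.uncurry, norm_mul, Real.norm_eq_abs, Real.abs_exp]
    rw [integral_mul_const, integral_exp_neg_mul hx.1, Real.sinc_of_ne_zero hx.1.ne', abs_div,
      abs_of_pos hx.1]
    ring

/-- The sine integral as a Laplace-type integral. -/
lemma integral_sinc_eq {R : ℝ} (hR : 0 < R) :
    ∫ x in (0 : ℝ)..R, Real.sinc x = Real.pi / 2 -
      ∫ s in Set.Ioi (0 : ℝ),
        Real.exp (-(s * R)) * (Real.cos R + s * Real.sin R) / (1 + s ^ 2) := by
  have hint : IntegrableOn (fun s : ℝ =>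
      Real.exp (-(s * R)) * (Real.cos R + s * Real.sin R) / (1 + s ^ 2)) (Set.Ioi 0) := by
    refine ((integrableOn_exp_neg_mul hR).const_mul 2).mono'
      (Continuous.aestronglyMeasurable ?_) ?_
    · exact Continuous.div (by fun_prop) (by fun_prop) fun s => by positivity
    · filter_upwards [ae_restrict_mem measurableSet_Ioi] with s hs
      exact abs_exp_neg_mul_cos_add_sin_le R s hs.le
  calc ∫ x in (0 : ℝ)..R, Real.sinc x
      = ∫ x in Set.Ioc 0 R, ∫ s in Set.Ioi (0 : ℝ), Real.exp (-(s * x)) * Real.sin x := by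
        rw [intervalIntegral.integral_of_le hR.le]
        refine setIntegral_congr_fun measurableSet_Ioc fun x hx => ?_
        rw [integral_mul_const, integral_exp_neg_mul hx.1, Real.sinc_of_ne_zero hx.1.ne']
        ring
    _ = ∫ s in Set.Ioi (0 : ℝ), ∫ x in Set.Ioc 0 R, Real.exp (-(s * x)) * Real.sin x :=
        integral_integral_swap (integrable_exp_neg_mul_sin_prod R)
    _ = ∫ s in Set.Ioi (0 : ℝ), ((1 + s ^ 2)⁻¹ -
          Real.exp (-(s * R)) * (Real.cos R + s * Real.sin R) / (1 + s ^ 2)) := by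
        simp_rw [← intervalIntegral.integral_of_le hR.le, integral_exp_neg_mul_sin]
    _ = _ := by
        rw [integral_sub integrable_inv_one_add_sq.integrableOn hint,
          integral_Ioi_inv_one_add_sq]
        simp

/-- The Dirichlet integral. -/
lemma tendsto_integral_sinc :
    Tendsto (fun R : ℝ => ∫ x in (0 : ℝ)..R, Real.sinc x) atTop (𝓝 (Real.pi / 2)) := by
  have hlim : Tendsto (fun R : ℝ => 2 * R⁻¹) atTop (𝓝 0) := by
    simpa using tendsto_inv_atTop_zero.const_mul (2 : ℝ)
  rw [tendsto_iff_norm_sub_tendsto_zero]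
  refine squeeze_zero' (Eventually.of_forall fun _ => norm_nonneg _) ?_ hlim
  filter_upwards [eventually_gt_atTop 0] with R hR
  rw [integral_sinc_eq hR, sub_sub_cancel_left, norm_neg, ← integral_exp_neg_mul hR,
    ← integral_const_mul]
  refine norm_integral_le_of_norm_le ((integrableOn_exp_neg_mul hR).const_mul 2) ?_
  filter_upwards [ae_restrict_mem measurableSet_Ioi] with s hs
  exact abs_exp_neg_mul_cos_add_sin_le R s (le_of_lt hs)

lemma integral_sinc_neg (R : ℝ) :
    ∫ x in (0 : ℝ)..(-R), Real.sinc x = -∫ x in (0 : ℝ)..R, Real.sinc x := by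
  have h := intervalIntegral.integral_comp_neg (a := 0) (b := R) Real.sinc
  simp only [Real.sinc_neg, neg_zero] at h
  rw [h, intervalIntegral.integral_symm]

lemma tendsto_integral_sinc_mul (t : ℝ) :
    Tendsto (fun R : ℝ => ∫ x in (0 : ℝ)..(t * R), Real.sinc x) atTop
      (𝓝 (SignType.sign t * (Real.pi / 2))) := by
  rcases lt_trichotomy t 0 with ht | rfl | ht
  · have h := (tendsto_integral_sinc.comp
      (tendsto_id.const_mul_atTop (neg_pos.2 ht))).neg
    simpa [Function.comp_def, integral_sinc_neg, sign_neg ht] using h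
  · simp
  · simpa [Function.comp_def, sign_pos ht] using
      tendsto_integral_sinc.comp (tendsto_id.const_mul_atTop ht)

lemma integral_sin_mul_div (t : ℝ) {R : ℝ} (hR : 1 ≤ R) :
    ∫ x in (1 : ℝ)..R, Real.sin (t * x) * x⁻¹ =
      (∫ x in (0 : ℝ)..(t * R), Real.sinc x) - ∫ x in (0 : ℝ)..t, Real.sinc x := by
  have hint (a b : ℝ) : IntervalIntegrable Real.sinc volume a b :=
    Real.continuous_sinc.intervalIntegrable a b
  rw [intervalIntegral.integral_interval_sub_left (hint _ _) (hint _ _)]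
  have h := intervalIntegral.mul_integral_comp_mul_left (f := Real.sinc) (a := 1) (b := R) t
  rw [mul_one] at h
  rw [← h, ← intervalIntegral.integral_const_mul]
  refine intervalIntegral.integral_congr fun x hx => ?_
  rw [Set.uIcc_of_le hR] at hx
  have hx0 : x ≠ 0 := by linarith [hx.1]
  rcases eq_or_ne t 0 with rfl | ht
  · simp
  · simp only [Real.sinc_of_ne_zero (mul_ne_zero ht hx0)]
    field_simp

lemma integrable_comp_mul_mul {φ q : ℝ → ℝ} {μ : Measure ℝ} (hφ : Continuous φ)
    (hb : ∀ x, |φ x| ≤ 1) (hq : Integrable q μ) (t : ℝ) :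
    Integrable (fun x => φ (t * x) * q x) μ :=
  hq.bdd_mul (c := 1) (Continuous.aestronglyMeasurable (by fun_prop))
    (Eventually.of_forall fun x => hb (t * x))

lemma continuous_integral_comp_mul_mul {φ q : ℝ → ℝ} {μ : Measure ℝ} (hφ : Continuous φ)
    (hb : ∀ x, |φ x| ≤ 1) (hq : Integrable q μ) :
    Continuous fun t => ∫ x, φ (t * x) * q x ∂μ := by
  refine continuous_of_dominated (bound := fun x => |q x|)
    (fun t => (integrable_comp_mul_mul hφ hb hq t).aestronglyMeasurable)
    (fun t => Eventually.of_forall fun x => ?_) hq.abs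
    (Eventually.of_forall fun x => by fun_prop)
  rw [Real.norm_eq_abs, abs_mul]
  exact mul_le_of_le_one_left (abs_nonneg _) (hb _)

/-- The symmetric Fourier integral split into its cosine and sine parts. -/
lemma integral_cexp_mul_eq_cos_add_sin {u : ℝ → ℝ} (hu : Continuous u) (t R : ℝ) :
    ∫ x in (-R)..R, Complex.exp (Complex.I * (t : ℂ) * (x : ℂ)) * (u x : ℂ) =
      ((∫ x in (0 : ℝ)..R, Real.cos (t * x) * (u x + u (-x)) : ℝ) : ℂ) +
      Complex.I * ((∫ x in (0 : ℝ)..R, Real.sin (t * x) * (u x - u (-x)) : ℝ) : ℂ) := by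
  have hF : Continuous fun x : ℝ =>
      Complex.exp (Complex.I * (t : ℂ) * (x : ℂ)) * (u x : ℂ) := by fun_prop
  have hF' : Continuous fun x : ℝ =>
      Complex.exp (Complex.I * (t : ℂ) * ((-x : ℝ) : ℂ)) * (u (-x) : ℂ) := by fun_prop
  have hneg := intervalIntegral.integral_comp_neg (a := 0) (b := R) fun x : ℝ =>
    Complex.exp (Complex.I * (t : ℂ) * (x : ℂ)) * (u x : ℂ)
  rw [neg_zero] at hneg
  rw [← intervalIntegral.integral_add_adjacent_intervals (hF.intervalIntegrable (-R) 0)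
    (hF.intervalIntegrable 0 R), ← hneg, ← intervalIntegral.integral_add
    (hF'.intervalIntegrable 0 R) (hF.intervalIntegrable 0 R),
    ← intervalIntegral.integral_ofReal, ← intervalIntegral.integral_ofReal,
    ← intervalIntegral.integral_const_mul, ← intervalIntegral.integral_add
      (Continuous.intervalIntegrable (by fun_prop) _ _)
      (Continuous.intervalIntegrable (by fun_prop) _ _)]
  refine intervalIntegral.integral_congr fun x _ => ?_
  have h1 : Complex.I * (t : ℂ) * ((-x : ℝ) : ℂ) = -((t * x : ℂ)) * Complex.I := by
    push_cast; ring
  have h2 : Complex.I * (t : ℂ) * (x : ℂ) = (t * x : ℂ) * Complex.I := by ring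
  simp only [h1, h2, Complex.exp_mul_I, Complex.cos_neg, Complex.sin_neg]
  push_cast
  ring

lemma integral_Ioi_add_comp_neg (u : ℝ → ℝ) :
    ∫ x in Set.Ioi (0 : ℝ), (u x + u (-x)) = 2⁻¹ * ∫ x, (u x + u (-x)) := by
  have h : ∀ x : ℝ, u x + u (-x) = u |x| + u (-|x|) := fun x => by
    rcases abs_choice x with hx | hx <;> simp [hx, add_comm]
  rw [integral_congr_ae (μ := volume) (Eventually.of_forall h),
    integral_comp_abs (f := fun y => u y + u (-y))]
  ring

lemma rpow_le_one_add_sq_rpow {ε x : ℝ} (hε : 0 < ε) (hx : 0 ≤ x) :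
    x ^ ε ≤ (1 + x ^ 2) ^ (ε / 2) := by
  calc x ^ ε = (x ^ 2) ^ (ε / 2) := by
        rw [← Real.rpow_natCast, ← Real.rpow_mul hx]; congr 1; push_cast; ring
    _ ≤ _ := Real.rpow_le_rpow (by positivity) (by linarith) (by positivity)

lemma abs_mul_sub_le_rpow {L C ε : ℝ} {u : ℝ → ℝ} (hε : 0 < ε)
    (hbound : ∀ x : ℝ, (1 + x ^ 2) ^ (ε / 2) * |x * u x - L| ≤ C) {x : ℝ} (hx : x ≠ 0) :
    |x * u x - L| ≤ C * |x| ^ (-ε) := by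
  have hx' : 0 < |x| := abs_pos.2 hx
  rw [Real.rpow_neg hx'.le, ← div_eq_mul_inv, le_div_iff₀ (Real.rpow_pos_of_pos hx' _), mul_comm]
  refine le_trans (mul_le_mul_of_nonneg_right ?_ (abs_nonneg _)) (hbound x)
  simpa using rpow_le_one_add_sq_rpow hε hx'.le

lemma tendsto_mul_self_of_bound {L C ε : ℝ} {u : ℝ → ℝ} (hε : 0 < ε)
    (hbound : ∀ x : ℝ, (1 + x ^ 2) ^ (ε / 2) * |x * u x - L| ≤ C) {l : Filter ℝ}
    (hl : Tendsto (fun x : ℝ => |x|) l atTop) :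
    Tendsto (fun x : ℝ => x * u x) l (𝓝 L) := by
  rw [tendsto_iff_norm_sub_tendsto_zero]
  refine squeeze_zero' (g := fun x => C * |x| ^ (-ε))
    (Eventually.of_forall fun _ => norm_nonneg _) ?_ ?_
  · filter_upwards [hl.eventually_gt_atTop 0] with x hx
    exact abs_mul_sub_le_rpow hε hbound (abs_pos.1 hx)
  · simpa using ((tendsto_rpow_neg_atTop hε).comp hl).const_mul C

lemma abs_le_of_abs_mul_le_rpow {K ε x y : ℝ} (hx : 0 < x) (h : |x * y| ≤ K * x ^ (-ε)) :
    |y| ≤ K * x ^ (-1 - ε) := by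
  rw [abs_mul, abs_of_pos hx] at h
  rw [sub_eq_add_neg, Real.rpow_add hx, Real.rpow_neg_one]
  calc |y| = x⁻¹ * (x * |y|) := by field_simp
    _ ≤ x⁻¹ * (K * x ^ (-ε)) := by gcongr
    _ = _ := by ring

lemma abs_add_comp_neg_le {L C ε : ℝ} {u : ℝ → ℝ} (hε : 0 < ε)
    (hbound : ∀ x : ℝ, (1 + x ^ 2) ^ (ε / 2) * |x * u x - L| ≤ C) {x : ℝ} (hx : 0 < x) :
    |u x + u (-x)| ≤ 2 * C * x ^ (-1 - ε) := by
  refine abs_le_of_abs_mul_le_rpow hx ?_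
  have h1 := abs_mul_sub_le_rpow hε hbound hx.ne'
  have h2 := abs_mul_sub_le_rpow hε hbound (neg_ne_zero.2 hx.ne')
  rw [abs_neg] at h2
  rw [abs_of_pos hx] at h1 h2
  calc |x * (u x + u (-x))| = |(x * u x - L) - (-x * u (-x) - L)| := by congr 1; ring
    _ ≤ |x * u x - L| + |-x * u (-x) - L| := abs_sub _ _
    _ ≤ _ := by linarith

lemma abs_sub_comp_neg_sub_le {L C ε : ℝ} {u : ℝ → ℝ} (hε : 0 < ε)
    (hbound : ∀ x : ℝ, (1 + x ^ 2) ^ (ε / 2) * |x * u x - L| ≤ C) {x : ℝ} (hx : 0 < x) :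
    |u x - u (-x) - 2 * L * x⁻¹| ≤ 2 * C * x ^ (-1 - ε) := by
  refine abs_le_of_abs_mul_le_rpow hx ?_
  have h1 := abs_mul_sub_le_rpow hε hbound hx.ne'
  have h2 := abs_mul_sub_le_rpow hε hbound (neg_ne_zero.2 hx.ne')
  rw [abs_neg] at h2
  rw [abs_of_pos hx] at h1 h2
  calc |x * (u x - u (-x) - 2 * L * x⁻¹)| = |(x * u x - L) + (-x * u (-x) - L)| := by
        congr 1; field_simp; ring
    _ ≤ |x * u x - L| + |-x * u (-x) - L| := abs_add_le _ _
    _ ≤ _ := by linarith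

lemma integrable_add_comp_neg {L C ε : ℝ} {u : ℝ → ℝ} (hu : Continuous u) (hε : 0 < ε)
    (hbound : ∀ x : ℝ, (1 + x ^ 2) ^ (ε / 2) * |x * u x - L| ≤ C) :
    Integrable fun x : ℝ => u x + u (-x) := by
  have hcont : Continuous fun x : ℝ => u x + u (-x) := by fun_prop
  refine hcont.locallyIntegrable.integrable_of_isBigO_atTop_of_norm_isNegInvariant
    (g := fun x => x ^ (-1 - ε)) (Eventually.of_forall fun x => by simp [add_comm]) ?_
    ⟨Set.Ioi 1, Ioi_mem_atTop 1, integrableOn_Ioi_rpow_of_lt (by linarith) one_pos⟩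
  refine Asymptotics.IsBigO.of_bound (2 * C) ?_
  filter_upwards [eventually_gt_atTop 0] with x hx
  rw [Real.norm_of_nonneg (Real.rpow_nonneg hx.le _)]
  exact abs_add_comp_neg_le hε hbound hx

lemma integrableOn_sub_comp_neg_sub {L C ε : ℝ} {u : ℝ → ℝ} (hu : Continuous u) (hε : 0 < ε)
    (hbound : ∀ x : ℝ, (1 + x ^ 2) ^ (ε / 2) * |x * u x - L| ≤ C) :
    IntegrableOn (fun x : ℝ => u x - u (-x) - 2 * L * x⁻¹) (Set.Ioi 1) := by
  refine ((integrableOn_Ioi_rpow_of_lt (a := -1 - ε) (by linarith) one_pos).const_mul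
    (2 * C)).mono' (by fun_prop) ?_
  filter_upwards [ae_restrict_mem measurableSet_Ioi] with x hx
  exact abs_sub_comp_neg_sub_le hε hbound (one_pos.trans hx)

/-- Limit of the sine part: the `1/x` tail is evaluated by the Dirichlet integral. -/
lemma tendsto_integral_sin_mul {w : ℝ → ℝ} {K : ℝ} (hw : Continuous w)
    (hg : IntegrableOn (fun x : ℝ => w x - K * x⁻¹) (Set.Ioi 1)) (t : ℝ) :
    Tendsto (fun R : ℝ => ∫ x in (0 : ℝ)..R, Real.sin (t * x) * w x) atTop
      (𝓝 ((∫ x in (0 : ℝ)..1, Real.sin (t * x) * w x) +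
        (∫ x in Set.Ioi (1 : ℝ), Real.sin (t * x) * (w x - K * x⁻¹)) +
        K * (SignType.sign t * (Real.pi / 2) - ∫ x in (0 : ℝ)..t, Real.sinc x))) := by
  have hgt := integrable_comp_mul_mul Real.continuous_sin Real.abs_sin_le_one hg t
  have hlim := ((intervalIntegral_tendsto_integral_Ioi 1 hgt tendsto_id).const_add
    (∫ x in (0 : ℝ)..1, Real.sin (t * x) * w x)).add
    (((tendsto_integral_sinc_mul t).sub_const (∫ x in (0 : ℝ)..t, Real.sinc x)).const_mul K)
  refine hlim.congr' ?_
  filter_upwards [eventually_ge_atTop 1] with R hR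
  have hcont : Continuous fun x : ℝ => Real.sin (t * x) * w x := by fun_prop
  have h1 : IntervalIntegrable (fun x : ℝ => Real.sin (t * x) * (w x - K * x⁻¹)) volume 1 R :=
    (intervalIntegrable_iff_integrableOn_Ioc_of_le hR).2
      (IntegrableOn.mono_set hgt Set.Ioc_subset_Ioi_self)
  have h2 : IntervalIntegrable (fun x : ℝ => K * (Real.sin (t * x) * x⁻¹)) volume 1 R := by
    convert (hcont.intervalIntegrable 1 R).sub h1 using 2
    ring
  rw [id, ← integral_sin_mul_div t hR, ← intervalIntegral.integral_const_mul, add_assoc,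
    ← intervalIntegral.integral_add h1 h2, ← intervalIntegral.integral_add_adjacent_intervals
      (hcont.intervalIntegrable 0 1) (hcont.intervalIntegrable 1 R)]
  congr 1
  refine intervalIntegral.integral_congr fun x _ => ?_
  ring

/-- The basic jump lemma: if `u : ℝ → ℝ` is continuous and `⟨x⟩^ε |x·u(x) − L| ≤ C`, then
`x ↦ u(x) + u(−x)` is integrable, `x·u(x) → L` at `±∞`, the symmetric improper integrals
`v(t) := lim_{R→∞} (2π)⁻¹ ∫_{−R}^{R} e^{itx} u(x) dx` exist for all `t`, and `v` has the
one-sided limits `±iL/2 + (4π)⁻¹ ∫ (u(x)+u(−x)) dx` at `0`; in particular the jump of `v`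
at `0` equals `i·L`. -/
theorem jump_lemma (L : ℝ) (u : ℝ → ℝ) (hu : Continuous u) (C ε : ℝ)
    (hC : 0 ≤ C) (hε : 0 < ε)
    (hbound : ∀ x : ℝ, (1 + x ^ 2) ^ (ε / 2) * |x * u x - L| ≤ C) :
    (Integrable fun x : ℝ => u x + u (-x)) ∧
    Tendsto (fun x : ℝ => x * u x) atTop (𝓝 L) ∧
    Tendsto (fun x : ℝ => x * u x) atBot (𝓝 L) ∧
    ∃ v : ℝ → ℂ,
      (∀ t : ℝ, Tendsto (fun R : ℝ => (2 * Real.pi : ℂ)⁻¹ *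
            ∫ x in (-R)..R, Complex.exp (Complex.I * (t : ℂ) * (x : ℂ)) * (u x : ℂ))
          atTop (𝓝 (v t))) ∧
      Tendsto v (𝓝[>] 0)
        (𝓝 (Complex.I * (L : ℂ) / 2 +
          (4 * Real.pi : ℂ)⁻¹ * ∫ x : ℝ, ((u x + u (-x) : ℝ) : ℂ))) ∧
      Tendsto v (𝓝[<] 0)
        (𝓝 (-(Complex.I * (L : ℂ) / 2) +
          (4 * Real.pi : ℂ)⁻¹ * ∫ x : ℝ, ((u x + u (-x) : ℝ) : ℂ))) := by
  have hf := integrable_add_comp_neg hu hε hbound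
  have hg := integrableOn_sub_comp_neg_sub hu hε hbound
  have hw : Continuous fun x : ℝ => u x - u (-x) := by fun_prop
  have hw1 : IntegrableOn (fun x : ℝ => u x - u (-x)) (Set.Ioc 0 1) := hw.integrableOn_Ioc
  refine ⟨hf, tendsto_mul_self_of_bound hε hbound tendsto_abs_atTop_atTop,
    tendsto_mul_self_of_bound hε hbound tendsto_abs_atBot_atTop, ?_⟩
  set A : ℝ → ℝ := fun t => ∫ x in Set.Ioi (0 : ℝ), Real.cos (t * x) * (u x + u (-x)) with hA
  set B : ℝ → ℝ := fun t =>
    (∫ x in (0 : ℝ)..1, Real.sin (t * x) * (u x - u (-x))) +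
      ∫ x in Set.Ioi (1 : ℝ), Real.sin (t * x) * (u x - u (-x) - 2 * L * x⁻¹) with hB
  set S : ℝ → ℝ := fun t => ∫ x in (0 : ℝ)..t, Real.sinc x with hS
  have hAc : Continuous A := continuous_integral_comp_mul_mul Real.continuous_cos
    Real.abs_cos_le_one hf.integrableOn
  have hBc : Continuous B := by
    simp only [hB, intervalIntegral.integral_of_le zero_le_one]
    exact (continuous_integral_comp_mul_mul Real.continuous_sin Real.abs_sin_le_one hw1).add
      (continuous_integral_comp_mul_mul Real.continuous_sin Real.abs_sin_le_one hg)
  have hSc : Continuous S := intervalIntegral.continuous_primitive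
    (fun a b => Real.continuous_sinc.intervalIntegrable a b) 0
  have hA0 : A 0 = 2⁻¹ * ∫ x, (u x + u (-x)) := by
    simpa [hA] using integral_Ioi_add_comp_neg u
  have hB0 : B 0 = 0 := by simp [hB]
  have hS0 : S 0 = 0 := by simp [hS]
  let V : ℝ → ℝ → ℂ := fun σ t => (2 * Real.pi : ℂ)⁻¹ *
    ((A t : ℂ) + Complex.I * ((B t + 2 * L * (σ * (Real.pi / 2) - S t) : ℝ) : ℂ))
  have hπ : (Real.pi : ℂ) ≠ 0 := Complex.ofReal_ne_zero.2 Real.pi_ne_zero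
  have hV (σ : ℝ) (s : Set ℝ) : Tendsto (V σ) (𝓝[s] 0) (𝓝 (σ * (Complex.I * (L : ℂ) / 2) +
      (4 * Real.pi : ℂ)⁻¹ * ∫ x : ℝ, ((u x + u (-x) : ℝ) : ℂ))) := by
    have hVc : Continuous (V σ) := by fun_prop
    convert (hVc.tendsto 0).mono_left nhdsWithin_le_nhds using 2
    simp only [V, hA0, hB0, hS0, integral_complex_ofReal]
    push_cast
    field_simp
    ring
  refine ⟨fun t => V (SignType.sign t) t, fun t => ?_, ?_, ?_⟩
  · simp only [integral_cexp_mul_eq_cos_add_sin hu]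
    have hcos := intervalIntegral_tendsto_integral_Ioi 0
      (integrable_comp_mul_mul Real.continuous_cos Real.abs_cos_le_one hf.integrableOn t)
      tendsto_id
    have hsin := tendsto_integral_sin_mul hw hg t
    exact ((Complex.continuous_ofReal.tendsto _).comp hcos |>.add
      (((Complex.continuous_ofReal.tendsto _).comp hsin).const_mul Complex.I)).const_mul _
  · have h := hV 1 (Set.Ioi 0)
    rw [Complex.ofReal_one, one_mul] at h
    refine h.congr' ?_
    filter_upwards [self_mem_nhdsWithin] with t ht
    simp [sign_pos (Set.mem_Ioi.1 ht)]
  · have h := hV (-1) (Set.Iio 0)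
    rw [Complex.ofReal_neg, Complex.ofReal_one, neg_one_mul] at h
    refine h.congr' ?_
    filter_upwards [self_mem_nhdsWithin] with t ht
    simp [sign_neg (Set.mem_Iio.1 ht)]
end

section
/- Let n ≥ 2, let m < −1, and let a : ℝⁿ × ℝⁿ → ℂ be a symbol of order m. Define b : ℝⁿ × ℝ^{n−1} × ℝ → ℂ by b(x, η, t) := (2π)⁻¹ ∫_ℝ e^{itτ} a(x, (η, τ)) dτ. Then: (a) for every (x, η, t) the defining integral converges absolutely; (b) for every fixed t ∈ ℝ, the map (x, η) ↦ b(x, η, t) is smooth; (c) b is jointly continuous in (x, η, t); (d) for all multi-indices α ∈ ℕⁿ and β ∈ ℕ^{n−1} there is a constant C'_{α,β} ≥ 0 such that |∂_x^α ∂_η^β b(x, η, t)| ≤ C'_{α,β} ⟨η⟩^{m+1−|β|} for all (x, η, t) ∈ ℝⁿ × ℝ^{n−1} × ℝ. In particular, for each fixed (x_n, t), the family b((·, x_n), ·, t) is a symbol of order m+1 on ℝ^{n−1}, with symbol seminorms bounded uniformly in (x_n, t). -/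
open MeasureTheory Filter Topology

noncomputable section

/-- Iterated partial derivatives of `f : ℝ^k → ℂ` in the list of coordinate directions `L`
(this realizes the multi-index derivative `∂^α`, the multi-index `α` being recorded as a
list of directions). -/
def pderivList {k : ℕ} : List (Fin k) → ((Fin k → ℝ) → ℂ) → ((Fin k → ℝ) → ℂ)
  | [], f => f
  | i :: L, f => fun x => fderiv ℝ (pderivList L f) x (Pi.single i 1)

/-- The mixed derivative `∂_x^α ∂_ξ^β f(x, ξ)` of `f : ℝ^k × ℝ^l → ℂ`, multi-indices being
recorded as lists of coordinate directions. -/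
def mixedPDeriv {k l : ℕ} (α : List (Fin k)) (β : List (Fin l))
    (f : (Fin k → ℝ) → (Fin l → ℝ) → ℂ) (x : Fin k → ℝ) (ξ : Fin l → ℝ) : ℂ :=
  pderivList α (fun y => pderivList β (f y) ξ) x

/-- `a : ℝ^k × ℝ^k → ℂ` is a (Kohn–Nirenberg) symbol of order `m`: it is smooth and
`|∂_x^α ∂_ξ^β a(x,ξ)| ≤ C_{α,β} ⟨ξ⟩^{m−|β|}` for all multi-indices `α, β`, where
`⟨ξ⟩ = (1+‖ξ‖²)^{1/2}` is the Japanese bracket. -/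
def IsSymbol {k : ℕ} (m : ℝ) (a : (Fin k → ℝ) → (Fin k → ℝ) → ℂ) : Prop :=
  ContDiff ℝ (⊤ : ℕ∞) (fun p : (Fin k → ℝ) × (Fin k → ℝ) => a p.1 p.2) ∧
  ∀ (α β : List (Fin k)), ∃ C : ℝ, 0 ≤ C ∧ ∀ (x ξ : Fin k → ℝ),
    ‖mixedPDeriv α β a x ξ‖ ≤ C * (1 + (∑ i, ξ i ^ 2)) ^ ((m - β.length) / 2)

end

section DirectionalDerivatives

variable {E F : Type*} [NormedAddCommGroup E] [NormedSpace ℝ E]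
  [NormedAddCommGroup F] [NormedSpace ℝ F]

/-- The iterated directional derivative of `f` along the vectors of a list. -/
noncomputable def dirDerivList : List E → (E → ℂ) → (E → ℂ)
  | [], f => f
  | v :: L, f => fun x => fderiv ℝ (dirDerivList L f) x v

theorem pderivList_eq_dirDerivList {k : ℕ} (L : List (Fin k)) (f : (Fin k → ℝ) → ℂ) :
    pderivList L f = dirDerivList (L.map fun i => Pi.single i (1 : ℝ)) f := by
  induction L with
  | nil => rfl
  | cons i L ih => simp only [pderivList, List.map_cons, dirDerivList, ih]

theorem dirDerivList_append (L M : List E) (f : E → ℂ) :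
    dirDerivList (L ++ M) f = dirDerivList L (dirDerivList M f) := by
  induction L with
  | nil => rfl
  | cons v L ih => simp only [List.cons_append, dirDerivList, ih]

theorem ContDiff.dirDerivList {f : E → ℂ} (hf : ContDiff ℝ (⊤ : ℕ∞) f) (L : List E) :
    ContDiff ℝ (⊤ : ℕ∞) (dirDerivList L f) := by
  induction L with
  | nil => exact hf
  | cons v L ih => exact (ih.fderiv_right (by simp)).clm_apply contDiff_const

theorem ContDiff.fderiv_fderiv_comm {f : E → ℂ} (hf : ContDiff ℝ (⊤ : ℕ∞) f) (x v w : E) :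
    fderiv ℝ (fun y => fderiv ℝ f y v) x w = fderiv ℝ (fun y => fderiv ℝ f y w) x v := by
  have hd : Differentiable ℝ (fderiv ℝ f) :=
    (hf.fderiv_right (m := (⊤ : ℕ∞)) (by simp)).differentiable (by simp)
  have hs : IsSymmSndFDerivAt ℝ f x :=
    hf.contDiffAt.isSymmSndFDerivAt (by simpa using WithTop.coe_le_coe.2 (le_top : (2 : ℕ∞) ≤ ⊤))
  rw [fderiv_clm_apply (hd x) (by fun_prop), fderiv_clm_apply (hd x) (by fun_prop)]
  simpa using hs.eq w v

theorem ContDiff.dirDerivList_perm {f : E → ℂ} (hf : ContDiff ℝ (⊤ : ℕ∞) f) {L M : List E}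
    (h : L.Perm M) : _root_.dirDerivList L f = _root_.dirDerivList M f := by
  induction h with
  | nil => rfl
  | cons v _ ih => simp only [_root_.dirDerivList, ih]
  | swap v w L =>
    funext x
    exact (hf.dirDerivList L).fderiv_fderiv_comm x v w
  | trans _ _ ih₁ ih₂ => exact ih₁.trans ih₂

theorem ContDiff.dirDerivList_comp_affine {f : F → ℂ} (hf : ContDiff ℝ (⊤ : ℕ∞) f)
    (A : E →L[ℝ] F) (c : F) (L : List E) :
    _root_.dirDerivList L (fun x => f (A x + c)) =
      fun x => _root_.dirDerivList (L.map A) f (A x + c) := by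
  induction L with
  | nil => rfl
  | cons v L ih =>
    funext x
    simp only [_root_.dirDerivList, ih, List.map_cons]
    have hg := ((hf.dirDerivList (L.map A)).differentiable (by simp)) (A x + c)
    have hA : HasFDerivAt (fun x => A x + c) A x := A.hasFDerivAt.add_const c
    have := (hg.hasFDerivAt.comp x hA).fderiv
    simp only [Function.comp_def] at this
    rw [this]
    rfl

theorem ContDiff.dirDerivList_const_mul {f : E → ℂ} (hf : ContDiff ℝ (⊤ : ℕ∞) f) (c : ℂ)
    (L : List E) :
    _root_.dirDerivList L (fun x => c * f x) = fun x => c * _root_.dirDerivList L f x := by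
  induction L with
  | nil => rfl
  | cons v L ih =>
    funext x
    have hg := ((hf.dirDerivList L).differentiable (by simp)) x
    simp only [_root_.dirDerivList, ih]
    rw [fderiv_const_mul hg]
    rfl

theorem mixedPDeriv_eq_dirDerivList {k l : ℕ} (α : List (Fin k)) (β : List (Fin l))
    {f : (Fin k → ℝ) → (Fin l → ℝ) → ℂ}
    (hf : ContDiff ℝ (⊤ : ℕ∞) (fun p : (Fin k → ℝ) × (Fin l → ℝ) => f p.1 p.2))
    (x : Fin k → ℝ) (ξ : Fin l → ℝ) :
    mixedPDeriv α β f x ξ =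
      dirDerivList ((α.map fun i => ((Pi.single i 1, 0) : (Fin k → ℝ) × (Fin l → ℝ))) ++
        β.map fun j => (0, Pi.single j 1)) (fun p => f p.1 p.2) (x, ξ) := by
  set g : (Fin k → ℝ) × (Fin l → ℝ) → ℂ := fun p => f p.1 p.2 with hg
  have h₂ (y : Fin k → ℝ) : pderivList β (f y) ξ =
      dirDerivList (β.map fun j => (0, Pi.single j 1)) g (y, ξ) := by
    have := congrFun (hf.dirDerivList_comp_affine
      (ContinuousLinearMap.inr ℝ (Fin k → ℝ) (Fin l → ℝ)) (y, 0)
      (β.map fun j => Pi.single j (1 : ℝ))) ξ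
    rw [pderivList_eq_dirDerivList]
    simpa [List.map_map, Function.comp_def] using this
  have h₁ := congrFun ((hf.dirDerivList (β.map fun j => (0, Pi.single j 1))).dirDerivList_comp_affine
      (ContinuousLinearMap.inl ℝ (Fin k → ℝ) (Fin l → ℝ)) (0, ξ)
      (α.map fun j => Pi.single j (1 : ℝ))) x
  rw [mixedPDeriv, pderivList_eq_dirDerivList, dirDerivList_append]
  simp only [h₂]
  simpa [List.map_map, Function.comp_def] using h₁

end DirectionalDerivatives

section ParametricIntegrals

variable {E ι : Type*} [NormedAddCommGroup E] [NormedSpace ℝ E]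

/-- A smooth family `g : E → ℝ → ℂ` all of whose iterated derivatives along the vectors of `b` are
bounded, uniformly in the first variable, by integrable functions of the second. -/
structure SmoothDominated (b : ι → E) (g : E → ℝ → ℂ) : Prop where
  contDiff : ContDiff ℝ (⊤ : ℕ∞) (Function.uncurry g)
  dominated (L : List ι) : ∃ bound : ℝ → ℝ, Integrable bound ∧
    ∀ p τ, ‖dirDerivList (L.map b) (fun q => g q τ) p‖ ≤ bound τ

namespace SmoothDominated

variable {b : ι → E} {g : E → ℝ → ℂ}

theorem contDiff_left (hg : SmoothDominated b g) (τ : ℝ) :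
    ContDiff ℝ (⊤ : ℕ∞) (fun p => g p τ) :=
  hg.contDiff.comp (contDiff_id.prodMk contDiff_const)

theorem continuous_right (hg : SmoothDominated b g) (p : E) : Continuous (g p) :=
  hg.contDiff.continuous.comp (Continuous.prodMk_right p)

theorem integrable (hg : SmoothDominated b g) (p : E) : Integrable (g p) := by
  obtain ⟨bound, hb, h⟩ := hg.dominated []
  exact hb.mono' (hg.continuous_right p).aestronglyMeasurable (.of_forall (h p))

theorem fderiv_apply (hg : SmoothDominated b g) (i : ι) :
    SmoothDominated b (fun p τ => fderiv ℝ (fun q => g q τ) p (b i)) where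
  contDiff := by
    have : ContDiff ℝ (⊤ : ℕ∞) (fun r : E × ℝ => fderiv ℝ (fun q => g q r.2) r.1) :=
      ContDiff.fderiv (f := fun (r : E × ℝ) q => g q r.2) (m := (⊤ : ℕ∞))
        (hg.contDiff.comp (by fun_prop : ContDiff ℝ (⊤ : ℕ∞) fun s : (E × ℝ) × E => (s.2, s.1.2)))
        contDiff_fst (by simp)
    exact this.clm_apply contDiff_const
  dominated L := by
    obtain ⟨bound, hb, h⟩ := hg.dominated (L ++ [i])
    refine ⟨bound, hb, fun p τ => ?_⟩
    have := h p τ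
    rwa [List.map_append, dirDerivList_append] at this

theorem dirDerivList (hg : SmoothDominated b g) (L : List ι) :
    SmoothDominated b (fun p τ => dirDerivList (L.map b) (fun q => g q τ) p) := by
  induction L with
  | nil => exact hg
  | cons i L ih => exact ih.fderiv_apply i

end SmoothDominated

namespace SmoothDominated

variable [Fintype ι] {b : Module.Basis ι ℝ E} {g : E → ℝ → ℂ}

theorem exists_fderiv_bound (hg : SmoothDominated b g) :
    ∃ bound : ℝ → ℝ, Integrable bound ∧ ∀ p τ, ‖fderiv ℝ (fun q => g q τ) p‖ ≤ bound τ := by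
  obtain ⟨C, -, hC⟩ := b.exists_opNorm_le (F := ℂ)
  choose B hB h using fun i => hg.dominated [i]
  refine ⟨fun τ => C * ∑ i, B i τ, (integrable_finsetSum _ fun i _ => hB i).const_mul C,
    fun p τ => ?_⟩
  have hnn (i : ι) : 0 ≤ B i τ := (norm_nonneg _).trans (h i p τ)
  exact hC (Finset.sum_nonneg fun i _ => hnn i) fun i => (h i p τ).trans
    (Finset.single_le_sum (f := fun i => B i τ) (fun i _ => hnn i) (Finset.mem_univ i))

theorem hasFDerivAt_integral [FiniteDimensional ℝ E] (hg : SmoothDominated b g) (p : E) :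
    Integrable (fun τ => fderiv ℝ (fun q => g q τ) p) ∧
    HasFDerivAt (fun q => ∫ τ, g q τ) (∫ τ, fderiv ℝ (fun q => g q τ) p) p := by
  obtain ⟨bound, hb, h⟩ := hg.exists_fderiv_bound
  have hcont : Continuous (fun τ => fderiv ℝ (fun q => g q τ) p) :=
    (ContDiff.fderiv (f := fun τ q => g q τ) (m := (⊤ : ℕ∞)) (n := 0)
      (hg.contDiff.comp (by fun_prop : ContDiff ℝ (⊤ : ℕ∞) fun s : ℝ × E => (s.2, s.1)))
      contDiff_const (by simp)).continuous
  refine ⟨hb.mono' hcont.aestronglyMeasurable (.of_forall (h p)), ?_⟩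
  exact hasFDerivAt_integral_of_dominated_of_fderiv_le univ_mem
    (.of_forall fun q => (hg.continuous_right q).aestronglyMeasurable) (hg.integrable p)
    hcont.aestronglyMeasurable (.of_forall fun τ q _ => h q τ) hb
    (.of_forall fun τ q _ => ((hg.contDiff_left τ).differentiable (by simp) q).hasFDerivAt)

theorem fderiv_integral_apply [FiniteDimensional ℝ E] (hg : SmoothDominated b g) (p v : E) :
    fderiv ℝ (fun q => ∫ τ, g q τ) p v = ∫ τ, fderiv ℝ (fun q => g q τ) p v := by
  obtain ⟨hi, hd⟩ := hg.hasFDerivAt_integral p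
  rw [hd.fderiv, ContinuousLinearMap.integral_apply hi]

theorem dirDerivList_integral [FiniteDimensional ℝ E] (hg : SmoothDominated b g) (L : List ι) :
    _root_.dirDerivList (L.map b) (fun q => ∫ τ, g q τ) =
      fun q => ∫ τ, _root_.dirDerivList (L.map b) (fun q => g q τ) q := by
  induction L with
  | nil => rfl
  | cons i L ih =>
    funext p
    simp only [List.map_cons, _root_.dirDerivList, ih]
    exact (hg.dirDerivList L).fderiv_integral_apply p (b i)

theorem contDiff_integral [FiniteDimensional ℝ E] (hg : SmoothDominated b g) :
    ContDiff ℝ (⊤ : ℕ∞) (fun q => ∫ τ, g q τ) := by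
  rw [contDiff_infty]
  intro n
  induction n generalizing g with
  | zero =>
    exact contDiff_zero.2 (continuous_iff_continuousAt.2 fun p =>
      (hg.hasFDerivAt_integral p).2.continuousAt)
  | succ n ih =>
    push_cast
    refine contDiff_succ_iff_fderiv_apply.2 ⟨fun p =>
      (hg.hasFDerivAt_integral p).2.differentiableAt, by simp, fun y => ?_⟩
    have (p : E) : fderiv ℝ (fun q => ∫ τ, g q τ) p y =
        ∑ i, b.repr y i • ∫ τ, fderiv ℝ (fun q => g q τ) p (b i) := by
      conv_lhs => rw [← b.sum_repr y, map_sum]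
      simp only [_root_.map_smul, hg.fderiv_integral_apply, integral_smul]
    simp only [this]
    exact ContDiff.sum fun i _ => (ih (hg.fderiv_apply i)).const_smul (b.repr y i)

end SmoothDominated

end ParametricIntegrals

section JapaneseBracket

variable {A μ : ℝ}

theorem add_sq_rpow_eq (hA : 0 < A) (τ : ℝ) :
    (A + τ ^ 2) ^ (μ / 2) = A ^ (μ / 2) * (1 + (τ / √A) ^ 2) ^ (μ / 2) := by
  rw [← Real.mul_rpow hA.le (by positivity), div_pow, Real.sq_sqrt hA.le]
  congr 1
  field_simp

theorem integrable_one_add_sq_rpow (hμ : μ < -1) :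
    Integrable fun τ : ℝ => (1 + τ ^ 2) ^ (μ / 2) := by
  have := integrable_rpow_neg_one_add_norm_sq (E := ℝ) (μ := volume) (r := -μ)
    (by simp; linarith)
  simpa using this

theorem integrable_add_sq_rpow (hμ : μ < -1) (hA : 0 < A) :
    Integrable fun τ : ℝ => (A + τ ^ 2) ^ (μ / 2) := by
  simp only [add_sq_rpow_eq hA]
  exact ((integrable_one_add_sq_rpow hμ).comp_div (Real.sqrt_pos.2 hA).ne').const_mul _

theorem integral_add_sq_rpow (hA : 0 < A) :
    ∫ τ : ℝ, (A + τ ^ 2) ^ (μ / 2) =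
      (∫ τ : ℝ, (1 + τ ^ 2) ^ (μ / 2)) * A ^ ((μ + 1) / 2) := by
  simp only [add_sq_rpow_eq hA]
  rw [integral_const_mul, Measure.integral_comp_div (fun s : ℝ => (1 + s ^ 2) ^ (μ / 2)),
    abs_of_nonneg (Real.sqrt_nonneg A), add_div, Real.rpow_add hA, ← Real.sqrt_eq_rpow, smul_eq_mul]
  ring

end JapaneseBracket

theorem List.exists_perm_map_inl_append_map_inr {ι κ : Type*} (L : List (ι ⊕ κ)) :
    ∃ (α : List ι) (β : List κ), L.Perm (α.map Sum.inl ++ β.map Sum.inr) := by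
  induction L with
  | nil => exact ⟨[], [], .nil⟩
  | cons s L ih =>
    obtain ⟨α, β, h⟩ := ih
    cases s with
    | inl i => exact ⟨i :: α, β, h.cons _⟩
    | inr j => exact ⟨α, j :: β, (h.cons _).trans List.perm_middle.symm⟩

section PartialFourier

variable {d : ℕ}

/-- The inclusion `η ↦ (η, 0)`. -/
noncomputable def snocZero (d : ℕ) : (Fin d → ℝ) →L[ℝ] (Fin (d + 1) → ℝ) :=
  ContinuousLinearMap.pi
    (Fin.lastCases (motive := fun _ => (Fin d → ℝ) →L[ℝ] ℝ) 0 fun j => ContinuousLinearMap.proj j)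

theorem snoc_eq_snocZero_add (η : Fin d → ℝ) (τ : ℝ) :
    (Fin.snoc η τ : Fin (d + 1) → ℝ) = snocZero d η + Pi.single (Fin.last d) τ := by
  ext i
  refine Fin.lastCases ?_ (fun j => ?_) i <;> simp [snocZero]

theorem snocZero_single (j : Fin d) :
    snocZero d (Pi.single j 1) = Pi.single j.castSucc 1 := by
  ext i
  refine Fin.lastCases ?_ (fun k => ?_) i
  · simp [snocZero]
  · simp [snocZero, Pi.single_apply]

/-- The inclusion `(x, η) ↦ (x, (η, 0))`. -/
noncomputable def phaseInclusion (d : ℕ) :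
    (Fin (d + 1) → ℝ) × (Fin d → ℝ) →L[ℝ] (Fin (d + 1) → ℝ) × (Fin (d + 1) → ℝ) :=
  (ContinuousLinearMap.id ℝ _).prodMap (snocZero d)

theorem mk_snoc_eq_phaseInclusion_add (p : (Fin (d + 1) → ℝ) × (Fin d → ℝ)) (τ : ℝ) :
    (p.1, (Fin.snoc p.2 τ : Fin (d + 1) → ℝ)) =
      phaseInclusion d p + (0, Pi.single (Fin.last d) τ) := by
  rw [snoc_eq_snocZero_add]
  ext i <;> simp [phaseInclusion]

/-- The standard basis of `ℝ^{d+1} × ℝ^d`. -/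
noncomputable def phaseBasis (d : ℕ) :
    Module.Basis (Fin (d + 1) ⊕ Fin d) ℝ ((Fin (d + 1) → ℝ) × (Fin d → ℝ)) :=
  (Pi.basisFun ℝ (Fin (d + 1))).prod (Pi.basisFun ℝ (Fin d))

theorem map_phaseBasis (α : List (Fin (d + 1))) (β : List (Fin d)) :
    (α.map Sum.inl ++ β.map Sum.inr).map (phaseBasis d) =
      (α.map fun i => (Pi.single i 1, 0)) ++ β.map fun j => (0, Pi.single j 1) := by
  simp [phaseBasis, Function.comp_def]

variable {m : ℝ} {a : (Fin (d + 1) → ℝ) → (Fin (d + 1) → ℝ) → ℂ}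

theorem dirDerivList_comp_snoc
    (ha : ContDiff ℝ (⊤ : ℕ∞) (fun p : (Fin (d + 1) → ℝ) × (Fin (d + 1) → ℝ) => a p.1 p.2))
    (α : List (Fin (d + 1))) (β : List (Fin d)) (p : (Fin (d + 1) → ℝ) × (Fin d → ℝ)) (τ : ℝ) :
    dirDerivList ((α.map Sum.inl ++ β.map Sum.inr).map (phaseBasis d))
        (fun q => a q.1 (Fin.snoc q.2 τ)) p =
      mixedPDeriv α (β.map Fin.castSucc) a p.1 (Fin.snoc p.2 τ) := by
  have h := congrFun (ha.dirDerivList_comp_affine (phaseInclusion d)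
    (0, Pi.single (Fin.last d) τ) ((α.map Sum.inl ++ β.map Sum.inr).map (phaseBasis d))) p
  simp only [← mk_snoc_eq_phaseInclusion_add] at h
  rw [h, mixedPDeriv_eq_dirDerivList _ _ ha, map_phaseBasis]
  simp [phaseInclusion, Function.comp_def, snocZero_single]

theorem contDiff_comp_snoc
    (ha : ContDiff ℝ (⊤ : ℕ∞) (fun p : (Fin (d + 1) → ℝ) × (Fin (d + 1) → ℝ) => a p.1 p.2)) :
    ContDiff ℝ (⊤ : ℕ∞) (fun r : ((Fin (d + 1) → ℝ) × (Fin d → ℝ)) × ℝ =>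
      a r.1.1 (Fin.snoc r.1.2 r.2)) := by
  simp only [snoc_eq_snocZero_add]
  refine ha.comp (g := fun p => a p.1 p.2) (f := fun r : ((Fin (d + 1) → ℝ) × (Fin d → ℝ)) × ℝ =>
    (r.1.1, snocZero d r.1.2 + Pi.single (Fin.last d) r.2)) ?_
  have hs : ContDiff ℝ (⊤ : ℕ∞) (fun s : ℝ => (Pi.single (Fin.last d) s : Fin (d + 1) → ℝ)) :=
    (ContinuousLinearMap.single ℝ (fun _ : Fin (d + 1) => ℝ) (Fin.last d)).contDiff
  exact (contDiff_fst.comp contDiff_fst).prodMk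
    (((snocZero d).contDiff.comp (contDiff_snd.comp contDiff_fst)).add (hs.comp contDiff_snd))

theorem IsSymbol.exists_dirDerivList_bound (ha : IsSymbol m a) (α : List (Fin (d + 1)))
    (β : List (Fin d)) :
    ∃ C : ℝ, 0 ≤ C ∧ ∀ (w : ℝ → ℂ), (∀ τ, ‖w τ‖ ≤ 1) →
      ∀ (p : (Fin (d + 1) → ℝ) × (Fin d → ℝ)) (τ : ℝ),
        ‖dirDerivList ((α.map Sum.inl ++ β.map Sum.inr).map (phaseBasis d))
          (fun q => w τ * a q.1 (Fin.snoc q.2 τ)) p‖ ≤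
        C * ((1 + ∑ i, p.2 i ^ 2) + τ ^ 2) ^ ((m - β.length) / 2) := by
  obtain ⟨C, hC, h⟩ := ha.2 α (β.map Fin.castSucc)
  refine ⟨C, hC, fun w hw p τ => ?_⟩
  have hτ : ContDiff ℝ (⊤ : ℕ∞) (fun q : (Fin (d + 1) → ℝ) × (Fin d → ℝ) =>
      a q.1 (Fin.snoc q.2 τ)) :=
    (contDiff_comp_snoc ha.1).comp (contDiff_id.prodMk contDiff_const)
  have hp := h p.1 (Fin.snoc p.2 τ)
  simp only [List.length_map, Fin.sum_univ_castSucc, Fin.snoc_castSucc, Fin.snoc_last,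
    ← add_assoc] at hp
  rw [hτ.dirDerivList_const_mul]
  beta_reduce
  rw [dirDerivList_comp_snoc ha.1, norm_mul]
  exact (mul_le_of_le_one_left (norm_nonneg _) (hw τ)).trans hp

theorem IsSymbol.exists_dirDerivList_bound_right (ha : IsSymbol m a) (hm : m ≤ 0)
    (L : List (Fin (d + 1) ⊕ Fin d)) :
    ∃ C : ℝ, 0 ≤ C ∧ ∀ (w : ℝ → ℂ), (∀ τ, ‖w τ‖ ≤ 1) →
      ∀ (p : (Fin (d + 1) → ℝ) × (Fin d → ℝ)) (τ : ℝ),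
        ‖dirDerivList (L.map (phaseBasis d)) (fun q => w τ * a q.1 (Fin.snoc q.2 τ)) p‖ ≤
        C * (1 + τ ^ 2) ^ (m / 2) := by
  obtain ⟨α, β, hL⟩ := L.exists_perm_map_inl_append_map_inr
  obtain ⟨C, hC, h⟩ := ha.exists_dirDerivList_bound α β
  refine ⟨C, hC, fun w hw p τ => ?_⟩
  have hτ : ContDiff ℝ (⊤ : ℕ∞) (fun q : (Fin (d + 1) → ℝ) × (Fin d → ℝ) =>
      w τ * a q.1 (Fin.snoc q.2 τ)) :=
    contDiff_const.mul ((contDiff_comp_snoc ha.1).comp (contDiff_id.prodMk contDiff_const))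
  rw [hτ.dirDerivList_perm (hL.map _)]
  refine (h w hw p τ).trans (mul_le_mul_of_nonneg_left ?_ hC)
  have hη : 0 ≤ ∑ i, p.2 i ^ 2 := Finset.sum_nonneg fun i _ => sq_nonneg _
  have hβ : (0 : ℝ) ≤ β.length := Nat.cast_nonneg _
  calc ((1 + ∑ i, p.2 i ^ 2) + τ ^ 2) ^ ((m - β.length) / 2)
      ≤ ((1 + ∑ i, p.2 i ^ 2) + τ ^ 2) ^ (m / 2) :=
        Real.rpow_le_rpow_of_exponent_le (by nlinarith [sq_nonneg τ]) (by linarith)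
    _ ≤ (1 + τ ^ 2) ^ (m / 2) :=
        Real.rpow_le_rpow_of_nonpos (by positivity) (by linarith) (by linarith)

theorem IsSymbol.smoothDominated (ha : IsSymbol m a) (hm : m < -1) {w : ℝ → ℂ}
    (hw : ContDiff ℝ (⊤ : ℕ∞) w) (hw₁ : ∀ τ, ‖w τ‖ ≤ 1) :
    SmoothDominated (phaseBasis d) (fun p τ => w τ * a p.1 (Fin.snoc p.2 τ)) where
  contDiff := (hw.comp contDiff_snd).mul (contDiff_comp_snoc ha.1)
  dominated L := by
    obtain ⟨C, -, h⟩ := ha.exists_dirDerivList_bound_right (by linarith) L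
    exact ⟨_, (integrable_one_add_sq_rpow hm).const_mul C, h w hw₁⟩

theorem IsSymbol.exists_integral_bound (ha : IsSymbol m a) (hm : m < -1)
    (α : List (Fin (d + 1))) (β : List (Fin d)) :
    ∃ C : ℝ, 0 ≤ C ∧ ∀ (w : ℝ → ℂ), ContDiff ℝ (⊤ : ℕ∞) w → (∀ τ, ‖w τ‖ ≤ 1) →
      ∀ (x : Fin (d + 1) → ℝ) (η : Fin d → ℝ),
        ‖mixedPDeriv α β (fun y ζ => ∫ τ, w τ * a y (Fin.snoc ζ τ)) x η‖ ≤
          C * (1 + ∑ i, η i ^ 2) ^ ((m + 1 - β.length) / 2) := by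
  obtain ⟨C, hC, h⟩ := ha.exists_dirDerivList_bound α β
  have hβ : (0 : ℝ) ≤ β.length := Nat.cast_nonneg _
  refine ⟨C * ∫ τ : ℝ, (1 + τ ^ 2) ^ ((m - β.length) / 2),
    mul_nonneg hC (integral_nonneg fun τ => by positivity), fun w hw hw₁ x η => ?_⟩
  have hg := ha.smoothDominated hm hw hw₁
  have hA : 0 < 1 + ∑ i, η i ^ 2 := by positivity
  rw [mixedPDeriv_eq_dirDerivList α β hg.contDiff_integral, ← map_phaseBasis,
    hg.dirDerivList_integral]
  refine (norm_integral_le_of_norm_le ((integrable_add_sq_rpow (by linarith) hA).const_mul C)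
    (.of_forall (h w hw₁ (x, η)))).trans_eq ?_
  rw [integral_const_mul, integral_add_sq_rpow hA, mul_assoc]
  congr 4
  ring

end PartialFourier

/-- The normalized Fourier kernel `τ ↦ (2π)⁻¹ e^{itτ}`. -/
noncomputable def fourierWeight (t τ : ℝ) : ℂ :=
  (2 * Real.pi : ℂ)⁻¹ * Complex.exp (Complex.I * (t : ℂ) * (τ : ℂ))

theorem contDiff_fourierWeight : ContDiff ℝ (⊤ : ℕ∞) (Function.uncurry fourierWeight) := by
  have h : ContDiff ℝ (⊤ : ℕ∞) (fun s : ℝ => (s : ℂ)) := Complex.ofRealCLM.contDiff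
  exact contDiff_const.mul ((contDiff_const.mul (h.comp contDiff_fst)).mul
    (h.comp contDiff_snd)).cexp

theorem norm_fourierWeight_le_one (t τ : ℝ) : ‖fourierWeight t τ‖ ≤ 1 := by
  have h : ‖Complex.exp (Complex.I * (t : ℂ) * (τ : ℂ))‖ = 1 := by
    rw [Complex.norm_exp]
    simp
  rw [fourierWeight, norm_mul, h, mul_one, norm_inv]
  refine inv_le_one_of_one_le₀ ?_
  simp only [norm_mul, Complex.norm_ofNat, Complex.norm_real, Real.norm_eq_abs,
    abs_of_pos Real.pi_pos]
  linarith [Real.pi_gt_three]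

/-- Let `n = d+1 ≥ 2`, `m < −1`, and let `a` be a symbol of order `m` on `ℝⁿ`.  Then
`b(x,η,t) := (2π)⁻¹ ∫ e^{itτ} a(x,(η,τ)) dτ` is defined by an absolutely convergent
integral, is smooth in `(x,η)` for each `t`, is jointly continuous, and for all
multi-indices `α, β` satisfies `|∂_x^α ∂_η^β b(x,η,t)| ≤ C'_{α,β} ⟨η⟩^{m+1−|β|}` uniformly
in `t`; in particular each `b(·,·,t)` is a symbol of order `m+1` on `ℝ^{n−1}` with
seminorms bounded uniformly in the parameters. -/
theorem boundary_symbol_order_lt_neg_one (d : ℕ) (hd : 1 ≤ d) (m : ℝ) (hm : m < -1)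
    (a : (Fin (d + 1) → ℝ) → (Fin (d + 1) → ℝ) → ℂ) (ha : IsSymbol m a) :
    (∀ (x : Fin (d + 1) → ℝ) (η : Fin d → ℝ) (t : ℝ),
        Integrable fun τ : ℝ => Complex.exp (Complex.I * (t : ℂ) * (τ : ℂ)) * a x (Fin.snoc η τ)) ∧
    (∀ t : ℝ, ContDiff ℝ (⊤ : ℕ∞) (fun p : (Fin (d + 1) → ℝ) × (Fin d → ℝ) =>
        (2 * Real.pi : ℂ)⁻¹ *
          ∫ τ : ℝ, Complex.exp (Complex.I * (t : ℂ) * (τ : ℂ)) * a p.1 (Fin.snoc p.2 τ))) ∧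
    Continuous (fun q : ((Fin (d + 1) → ℝ) × (Fin d → ℝ)) × ℝ =>
        (2 * Real.pi : ℂ)⁻¹ *
          ∫ τ : ℝ, Complex.exp (Complex.I * (q.2 : ℂ) * (τ : ℂ)) * a q.1.1 (Fin.snoc q.1.2 τ)) ∧
    (∀ (α : List (Fin (d + 1))) (β : List (Fin d)), ∃ C : ℝ, 0 ≤ C ∧
      ∀ (x : Fin (d + 1) → ℝ) (η : Fin d → ℝ) (t : ℝ),
        ‖mixedPDeriv α β
            (fun y ζ => (2 * Real.pi : ℂ)⁻¹ *
              ∫ τ : ℝ, Complex.exp (Complex.I * (t : ℂ) * (τ : ℂ)) * a y (Fin.snoc ζ τ))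
            x η‖ ≤
          C * (1 + (∑ i, η i ^ 2)) ^ ((m + 1 - β.length) / 2)) := by
  have hw (t : ℝ) : ContDiff ℝ (⊤ : ℕ∞) (fourierWeight t) :=
    contDiff_fourierWeight.comp (contDiff_const.prodMk contDiff_id)
  have hg (t : ℝ) := ha.smoothDominated hm (hw t) (norm_fourierWeight_le_one t)
  have hπ : (2 * Real.pi : ℂ) ≠ 0 := by simp [Real.pi_ne_zero]
  simp only [← integral_const_mul, ← mul_assoc (2 * Real.pi : ℂ)⁻¹]
  refine ⟨fun x η t => ?_, fun t => (hg t).contDiff_integral, ?_, fun α β => ?_⟩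
  · refine (((hg t).integrable (x, η)).const_mul (2 * Real.pi : ℂ)).congr (.of_forall fun τ => ?_)
    simp only [fourierWeight]
    rw [mul_assoc (2 * Real.pi : ℂ)⁻¹, mul_inv_cancel_left₀ hπ]
  · obtain ⟨C, -, h⟩ := ha.exists_dirDerivList_bound_right (by linarith) []
    refine continuous_of_dominated
      (fun q => ((hg q.2).continuous_right q.1).aestronglyMeasurable)
      (fun q => .of_forall (h _ (norm_fourierWeight_le_one q.2) q.1))
      ((integrable_one_add_sq_rpow hm).const_mul C) (.of_forall fun τ => ?_)
    exact (contDiff_fourierWeight.continuous.comp (continuous_snd.prodMk continuous_const)).mul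
      ((contDiff_comp_snoc ha.1).continuous.comp (continuous_fst.prodMk continuous_const))
  · obtain ⟨C, hC, h⟩ := ha.exists_integral_bound hm α β
    exact ⟨C, hC, fun x η t => h _ (hw t) (norm_fourierWeight_le_one t) x η⟩
end

section
/- Let n ≥ 2 and let a = b + r : ℝⁿ × ℝⁿ → ℂ be a classical symbol of order −1 with odd principal symbol (so b is a symbol of order −1 that is essentially homogeneous of degree −1 and odd for ‖ξ‖ ≥ 1, and r is a symbol of order −2). Define, when the limit exists, A(x, η, t) := lim_{R→∞} (2π)⁻¹ ∫_{−R}^{R} e^{itτ} a(x, (η, τ)) dτ. Then: (a) the limit exists for every (x, η, t) ∈ ℝⁿ × ℝ^{n−1} × ℝ; (b) for every fixed t ∈ ℝ, the map (x, η) ↦ A(x, η, t) is smooth; (c) for all multi-indices α ∈ ℕⁿ and β ∈ ℕ^{n−1} there is a constant C ≥ 0, independent of t, such that |∂_x^α ∂_η^β A(x, η, t)| ≤ C ⟨η⟩^{−|β|} for all (x, η, t). In particular, the family {A(·, ·, t) : t ∈ ℝ} is a bounded family of symbols of order 0 on ℝ^{n−1}. -/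
open MeasureTheory Filter Topology

noncomputable section

/-- The Euclidean norm on `ℝ^k`. -/
def euclNorm {k : ℕ} (ξ : Fin k → ℝ) : ℝ := Real.sqrt (∑ i, ξ i ^ 2)

end


section PartialDerivatives

variable {E F : Type*} [NormedAddCommGroup E] [NormedSpace ℝ E] [NormedAddCommGroup F]
  [NormedSpace ℝ F]

lemma fderiv_left_eq {g : E → F → ℂ}
    (hg : ContDiff ℝ (⊤ : ℕ∞) (fun p : E × F => g p.1 p.2)) (x v : E) (ξ : F) :
    fderiv ℝ (fun y => g y ξ) x v = fderiv ℝ (fun p : E × F => g p.1 p.2) (x, ξ) (v, 0) := by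
  have h : HasFDerivAt (fun p : E × F => g p.1 p.2) _ (x, ξ) :=
    (hg.differentiable (by simp) (x, ξ)).hasFDerivAt
  have h2 := HasFDerivAt.comp (f := fun y : E => (y, ξ)) x h (hasFDerivAt_prodMk_left x ξ)
  have h3 : fderiv ℝ (fun y => g y ξ) x = _ := h2.fderiv
  rw [h3]; simp

lemma fderiv_right_eq {g : E → F → ℂ}
    (hg : ContDiff ℝ (⊤ : ℕ∞) (fun p : E × F => g p.1 p.2)) (x : E) (ξ w : F) :
    fderiv ℝ (g x) ξ w = fderiv ℝ (fun p : E × F => g p.1 p.2) (x, ξ) (0, w) := by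
  have h : HasFDerivAt (fun p : E × F => g p.1 p.2) _ (x, ξ) :=
    (hg.differentiable (by simp) (x, ξ)).hasFDerivAt
  have h2 := HasFDerivAt.comp (f := fun y : F => (x, y)) ξ h (hasFDerivAt_prodMk_right x ξ)
  have h3 : fderiv ℝ (g x) ξ = _ := h2.fderiv
  rw [h3]; simp

lemma contDiff_fderiv_apply_const {g : E → ℂ} (hg : ContDiff ℝ (⊤ : ℕ∞) g) (v : E) :
    ContDiff ℝ (⊤ : ℕ∞) (fun p => fderiv ℝ g p v) :=
  (hg.fderiv_right (m := ((⊤ : ℕ∞) : WithTop ℕ∞)) (by simp)).clm_apply contDiff_const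

lemma contDiff_fderiv_left {g : E → F → ℂ}
    (hg : ContDiff ℝ (⊤ : ℕ∞) (fun p : E × F => g p.1 p.2)) (v : E) :
    ContDiff ℝ (⊤ : ℕ∞) (fun p : E × F => fderiv ℝ (fun y => g y p.2) p.1 v) := by
  simp only [fderiv_left_eq hg]
  exact contDiff_fderiv_apply_const hg (v, 0)

lemma contDiff_fderiv_right {g : E → F → ℂ}
    (hg : ContDiff ℝ (⊤ : ℕ∞) (fun p : E × F => g p.1 p.2)) (w : F) :
    ContDiff ℝ (⊤ : ℕ∞) (fun p : E × F => fderiv ℝ (g p.1) p.2 w) := by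
  simp only [fderiv_right_eq hg]
  exact contDiff_fderiv_apply_const hg (0, w)

lemma fderiv_fderiv_apply_comm {g : E → ℂ} (hg : ContDiff ℝ (⊤ : ℕ∞) g) (p v w : E) :
    fderiv ℝ (fun q => fderiv ℝ g q v) p w = fderiv ℝ (fun q => fderiv ℝ g q w) p v := by
  have hd : DifferentiableAt ℝ (fderiv ℝ g) p :=
    ((hg.fderiv_right (m := ((⊤ : ℕ∞) : WithTop ℕ∞)) (by simp)).differentiable (by simp)) p
  have key : ∀ u : E, fderiv ℝ (fun q => fderiv ℝ g q u) p = (fderiv ℝ (fderiv ℝ g) p).flip u := by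
    intro u
    rw [fderiv_clm_apply hd (differentiableAt_const u)]
    ext z; simp
  rw [key, key]
  have := (hg.contDiffAt (x := p)).isSymmSndFDerivAt (by
    rw [minSmoothness_of_isRCLikeNormedField]
    exact WithTop.coe_le_coe.2 (le_top (a := (2 : ℕ∞))))
  exact this w v

lemma fderiv_left_right_comm {g : E → F → ℂ}
    (hg : ContDiff ℝ (⊤ : ℕ∞) (fun p : E × F => g p.1 p.2)) (x v : E) (ξ w : F) :
    fderiv ℝ (fun ζ => fderiv ℝ (fun y => g y ζ) x v) ξ w =
      fderiv ℝ (fun y => fderiv ℝ (g y) ξ w) x v := by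
  have h1 := fderiv_right_eq (g := fun x ζ => fderiv ℝ (fun y => g y ζ) x v)
    (contDiff_fderiv_left hg v) x ξ w
  have h2 := fderiv_left_eq (g := fun x ζ => fderiv ℝ (g x) ζ w)
    (contDiff_fderiv_right hg w) x v ξ
  rw [h1, h2]
  simp only [fderiv_right_eq hg, fderiv_left_eq hg]
  exact fderiv_fderiv_apply_comm hg (x, ξ) (v, 0) (0, w)

end PartialDerivatives

lemma pderivList_append {k : ℕ} (L M : List (Fin k)) (f : (Fin k → ℝ) → ℂ) :
    pderivList (L ++ M) f = pderivList L (pderivList M f) := by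
  induction L with
  | nil => rfl
  | cons i L ih => simp only [List.cons_append, pderivList, ih]

lemma contDiff_pderivList_right {k l : ℕ} (β : List (Fin l)) {f : (Fin k → ℝ) → (Fin l → ℝ) → ℂ}
    (hf : ContDiff ℝ (⊤ : ℕ∞) (fun p : (Fin k → ℝ) × (Fin l → ℝ) => f p.1 p.2)) :
    ContDiff ℝ (⊤ : ℕ∞) (fun p : (Fin k → ℝ) × (Fin l → ℝ) => pderivList β (f p.1) p.2) := by
  induction β with
  | nil => exact hf
  | cons j β ih => exact contDiff_fderiv_right (g := fun x => pderivList β (f x)) ih _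

lemma pderivList_fderiv_left {k l : ℕ} (β : List (Fin l)) {f : (Fin k → ℝ) → (Fin l → ℝ) → ℂ}
    (hf : ContDiff ℝ (⊤ : ℕ∞) (fun p : (Fin k → ℝ) × (Fin l → ℝ) => f p.1 p.2))
    (x v : Fin k → ℝ) :
    pderivList β (fun ξ => fderiv ℝ (fun y => f y ξ) x v) =
      fun ξ => fderiv ℝ (fun y => pderivList β (f y) ξ) x v := by
  induction β with
  | nil => rfl
  | cons j β ih =>
    funext ξ
    simp only [pderivList, ih]
    exact fderiv_left_right_comm (g := fun x => pderivList β (f x))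
      (contDiff_pderivList_right β hf) x v ξ _

lemma IsSymbol.fderiv_left {k : ℕ} {m : ℝ} {f : (Fin k → ℝ) → (Fin k → ℝ) → ℂ}
    (hf : IsSymbol m f) (i : Fin k) :
    IsSymbol m (fun x ξ => fderiv ℝ (fun y => f y ξ) x (Pi.single i 1)) := by
  refine ⟨contDiff_fderiv_left hf.1 _, fun α β => ?_⟩
  obtain ⟨C, hC, h⟩ := hf.2 (α ++ [i]) β
  refine ⟨C, hC, fun x ξ => ?_⟩
  convert h x ξ using 2
  simp only [mixedPDeriv, pderivList_fderiv_left β hf.1, pderivList_append]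
  rfl

lemma IsSymbol.fderiv_right {k : ℕ} {m : ℝ} {f : (Fin k → ℝ) → (Fin k → ℝ) → ℂ}
    (hf : IsSymbol m f) (j : Fin k) :
    IsSymbol (m - 1) (fun x ξ => fderiv ℝ (f x) ξ (Pi.single j 1)) := by
  refine ⟨contDiff_fderiv_right hf.1 _, fun α β => ?_⟩
  obtain ⟨C, hC, h⟩ := hf.2 α (β ++ [j])
  refine ⟨C, hC, fun x ξ => ?_⟩
  convert h x ξ using 2
  · simp only [mixedPDeriv, pderivList_append]
    rfl
  · congr 1
    simp only [List.length_append, List.length_singleton]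
    push_cast
    ring

lemma IsSymbol.exists_norm_le {k : ℕ} {m : ℝ} {f : (Fin k → ℝ) → (Fin k → ℝ) → ℂ}
    (hf : IsSymbol m f) :
    ∃ C : ℝ, 0 ≤ C ∧ ∀ x ξ, ‖f x ξ‖ ≤ C * (1 + ∑ i, ξ i ^ 2) ^ (m / 2) := by
  simpa [mixedPDeriv, pderivList] using hf.2 [] []

lemma norm_integral_le_of_norm_le_div_sq {E : Type*} [NormedAddCommGroup E] [NormedSpace ℝ E]
    {φ : ℝ → E} {a b c : ℝ} (ha : 0 < a) (hab : a ≤ b)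
    (h : ∀ τ, a ≤ τ → ‖φ τ‖ ≤ c / τ ^ 2) :
    ‖∫ τ in a..b, φ τ‖ ≤ c * (1 / a - 1 / b) := by
  have hne : ∀ τ ∈ Set.uIcc a b, τ ≠ 0 := fun τ hτ => by
    rw [Set.uIcc_of_le hab] at hτ
    exact (ha.trans_le hτ.1).ne'
  have hcont : ContinuousOn (fun τ : ℝ => c / τ ^ 2) (Set.uIcc a b) :=
    continuousOn_const.div (by fun_prop) fun τ hτ => pow_ne_zero 2 (hne τ hτ)
  have hder : ∀ τ ∈ Set.uIcc a b, HasDerivAt (fun τ : ℝ => -(c / τ)) (c / τ ^ 2) τ := by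
    intro τ hτ
    refine ((hasDerivAt_const τ c).fun_div (hasDerivAt_id' τ) (hne τ hτ)).fun_neg.congr_deriv ?_
    ring
  have hval : ∫ τ in a..b, c / τ ^ 2 = c * (1 / a - 1 / b) := by
    rw [intervalIntegral.integral_eq_sub_of_hasDerivAt hder hcont.intervalIntegrable]
    ring
  rw [← hval]
  exact intervalIntegral.norm_integral_le_of_norm_le hab
    (ae_of_all _ fun τ hτ => h τ hτ.1.le) hcont.intervalIntegrable

lemma continuousOn_sin_mul_div {t a b : ℝ} (ha : 0 < a) (hab : a ≤ b) :
    ContinuousOn (fun τ : ℝ => Real.sin (t * τ) / τ) (Set.uIcc a b) := by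
  refine ContinuousOn.div (by fun_prop) continuousOn_id fun τ hτ => ?_
  rw [Set.uIcc_of_le hab] at hτ
  exact (ha.trans_le hτ.1).ne'

lemma abs_integral_sin_mul_div_le {t a b : ℝ} (ht : t ≠ 0) (ha : 0 < a) (hab : a ≤ b) :
    |∫ τ in a..b, Real.sin (t * τ) / τ| ≤ 2 / |t| / a := by
  have hb : 0 < b := ha.trans_le hab
  have htp : 0 < |t| := abs_pos.2 ht
  have hne : ∀ τ ∈ Set.uIcc a b, τ ≠ 0 := fun τ hτ => by
    rw [Set.uIcc_of_le hab] at hτ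
    exact (ha.trans_le hτ.1).ne'
  have hc1 := continuousOn_sin_mul_div (t := t) ha hab
  have hc2 : ContinuousOn (fun τ : ℝ => Real.cos (t * τ) / t / τ ^ 2) (Set.uIcc a b) :=
    ContinuousOn.div (by fun_prop) (by fun_prop) fun τ hτ => pow_ne_zero 2 (hne τ hτ)
  have hder : ∀ τ ∈ Set.uIcc a b, HasDerivAt (fun τ : ℝ => -(Real.cos (t * τ) / t / τ))
      (Real.sin (t * τ) / τ + Real.cos (t * τ) / t / τ ^ 2) τ := by
    intro τ hτ
    have hτ0 := hne τ hτ
    have h1 : HasDerivAt (fun τ : ℝ => Real.cos (t * τ) / t) (-Real.sin (t * τ) * t / t) τ := by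
      have := ((hasDerivAt_id τ).const_mul t).cos.div_const t
      simpa using this
    refine (h1.fun_div (hasDerivAt_id' τ) hτ0).fun_neg.congr_deriv ?_
    field_simp
    ring
  have h := intervalIntegral.integral_eq_sub_of_hasDerivAt hder (hc1.add hc2).intervalIntegrable
  rw [intervalIntegral.integral_add hc1.intervalIntegrable hc2.intervalIntegrable] at h
  have h2 : ‖∫ τ in a..b, Real.cos (t * τ) / t / τ ^ 2‖ ≤ 1 / |t| * (1 / a - 1 / b) := by
    refine norm_integral_le_of_norm_le_div_sq ha hab fun τ _ => ?_
    rw [norm_div, norm_div, norm_pow, Real.norm_eq_abs, Real.norm_eq_abs, Real.norm_eq_abs, sq_abs]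
    gcongr
    exact Real.abs_cos_le_one _
  have h3 : ∀ c : ℝ, 0 < c → |Real.cos (t * c) / t / c| ≤ 1 / |t| * (1 / c) := by
    intro c hc
    rw [abs_div, abs_div, abs_of_pos hc, div_eq_mul_one_div _ c]
    gcongr
    exact Real.abs_cos_le_one _
  have e1 := abs_le.1 (h3 a ha)
  have e2 := abs_le.1 (h3 b hb)
  rw [Real.norm_eq_abs] at h2
  have e3 := abs_le.1 h2
  have e4 : 2 / |t| / a = 2 * (1 / |t| * (1 / a)) := by ring
  rw [e4, abs_le]
  rw [mul_sub] at e3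
  constructor <;> linarith [e1.1, e1.2, e2.1, e2.2, e3.1, e3.2]

lemma exists_abs_integral_sin_mul_div_le (t : ℝ) :
    ∃ B : ℝ, 0 ≤ B ∧ ∀ a b : ℝ, 0 < a → a ≤ b →
      |∫ τ in a..b, Real.sin (t * τ) / τ| ≤ B / a := by
  rcases eq_or_ne t 0 with rfl | ht
  · exact ⟨0, le_rfl, fun a b _ _ => by simp⟩
  · exact ⟨2 / |t|, by positivity, fun a b => abs_integral_sin_mul_div_le ht⟩

lemma abs_integral_sin_mul_div_le_three (t : ℝ) {a b : ℝ} (ha : 0 < a) (hab : a ≤ b) :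
    |∫ τ in a..b, Real.sin (t * τ) / τ| ≤ 3 := by
  rcases eq_or_ne t 0 with rfl | ht
  · simp
  have htp : 0 < |t| := abs_pos.2 ht
  have far : ∀ c d : ℝ, 1 / |t| ≤ c → c ≤ d → |∫ τ in c..d, Real.sin (t * τ) / τ| ≤ 2 := by
    intro c d hc hcd
    have hc0 : 0 < c := (by positivity : 0 < 1 / |t|).trans_le hc
    refine (abs_integral_sin_mul_div_le ht hc0 hcd).trans ?_
    rw [div_div, div_le_iff₀ (by positivity)]
    rw [div_le_iff₀ htp] at hc
    nlinarith
  have near : ∀ c : ℝ, a ≤ c → c ≤ 1 / |t| → |∫ τ in a..c, Real.sin (t * τ) / τ| ≤ 1 := by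
    intro c hac hc
    have h : ‖∫ τ in a..c, Real.sin (t * τ) / τ‖ ≤ |t| * |c - a| := by
      refine intervalIntegral.norm_integral_le_of_norm_le_const fun τ hτ => ?_
      rw [Set.uIoc_of_le hac] at hτ
      have hτ0 : 0 < τ := ha.trans hτ.1
      rw [norm_div, Real.norm_eq_abs, Real.norm_eq_abs, div_le_iff₀ (abs_pos.2 hτ0.ne'), ← abs_mul]
      exact Real.abs_sin_le_abs
    refine h.trans ?_
    rw [abs_of_nonneg (sub_nonneg.2 hac)]
    rw [le_div_iff₀ htp] at hc
    nlinarith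
  rcases le_total b (1 / |t|) with hb | hb
  · linarith [near b hab hb]
  rcases le_total a (1 / |t|) with ha' | ha'
  · rw [← intervalIntegral.integral_add_adjacent_intervals
      (continuousOn_sin_mul_div ha ha').intervalIntegrable
      (continuousOn_sin_mul_div (ha.trans_le ha') hb).intervalIntegrable]
    refine (abs_add_le _ _).trans ?_
    linarith [near _ ha' le_rfl, far _ b le_rfl hb]
  · linarith [far a b ha' hab]

lemma norm_exp_I_mul_mul (t τ : ℝ) : ‖Complex.exp (Complex.I * (t : ℂ) * (τ : ℂ))‖ = 1 := by
  have : Complex.I * (t : ℂ) * (τ : ℂ) = ((t * τ : ℝ) : ℂ) * Complex.I := by push_cast; ring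
  rw [this, Complex.norm_exp_ofReal_mul_I]

/-- If `φ(τ) = e / τ + O(c / τ²)` for large `|τ|`, the tails of the symmetric oscillatory integral
of `φ` are controlled by those of `∫ sin (t τ) / τ`. -/
lemma norm_symm_integral_sub_le {φ : ℝ → ℂ} (hφ : Continuous φ) {e : ℂ} {c : ℝ} {R₀ : ℝ}
    (hR₀ : 0 < R₀) (h : ∀ τ : ℝ, R₀ ≤ |τ| → ‖φ τ - e / τ‖ ≤ c / τ ^ 2) (t : ℝ) {R R' : ℝ}
    (hR : R₀ ≤ R) (hRR' : R ≤ R') :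
    ‖(∫ τ in (-R')..R', Complex.exp (Complex.I * (t : ℂ) * (τ : ℂ)) * φ τ) -
        ∫ τ in (-R)..R, Complex.exp (Complex.I * (t : ℂ) * (τ : ℂ)) * φ τ‖ ≤
      2 * c / R + 2 * ‖e‖ * |∫ τ in R..R', Real.sin (t * τ) / τ| := by
  set ψ : ℝ → ℂ := fun τ => Complex.exp (Complex.I * (t : ℂ) * (τ : ℂ)) * φ τ with hψ
  have hR0 : 0 < R := hR₀.trans_le hR
  have hψc : Continuous ψ := by fun_prop
  have hψi : ∀ a b, IntervalIntegrable ψ volume a b := fun a b => hψc.intervalIntegrable a b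
  have hψc' : Continuous fun τ => ψ (-τ) := by fun_prop
  have hsplit : (∫ τ in (-R')..R', ψ τ) - ∫ τ in (-R)..R, ψ τ =
      ∫ τ in R..R', (ψ τ + ψ (-τ)) := by
    rw [intervalIntegral.integral_add (hψi _ _) (hψc'.intervalIntegrable _ _),
      intervalIntegral.integral_comp_neg (f := ψ),
      ← intervalIntegral.integral_add_adjacent_intervals (hψi (-R') (-R)) (hψi (-R) R'),
      ← intervalIntegral.integral_add_adjacent_intervals (hψi (-R) R) (hψi R R')]
    ring
  have hsinC : IntervalIntegrable
      (fun τ : ℝ => (2 * Complex.I * e) * ((Real.sin (t * τ) / τ : ℝ) : ℂ)) volume R R' :=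
    (Complex.continuous_ofReal.comp_continuousOn
      (continuousOn_sin_mul_div hR0 hRR')).intervalIntegrable.const_mul _
  have hrem : ‖∫ τ in R..R', ((ψ τ + ψ (-τ)) -
      (2 * Complex.I * e) * ((Real.sin (t * τ) / τ : ℝ) : ℂ))‖ ≤ 2 * c * (1 / R - 1 / R') := by
    refine norm_integral_le_of_norm_le_div_sq hR0 hRR' fun τ hτ => ?_
    have hτ0 : 0 < τ := hR0.trans_le hτ
    have hτC : (τ : ℂ) ≠ 0 := by exact_mod_cast hτ0.ne'
    have h1 := h τ (by rw [abs_of_pos hτ0]; linarith)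
    have h2 := h (-τ) (by rw [abs_neg, abs_of_pos hτ0]; linarith)
    have key : (ψ τ + ψ (-τ)) - (2 * Complex.I * e) * ((Real.sin (t * τ) / τ : ℝ) : ℂ) =
        Complex.exp (Complex.I * (t : ℂ) * (τ : ℂ)) * (φ τ - e / τ) +
        Complex.exp (Complex.I * (t : ℂ) * ((-τ : ℝ) : ℂ)) * (φ (-τ) - e / ((-τ : ℝ) : ℂ)) := by
      have hs : ((Real.sin (t * τ) : ℝ) : ℂ) =
          (Complex.exp (-(Complex.I * (t : ℂ) * (τ : ℂ))) -
            Complex.exp (Complex.I * (t : ℂ) * (τ : ℂ))) * Complex.I / 2 := by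
        rw [Complex.ofReal_sin, Complex.sin]
        push_cast
        congr 4 <;> ring_nf
      simp only [hψ]
      push_cast
      rw [← Complex.ofReal_mul, ← Complex.ofReal_sin, hs]
      have e1 : Complex.I * (t : ℂ) * -(τ : ℂ) = -(Complex.I * (t : ℂ) * (τ : ℂ)) := by ring
      rw [e1]
      field_simp
      ring_nf
      simp only [Complex.I_sq]
      ring
    rw [key]
    refine (norm_add_le _ _).trans ?_
    rw [norm_mul, norm_mul, norm_exp_I_mul_mul, norm_exp_I_mul_mul, one_mul, one_mul]
    rw [neg_sq] at h2
    refine (add_le_add h1 h2).trans (le_of_eq ?_)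
    ring
  have hc : 0 ≤ c := by
    have := (norm_nonneg _).trans (h R (by rwa [abs_of_pos hR0]))
    by_contra hneg
    exact absurd this (not_le.2 (div_neg_of_neg_of_pos (not_le.1 hneg) (by positivity)))
  rw [hsplit]
  have hadd : ∫ τ in R..R', (ψ τ + ψ (-τ)) =
      (∫ τ in R..R', ((ψ τ + ψ (-τ)) -
        (2 * Complex.I * e) * ((Real.sin (t * τ) / τ : ℝ) : ℂ))) +
      (2 * Complex.I * e) * ((∫ τ in R..R', Real.sin (t * τ) / τ : ℝ) : ℂ) := by
    rw [intervalIntegral.integral_sub ((hψc.fun_add hψc').intervalIntegrable _ _) hsinC,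
      intervalIntegral.integral_const_mul, intervalIntegral.integral_ofReal]
    ring
  rw [hadd]
  refine (norm_add_le _ _).trans (add_le_add (hrem.trans ?_) (le_of_eq ?_))
  · have : 0 ≤ 1 / R' := by have := hR0.trans_le hRR'; positivity
    calc 2 * c * (1 / R - 1 / R') ≤ 2 * c * (1 / R) := by gcongr; linarith
      _ = 2 * c / R := by ring
  · rw [norm_mul, Complex.norm_real]
    simp

section OscillatoryIntegral

variable {d : ℕ}

/-- `(η, τ) ↦ Fin.snoc η τ` as a continuous linear map. -/
noncomputable def snocCLM (d : ℕ) : (Fin d → ℝ) × ℝ →L[ℝ] (Fin (d + 1) → ℝ) :=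
  LinearMap.toContinuousLinearMap
    { toFun := fun p => Fin.snoc p.1 p.2
      map_add' := fun p q => by
        ext i
        refine Fin.lastCases ?_ (fun j => ?_) i <;> simp
      map_smul' := fun c p => by
        ext i
        refine Fin.lastCases ?_ (fun j => ?_) i <;> simp }

lemma snocCLM_apply (η : Fin d → ℝ) (τ : ℝ) : snocCLM d (η, τ) = Fin.snoc η τ := rfl

lemma snocCLM_zero_right (η : Fin d → ℝ) :
    snocCLM d (η, 0) = ∑ j, η j • (Pi.single j.castSucc 1 : Fin (d + 1) → ℝ) := by
  ext i
  rw [snocCLM_apply]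
  refine Fin.lastCases ?_ (fun j => ?_) i
  · simp [(Fin.castSucc_ne_last _).symm]
  · simp [Pi.single_apply]

lemma sum_sq_snoc (η : Fin d → ℝ) (τ : ℝ) :
    1 + ∑ i, (Fin.snoc η τ : Fin (d + 1) → ℝ) i ^ 2 = 1 + ∑ i, η i ^ 2 + τ ^ 2 := by
  rw [Fin.sum_univ_castSucc]
  simp [add_assoc]

/-- The derivatives of a symbol in all the variables `x` and in the first `d` variables `ξ`. -/
noncomputable def symbolDeriv (s : Fin (d + 1) ⊕ Fin d)
    (f : (Fin (d + 1) → ℝ) → (Fin (d + 1) → ℝ) → ℂ) :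
    (Fin (d + 1) → ℝ) → (Fin (d + 1) → ℝ) → ℂ :=
  match s with
  | .inl i => fun x ξ => fderiv ℝ (fun y => f y ξ) x (Pi.single i 1)
  | .inr j => fun x ξ => fderiv ℝ (f x) ξ (Pi.single j.castSucc 1)

/-- The coordinates of `(x, η)`, as complex valued functionals. -/
noncomputable def paramCoord (s : Fin (d + 1) ⊕ Fin d) :
    (Fin (d + 1) → ℝ) × (Fin d → ℝ) →L[ℝ] ℂ :=
  match s with
  | .inl i => Complex.ofRealCLM.comp
      ((ContinuousLinearMap.proj i).comp (ContinuousLinearMap.fst ℝ _ _))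
  | .inr j => Complex.ofRealCLM.comp
      ((ContinuousLinearMap.proj j).comp (ContinuousLinearMap.snd ℝ _ _))

lemma hasFDerivAt_symbol_snoc {f : (Fin (d + 1) → ℝ) → (Fin (d + 1) → ℝ) → ℂ}
    (hf : ContDiff ℝ (⊤ : ℕ∞)
      (fun p : (Fin (d + 1) → ℝ) × (Fin (d + 1) → ℝ) => f p.1 p.2))
    (τ : ℝ) (p : (Fin (d + 1) → ℝ) × (Fin d → ℝ)) :
    HasFDerivAt (fun p : (Fin (d + 1) → ℝ) × (Fin d → ℝ) => f p.1 (Fin.snoc p.2 τ))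
      (∑ s, symbolDeriv s f p.1 (Fin.snoc p.2 τ) • paramCoord s) p := by
  set g : (Fin (d + 1) → ℝ) × (Fin d → ℝ) → (Fin (d + 1) → ℝ) × (Fin (d + 1) → ℝ) :=
    fun p => (p.1, snocCLM d (p.2, τ)) with hg
  have h1 : HasFDerivAt g ((ContinuousLinearMap.fst ℝ _ _).prod ((snocCLM d).comp
      ((ContinuousLinearMap.snd ℝ _ _).prod 0))) p :=
    hasFDerivAt_fst.prodMk ((snocCLM d).hasFDerivAt.comp p
      (hasFDerivAt_snd.prodMk (hasFDerivAt_const τ p)))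
  have h2 := ((hf.differentiable (by simp) (g p)).hasFDerivAt).comp p h1
  refine h2.congr_fderiv ?_
  refine ContinuousLinearMap.ext fun v => ?_
  set D := fderiv ℝ (fun p : (Fin (d + 1) → ℝ) × (Fin (d + 1) → ℝ) => f p.1 p.2) (g p) with hD
  have e1 : D (v.1, 0) = ∑ i, (v.1 i : ℂ) * D (Pi.single i 1, 0) := by
    have : v.1 = ∑ i, v.1 i • (Pi.single i 1 : Fin (d + 1) → ℝ) := by
      ext j; simp [Pi.single_apply]
    have h := congrArg (D.comp (ContinuousLinearMap.inl ℝ _ _)) this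
    simpa using h
  have e2 : D (0, snocCLM d (v.2, 0)) = ∑ j, (v.2 j : ℂ) * D (0, Pi.single j.castSucc 1) := by
    have h := congrArg (D.comp (ContinuousLinearMap.inr ℝ _ _)) (snocCLM_zero_right v.2)
    simpa using h
  have e3 : D (v.1, snocCLM d (v.2, 0)) = D (v.1, 0) + D (0, snocCLM d (v.2, 0)) := by
    rw [← map_add]; simp
  change D (v.1, snocCLM d (v.2, 0)) = _
  rw [e3, e1, e2]
  simp only [Fintype.sum_sum_type, add_apply, sum_apply,
    smul_apply, symbolDeriv, paramCoord, fderiv_left_eq hf, fderiv_right_eq hf,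
    smul_eq_mul]
  congr 1 <;> refine Finset.sum_congr rfl fun i _ => ?_ <;> rw [mul_comm] <;> rfl

/-- The truncated oscillatory integral `(2π)⁻¹ ∫_{-R}^R e^{itτ} f(x, (η, τ)) dτ`. -/
noncomputable def truncOsc (f : (Fin (d + 1) → ℝ) → (Fin (d + 1) → ℝ) → ℂ) (t R : ℝ)
    (p : (Fin (d + 1) → ℝ) × (Fin d → ℝ)) : ℂ :=
  (2 * Real.pi : ℂ)⁻¹ * ∫ τ in (-R)..R, Complex.exp (Complex.I * (t : ℂ) * (τ : ℂ)) *
    f p.1 (Fin.snoc p.2 τ)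

/-- Uniform bounds of order `-k` for the truncated oscillatory integrals of `f`, together with a
locally uniform rate of convergence as the truncation is removed. -/
def OscBound (k : ℕ) (f : (Fin (d + 1) → ℝ) → (Fin (d + 1) → ℝ) → ℂ) : Prop :=
  ∃ C : ℝ, 0 ≤ C ∧
    (∀ p t R R', 1 ≤ R → R ≤ R' → ‖truncOsc f t R' p - truncOsc f t R p‖ ≤
      C * ((1 + ‖p.2‖) / R + |∫ τ in R..R', Real.sin (t * τ) / τ|)) ∧
    ∀ p t R, √(1 + ∑ i, p.2 i ^ 2) ≤ R →
      ‖truncOsc f t R p‖ ≤ C * (1 + ∑ i, p.2 i ^ 2) ^ (-(k : ℝ) / 2)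

lemma norm_two_pi_inv_mul_le (z : ℂ) : ‖(2 * Real.pi : ℂ)⁻¹ * z‖ ≤ ‖z‖ := by
  rw [norm_mul]
  refine mul_le_of_le_one_left (norm_nonneg _) ?_
  rw [norm_inv, norm_mul, Complex.norm_real, Real.norm_of_nonneg Real.pi_pos.le]
  have := Real.pi_gt_three
  refine inv_le_one_of_one_le₀ ?_
  norm_num
  linarith

lemma one_le_one_add_sum_sq (η : Fin d → ℝ) : 1 ≤ 1 + ∑ i, η i ^ 2 :=
  le_add_of_nonneg_right (Finset.sum_nonneg fun _ _ => sq_nonneg _)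

lemma norm_le_sqrt_one_add_sum_sq (η : Fin d → ℝ) : ‖η‖ ≤ √(1 + ∑ i, η i ^ 2) := by
  refine (pi_norm_le_iff_of_nonneg (Real.sqrt_nonneg _)).2 fun i => Real.le_sqrt_of_sq_le ?_
  rw [Real.norm_eq_abs, sq_abs]
  have := Finset.single_le_sum (f := fun i => η i ^ 2) (fun i _ => sq_nonneg _) (Finset.mem_univ i)
  linarith

lemma continuous_symbol_snoc {f : (Fin (d + 1) → ℝ) → (Fin (d + 1) → ℝ) → ℂ}
    (hf : ContDiff ℝ (⊤ : ℕ∞)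
      (fun p : (Fin (d + 1) → ℝ) × (Fin (d + 1) → ℝ) => f p.1 p.2)) :
    Continuous fun q : ((Fin (d + 1) → ℝ) × (Fin d → ℝ)) × ℝ => f q.1.1 (Fin.snoc q.1.2 q.2) :=
  hf.continuous.comp (continuous_fst.fst.prodMk
    ((snocCLM d).continuous.comp (continuous_fst.snd.prodMk continuous_snd)))

lemma norm_truncOsc_sub_le {f : (Fin (d + 1) → ℝ) → (Fin (d + 1) → ℝ) → ℂ}
    {p : (Fin (d + 1) → ℝ) × (Fin d → ℝ)}
    (hf : Continuous fun τ : ℝ => f p.1 (Fin.snoc p.2 τ)) {e : ℂ} {c : ℝ}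
    (h : ∀ τ : ℝ, 1 ≤ |τ| → ‖f p.1 (Fin.snoc p.2 τ) - e / τ‖ ≤ c / τ ^ 2) (t : ℝ) {R R' : ℝ}
    (hR : 1 ≤ R) (hRR' : R ≤ R') :
    ‖truncOsc f t R' p - truncOsc f t R p‖ ≤
      2 * c / R + 2 * ‖e‖ * |∫ τ in R..R', Real.sin (t * τ) / τ| := by
  rw [truncOsc, truncOsc, ← mul_sub]
  exact (norm_two_pi_inv_mul_le _).trans (norm_symm_integral_sub_le hf one_pos h t hR hRR')

lemma norm_truncOsc_le {f : (Fin (d + 1) → ℝ) → (Fin (d + 1) → ℝ) → ℂ}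
    {p : (Fin (d + 1) → ℝ) × (Fin d → ℝ)}
    (hf : Continuous fun τ : ℝ => f p.1 (Fin.snoc p.2 τ)) {e : ℂ} {c M : ℝ}
    (h : ∀ τ : ℝ, 1 ≤ |τ| → ‖f p.1 (Fin.snoc p.2 τ) - e / τ‖ ≤ c / τ ^ 2)
    (hM : ∀ τ : ℝ, ‖f p.1 (Fin.snoc p.2 τ)‖ ≤ M) (t : ℝ) {R R' : ℝ}
    (hR : 1 ≤ R) (hRR' : R ≤ R') :
    ‖truncOsc f t R' p‖ ≤ 2 * R * M + 2 * c / R + 6 * ‖e‖ := by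
  have h1 : ‖truncOsc f t R p‖ ≤ 2 * R * M := by
    refine (norm_two_pi_inv_mul_le _).trans ?_
    refine (intervalIntegral.norm_integral_le_of_norm_le_const (C := M) fun τ _ => ?_).trans
      (le_of_eq ?_)
    · rw [norm_mul, norm_exp_I_mul_mul, one_mul]
      exact hM τ
    · rw [abs_of_nonneg (by linarith)]
      ring
  have h2 := norm_truncOsc_sub_le hf h t hR hRR'
  have h3 := mul_le_mul_of_nonneg_left
    (abs_integral_sin_mul_div_le_three t (one_pos.trans_le hR) hRR')
    (by positivity : 0 ≤ 2 * ‖e‖)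
  have h4 := norm_le_norm_add_norm_sub (truncOsc f t R p) (truncOsc f t R' p)
  rw [norm_sub_rev] at h4
  linarith [norm_sub_rev (truncOsc f t R p) (truncOsc f t R' p)]

lemma rpow_neg_natCast_div_two_le {q τ : ℝ} (hq : 1 ≤ q) (hτ : τ ≠ 0) (j : ℕ) :
    (q + τ ^ 2) ^ ((-2 - j : ℝ) / 2) ≤ q ^ (-(j : ℝ) / 2) / τ ^ 2 := by
  have hq0 : 0 < q := one_pos.trans_le hq
  have hτ2 : 0 < τ ^ 2 := by positivity
  have e : (-2 - j : ℝ) / 2 = -(j : ℝ) / 2 + -1 := by ring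
  rw [e, Real.rpow_add (by positivity), Real.rpow_neg_one, div_eq_mul_inv _ (τ ^ 2)]
  refine mul_le_mul (Real.rpow_le_rpow_of_nonpos hq0 (by linarith) ?_)
    (inv_anti₀ hτ2 (by linarith)) (by positivity) (by positivity)
  have : (0 : ℝ) ≤ j := by positivity
  linarith

lemma oscBound_of_isSymbol {f : (Fin (d + 1) → ℝ) → (Fin (d + 1) → ℝ) → ℂ} {j : ℕ}
    (hf : IsSymbol (-2 - j) f) : OscBound (j + 1) f := by
  obtain ⟨C, hC, h⟩ := hf.exists_norm_le
  have hcont := continuous_symbol_snoc hf.1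
  have hjn : (0 : ℝ) ≤ j := by positivity
  have tail : ∀ (p : (Fin (d + 1) → ℝ) × (Fin d → ℝ)) (τ : ℝ), 1 ≤ |τ| →
      ‖f p.1 (Fin.snoc p.2 τ) - 0 / τ‖ ≤
        (C * (1 + ∑ i, p.2 i ^ 2) ^ (-(j : ℝ) / 2)) / τ ^ 2 := by
    intro p τ hτ
    have hτ0 : τ ≠ 0 := by rintro rfl; simp at hτ; linarith
    rw [zero_div, sub_zero, mul_div_assoc]
    refine (h _ _).trans (mul_le_mul_of_nonneg_left ?_ hC)
    rw [sum_sq_snoc]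
    exact rpow_neg_natCast_div_two_le (one_le_one_add_sum_sq _) hτ0 j
  refine ⟨4 * C, by positivity, fun p t R R' hR hRR' => ?_, fun p t R hR => ?_⟩
  · have hc : Continuous fun τ : ℝ => f p.1 (Fin.snoc p.2 τ) :=
      hcont.comp (Continuous.prodMk_right p)
    have h1 := norm_truncOsc_sub_le hc (tail p) t hR hRR'
    simp only [norm_zero, mul_zero, zero_mul, add_zero] at h1
    have h2 : (1 + ∑ i, p.2 i ^ 2) ^ (-(j : ℝ) / 2) ≤ 1 :=
      Real.rpow_le_one_of_one_le_of_nonpos (one_le_one_add_sum_sq _) (by linarith)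
    have hR0 : 0 < R := one_pos.trans_le hR
    refine h1.trans ?_
    have h3 : 0 ≤ |∫ τ in R..R', Real.sin (t * τ) / τ| := abs_nonneg _
    have h4 : 2 * (C * (1 + ∑ i, p.2 i ^ 2) ^ (-(j : ℝ) / 2)) / R ≤ 4 * C * ((1 + ‖p.2‖) / R) := by
      rw [mul_div_assoc']
      refine div_le_div_of_nonneg_right ?_ hR0.le
      nlinarith [norm_nonneg p.2, mul_nonneg hC (norm_nonneg p.2),
        mul_le_mul_of_nonneg_left h2 hC]
    nlinarith
  · have hc : Continuous fun τ : ℝ => f p.1 (Fin.snoc p.2 τ) :=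
      hcont.comp (Continuous.prodMk_right p)
    set q := 1 + ∑ i, p.2 i ^ 2 with hq
    have hq1 : 1 ≤ q := one_le_one_add_sum_sq _
    have hq0 : 0 < q := one_pos.trans_le hq1
    have hM : ∀ τ : ℝ, ‖f p.1 (Fin.snoc p.2 τ)‖ ≤ C * q ^ ((-2 - j : ℝ) / 2) := by
      intro τ
      refine (h _ _).trans (mul_le_mul_of_nonneg_left ?_ hC)
      rw [sum_sq_snoc]
      exact Real.rpow_le_rpow_of_nonpos hq0 (by nlinarith) (by linarith)
    have h1 := norm_truncOsc_le hc (tail p) hM t (Real.one_le_sqrt.2 hq1) hR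
    refine h1.trans (le_of_eq ?_)
    have e1 : √q * q ^ ((-2 - j : ℝ) / 2) = q ^ (-((j + 1 : ℕ) : ℝ) / 2) := by
      rw [Real.sqrt_eq_rpow, ← Real.rpow_add hq0]
      congr 1; push_cast; ring
    have e2 : q ^ (-(j : ℝ) / 2) / √q = q ^ (-((j + 1 : ℕ) : ℝ) / 2) := by
      rw [Real.sqrt_eq_rpow, ← Real.rpow_sub hq0]
      congr 1; push_cast; ring
    rw [← hq]
    calc _ = 2 * C * (√q * q ^ ((-2 - j : ℝ) / 2)) + 2 * C * (q ^ (-(j : ℝ) / 2) / √q) := by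
          rw [norm_zero]; ring
      _ = _ := by rw [e1, e2]; ring

lemma OscBound.of_succ {f : (Fin (d + 1) → ℝ) → (Fin (d + 1) → ℝ) → ℂ} {k : ℕ}
    (hf : OscBound (k + 1) f) : OscBound k f := by
  obtain ⟨C, hC, h1, h2⟩ := hf
  refine ⟨C, hC, h1, fun p t R hR => (h2 p t R hR).trans ?_⟩
  refine mul_le_mul_of_nonneg_left ?_ hC
  refine Real.rpow_le_rpow_of_exponent_le (one_le_one_add_sum_sq _) ?_
  push_cast
  linarith

lemma truncOsc_add {g h : (Fin (d + 1) → ℝ) → (Fin (d + 1) → ℝ) → ℂ}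
    (hg : ContDiff ℝ (⊤ : ℕ∞)
      (fun p : (Fin (d + 1) → ℝ) × (Fin (d + 1) → ℝ) => g p.1 p.2))
    (hh : ContDiff ℝ (⊤ : ℕ∞)
      (fun p : (Fin (d + 1) → ℝ) × (Fin (d + 1) → ℝ) => h p.1 p.2)) (t R : ℝ)
    (p : (Fin (d + 1) → ℝ) × (Fin d → ℝ)) :
    truncOsc (fun x ξ => g x ξ + h x ξ) t R p = truncOsc g t R p + truncOsc h t R p := by
  have hgc : Continuous fun τ : ℝ => g p.1 (Fin.snoc p.2 τ) :=
    (continuous_symbol_snoc hg).comp (Continuous.prodMk_right p)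
  have hhc : Continuous fun τ : ℝ => h p.1 (Fin.snoc p.2 τ) :=
    (continuous_symbol_snoc hh).comp (Continuous.prodMk_right p)
  simp only [truncOsc, mul_add]
  rw [intervalIntegral.integral_add (Continuous.intervalIntegrable (by fun_prop) _ _)
    (Continuous.intervalIntegrable (by fun_prop) _ _), mul_add]

lemma OscBound.add {g h : (Fin (d + 1) → ℝ) → (Fin (d + 1) → ℝ) → ℂ} {k : ℕ}
    (hgs : ContDiff ℝ (⊤ : ℕ∞)
      (fun p : (Fin (d + 1) → ℝ) × (Fin (d + 1) → ℝ) => g p.1 p.2))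
    (hhs : ContDiff ℝ (⊤ : ℕ∞)
      (fun p : (Fin (d + 1) → ℝ) × (Fin (d + 1) → ℝ) => h p.1 p.2))
    (hg : OscBound k g) (hh : OscBound k h) : OscBound k (fun x ξ => g x ξ + h x ξ) := by
  obtain ⟨C, hC, h1, h2⟩ := hg
  obtain ⟨C', hC', h1', h2'⟩ := hh
  refine ⟨C + C', by positivity, fun p t R R' hR hRR' => ?_, fun p t R hR => ?_⟩
  · rw [truncOsc_add hgs hhs, truncOsc_add hgs hhs, add_sub_add_comm, add_mul]
    exact norm_add_le_of_le (h1 p t R R' hR hRR') (h1' p t R R' hR hRR')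
  · rw [truncOsc_add hgs hhs, add_mul]
    exact norm_add_le_of_le (h2 p t R hR) (h2' p t R hR)

/-- Along the `ξ_n`-axis, `g` is homogeneous of degree `-1` and odd. -/
def IsAxisOdd (g : (Fin (d + 1) → ℝ) → (Fin (d + 1) → ℝ) → ℂ) : Prop :=
  ∀ (x : Fin (d + 1) → ℝ) (τ : ℝ), 1 ≤ |τ| →
    g x (Fin.snoc (0 : Fin d → ℝ) τ) = (τ : ℂ)⁻¹ * g x (Fin.snoc (0 : Fin d → ℝ) 1)

lemma norm_symbol_snoc_sub_le {g : (Fin (d + 1) → ℝ) → (Fin (d + 1) → ℝ) → ℂ}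
    (hg : IsSymbol (-1) g) :
    ∃ C : ℝ, 0 ≤ C ∧ ∀ (x : Fin (d + 1) → ℝ) (η : Fin d → ℝ) (τ : ℝ), τ ≠ 0 →
      ‖g x (Fin.snoc η τ) - g x (Fin.snoc (0 : Fin d → ℝ) τ)‖ ≤ C * ‖η‖ / τ ^ 2 := by
  choose C hC h using fun j : Fin d => (hg.fderiv_right j.castSucc).exists_norm_le
  refine ⟨∑ j, C j, Finset.sum_nonneg fun j _ => hC j, fun x η τ hτ => ?_⟩
  have hτ2 : 0 < τ ^ 2 := by positivity
  have hbd : ∀ (ζ : Fin d → ℝ) (j : Fin d),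
      ‖symbolDeriv (.inr j) g x (Fin.snoc ζ τ)‖ ≤ C j * (τ ^ 2)⁻¹ := by
    intro ζ j
    refine (h j x _).trans (mul_le_mul_of_nonneg_left ?_ (hC j))
    rw [sum_sq_snoc, show ((-1 - 1 : ℝ) / 2) = -1 by norm_num, Real.rpow_neg_one]
    exact inv_anti₀ hτ2 (by linarith [one_le_one_add_sum_sq ζ])
  have hder : ∀ ζ ∈ (Set.univ : Set (Fin d → ℝ)),
      HasFDerivWithinAt (fun ζ : Fin d → ℝ => g x (Fin.snoc ζ τ))
        ((∑ s, symbolDeriv s g x (Fin.snoc ζ τ) • paramCoord s).comp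
          (ContinuousLinearMap.inr ℝ _ _)) Set.univ ζ := fun ζ _ =>
    (HasFDerivAt.comp (f := fun ζ : Fin d → ℝ => (x, ζ)) ζ
      (hasFDerivAt_symbol_snoc hg.1 τ (x, ζ)) (hasFDerivAt_prodMk_right x ζ)).hasFDerivWithinAt
  have hnorm : ∀ ζ ∈ (Set.univ : Set (Fin d → ℝ)),
      ‖(∑ s, symbolDeriv s g x (Fin.snoc ζ τ) • paramCoord s).comp
          (ContinuousLinearMap.inr ℝ (Fin (d + 1) → ℝ) (Fin d → ℝ))‖ ≤
        (∑ j, C j) * (τ ^ 2)⁻¹ := by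
    intro ζ _
    refine ContinuousLinearMap.opNorm_le_bound _
      (mul_nonneg (Finset.sum_nonneg fun j _ => hC j) (by positivity)) fun w => ?_
    simp only [Fintype.sum_sum_type, ContinuousLinearMap.comp_apply,
      add_apply, sum_apply,
      smul_apply, ContinuousLinearMap.inr_apply, paramCoord,
      ContinuousLinearMap.coe_fst', ContinuousLinearMap.coe_snd', ContinuousLinearMap.proj_apply,
      map_zero, smul_zero, Finset.sum_const_zero, zero_add]
    rw [Finset.sum_mul, Finset.sum_mul]
    refine norm_sum_le_of_le _ fun j _ => ?_
    rw [norm_smul, Complex.ofRealCLM_apply, Complex.norm_real]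
    exact mul_le_mul (hbd ζ j) (norm_le_pi_norm w j) (norm_nonneg _)
      (mul_nonneg (hC j) (by positivity))
  have := convex_univ.norm_image_sub_le_of_norm_hasFDerivWithin_le hder hnorm
    (Set.mem_univ 0) (Set.mem_univ η)
  rw [sub_zero] at this
  refine this.trans (le_of_eq ?_)
  ring

lemma oscBound_of_isAxisOdd {g : (Fin (d + 1) → ℝ) → (Fin (d + 1) → ℝ) → ℂ}
    (hg : IsSymbol (-1) g) (hodd : IsAxisOdd g) : OscBound 0 g := by
  obtain ⟨C, hC, h⟩ := hg.exists_norm_le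
  obtain ⟨C', hC', h'⟩ := norm_symbol_snoc_sub_le hg
  have hcont := continuous_symbol_snoc hg.1
  have tail : ∀ (p : (Fin (d + 1) → ℝ) × (Fin d → ℝ)) (τ : ℝ), 1 ≤ |τ| →
      ‖g p.1 (Fin.snoc p.2 τ) - g p.1 (Fin.snoc (0 : Fin d → ℝ) 1) / τ‖ ≤
        C' * ‖p.2‖ / τ ^ 2 := by
    intro p τ hτ
    rw [div_eq_inv_mul, ← hodd p.1 τ hτ]
    exact h' _ _ _ (by rintro rfl; simp at hτ; linarith)
  have hM : ∀ (x : Fin (d + 1) → ℝ) (η : Fin d → ℝ) (τ : ℝ),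
      ‖g x (Fin.snoc η τ)‖ ≤ C * (√(1 + ∑ i, η i ^ 2))⁻¹ := by
    intro x η τ
    have hq1 := one_le_one_add_sum_sq η
    refine (h _ _).trans (mul_le_mul_of_nonneg_left ?_ hC)
    rw [sum_sq_snoc, Real.sqrt_eq_rpow, ← Real.rpow_neg (by linarith), neg_div]
    exact Real.rpow_le_rpow_of_nonpos (by linarith) (by nlinarith) (by norm_num)
  have he : ∀ x : Fin (d + 1) → ℝ, ‖g x (Fin.snoc (0 : Fin d → ℝ) 1)‖ ≤ C := fun x => by
    simpa using hM x 0 1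
  refine ⟨2 * C' + 8 * C, by positivity, fun p t R R' hR hRR' => ?_, fun p t R hR => ?_⟩
  · have hc : Continuous fun τ : ℝ => g p.1 (Fin.snoc p.2 τ) :=
      hcont.comp (Continuous.prodMk_right p)
    refine (norm_truncOsc_sub_le hc (tail p) t hR hRR').trans ?_
    have hR0 : 0 < R := one_pos.trans_le hR
    rw [mul_add]
    refine add_le_add ?_ (mul_le_mul_of_nonneg_right ?_ (abs_nonneg _))
    · rw [mul_div_assoc']
      refine div_le_div_of_nonneg_right ?_ hR0.le
      nlinarith [norm_nonneg p.2, mul_nonneg hC (norm_nonneg p.2),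
        mul_nonneg hC' (norm_nonneg p.2)]
    · linarith [he p.1]
  · have hc : Continuous fun τ : ℝ => g p.1 (Fin.snoc p.2 τ) :=
      hcont.comp (Continuous.prodMk_right p)
    have hs : 1 ≤ √(1 + ∑ i, p.2 i ^ 2) := Real.one_le_sqrt.2 (one_le_one_add_sum_sq _)
    refine (norm_truncOsc_le hc (tail p) (hM p.1 p.2) t hs hR).trans ?_
    have h1 : 2 * √(1 + ∑ i, p.2 i ^ 2) * (C * (√(1 + ∑ i, p.2 i ^ 2))⁻¹) = 2 * C := by
      field_simp
    have h2 : 2 * (C' * ‖p.2‖) / √(1 + ∑ i, p.2 i ^ 2) ≤ 2 * C' := by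
      rw [div_le_iff₀ (by linarith), ← mul_assoc]
      exact mul_le_mul_of_nonneg_left (norm_le_sqrt_one_add_sum_sq _) (by positivity)
    rw [h1]
    simp only [Nat.cast_zero, neg_zero, zero_div, Real.rpow_zero, mul_one]
    linarith [he p.1]

/-- The amplitudes obtained from a classical symbol of order `-1` with odd principal symbol by
differentiating `k` times in `ξ`, and any number of times in `x`. -/
def IsOscAmplitude (k : ℕ) (f : (Fin (d + 1) → ℝ) → (Fin (d + 1) → ℝ) → ℂ) : Prop :=
  ∃ g h : (Fin (d + 1) → ℝ) → (Fin (d + 1) → ℝ) → ℂ, f = (fun x ξ => g x ξ + h x ξ) ∧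
    IsSymbol (-1 - k) g ∧ (k = 0 → IsAxisOdd g) ∧ IsSymbol (-2 - k) h

lemma IsOscAmplitude.contDiff {k : ℕ} {f : (Fin (d + 1) → ℝ) → (Fin (d + 1) → ℝ) → ℂ}
    (hf : IsOscAmplitude k f) :
    ContDiff ℝ (⊤ : ℕ∞)
      (fun p : (Fin (d + 1) → ℝ) × (Fin (d + 1) → ℝ) => f p.1 p.2) := by
  obtain ⟨g, h, rfl, hg, -, hh⟩ := hf
  exact hg.1.add hh.1

lemma IsOscAmplitude.oscBound {k : ℕ} {f : (Fin (d + 1) → ℝ) → (Fin (d + 1) → ℝ) → ℂ}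
    (hf : IsOscAmplitude k f) : OscBound k f := by
  obtain ⟨g, h, rfl, hg, hodd, hh⟩ := hf
  refine OscBound.add hg.1 hh.1 ?_ (oscBound_of_isSymbol hh).of_succ
  cases k with
  | zero => exact oscBound_of_isAxisOdd (by simpa using hg) (hodd rfl)
  | succ j =>
    refine oscBound_of_isSymbol ?_
    convert hg using 1
    push_cast
    ring

lemma symbolDeriv_add {g h : (Fin (d + 1) → ℝ) → (Fin (d + 1) → ℝ) → ℂ}
    (hg : ContDiff ℝ (⊤ : ℕ∞)
      (fun p : (Fin (d + 1) → ℝ) × (Fin (d + 1) → ℝ) => g p.1 p.2))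
    (hh : ContDiff ℝ (⊤ : ℕ∞)
      (fun p : (Fin (d + 1) → ℝ) × (Fin (d + 1) → ℝ) => h p.1 p.2))
    (s : Fin (d + 1) ⊕ Fin d) :
    symbolDeriv s (fun x ξ => g x ξ + h x ξ) =
      fun x ξ => symbolDeriv s g x ξ + symbolDeriv s h x ξ := by
  have hgh := hg.add hh
  have hadd : ∀ p, fderiv ℝ
      (fun p : (Fin (d + 1) → ℝ) × (Fin (d + 1) → ℝ) => g p.1 p.2 + h p.1 p.2) p = _ := fun p =>
    fderiv_fun_add (hg.differentiable (by simp) p) (hh.differentiable (by simp) p)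
  funext x ξ
  cases s with
  | inl i =>
    simp only [symbolDeriv, fderiv_left_eq hg, fderiv_left_eq hh]
    rw [fderiv_left_eq (g := fun x ξ => g x ξ + h x ξ) hgh, hadd]
    rfl
  | inr j =>
    simp only [symbolDeriv, fderiv_right_eq hg, fderiv_right_eq hh]
    rw [fderiv_right_eq (g := fun x ξ => g x ξ + h x ξ) hgh, hadd]
    rfl

lemma IsAxisOdd.symbolDeriv_inl {g : (Fin (d + 1) → ℝ) → (Fin (d + 1) → ℝ) → ℂ}
    (hodd : IsAxisOdd g) (i : Fin (d + 1)) : IsAxisOdd (symbolDeriv (.inl i) g) := by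
  intro x τ hτ
  have h : (fun y => g y (Fin.snoc (0 : Fin d → ℝ) τ)) =
      (τ : ℂ)⁻¹ • fun y => g y (Fin.snoc (0 : Fin d → ℝ) 1) := funext fun y => hodd y τ hτ
  simp only [symbolDeriv, h]
  rw [fderiv_const_smul_field]
  rfl

lemma IsOscAmplitude.symbolDeriv_inl {k : ℕ} {f : (Fin (d + 1) → ℝ) → (Fin (d + 1) → ℝ) → ℂ}
    (hf : IsOscAmplitude k f) (i : Fin (d + 1)) :
    IsOscAmplitude k (symbolDeriv (.inl i) f) := by
  obtain ⟨g, h, rfl, hg, hodd, hh⟩ := hf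
  exact ⟨_, _, symbolDeriv_add hg.1 hh.1 _, hg.fderiv_left i,
    fun hk => (hodd hk).symbolDeriv_inl i, hh.fderiv_left i⟩

lemma IsOscAmplitude.symbolDeriv_inr {k : ℕ} {f : (Fin (d + 1) → ℝ) → (Fin (d + 1) → ℝ) → ℂ}
    (hf : IsOscAmplitude k f) (j : Fin d) :
    IsOscAmplitude (k + 1) (symbolDeriv (.inr j) f) := by
  obtain ⟨g, h, rfl, hg, -, hh⟩ := hf
  refine ⟨_, _, symbolDeriv_add hg.1 hh.1 _, ?_, by simp, ?_⟩
  · rw [Nat.cast_succ, ← sub_sub]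
    exact hg.fderiv_right j.castSucc
  · rw [Nat.cast_succ, ← sub_sub]
    exact hh.fderiv_right j.castSucc

lemma IsOscAmplitude.exists_symbolDeriv {k : ℕ}
    {f : (Fin (d + 1) → ℝ) → (Fin (d + 1) → ℝ) → ℂ} (hf : IsOscAmplitude k f)
    (s : Fin (d + 1) ⊕ Fin d) : ∃ l, IsOscAmplitude l (symbolDeriv s f) := by
  cases s with
  | inl i => exact ⟨_, hf.symbolDeriv_inl i⟩
  | inr j => exact ⟨_, hf.symbolDeriv_inr j⟩

end OscillatoryIntegral

lemma hasFDerivAt_intervalIntegral_of_continuous {H E : Type*} [NormedAddCommGroup H]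
    [NormedSpace ℝ H] [ProperSpace H] [NormedAddCommGroup E] [NormedSpace ℝ E]
    {F : H → ℝ → E} {F' : H → ℝ → H →L[ℝ] E}
    (hF : Continuous fun q : H × ℝ => F q.1 q.2) (hF' : Continuous fun q : H × ℝ => F' q.1 q.2)
    (h : ∀ p τ, HasFDerivAt (fun p => F p τ) (F' p τ) p) (a b : ℝ) (p : H) :
    HasFDerivAt (fun p => ∫ τ in a..b, F p τ) (∫ τ in a..b, F' p τ) p := by
  obtain ⟨C, hC⟩ := ((isCompact_closedBall p 1).prod
    (isCompact_uIcc (a := a) (b := b))).exists_bound_of_continuousOn hF'.continuousOn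
  have hFp : ∀ p, Continuous (F p) := fun p => hF.comp (Continuous.prodMk_right p)
  have hFp' : ∀ p, Continuous (F' p) := fun p => hF'.comp (Continuous.prodMk_right p)
  refine intervalIntegral.hasFDerivAt_integral_of_dominated_of_fderiv_le (bound := fun _ => C)
    (Metric.closedBall_mem_nhds p one_pos)
    (Eventually.of_forall fun p => (hFp p).aestronglyMeasurable)
    ((hFp p).intervalIntegrable _ _) (hFp' p).aestronglyMeasurable
    (ae_of_all _ fun τ hτ q hq => hC (q, τ) ⟨hq, Set.uIoc_subset_uIcc hτ⟩)
    (by simp) (ae_of_all _ fun τ _ q _ => h q τ)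

section OscillatoryLimit

variable {d : ℕ}

lemma hasFDerivAt_truncOsc {f : (Fin (d + 1) → ℝ) → (Fin (d + 1) → ℝ) → ℂ}
    (hf : ContDiff ℝ (⊤ : ℕ∞)
      (fun p : (Fin (d + 1) → ℝ) × (Fin (d + 1) → ℝ) => f p.1 p.2))
    (hf' : ∀ s, ContDiff ℝ (⊤ : ℕ∞)
      (fun p : (Fin (d + 1) → ℝ) × (Fin (d + 1) → ℝ) => symbolDeriv s f p.1 p.2))
    (t R : ℝ) (p : (Fin (d + 1) → ℝ) × (Fin d → ℝ)) :
    HasFDerivAt (truncOsc f t R) (∑ s, truncOsc (symbolDeriv s f) t R p • paramCoord s) p := by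
  have hc := continuous_symbol_snoc hf
  have hc' := fun s => continuous_symbol_snoc (hf' s)
  have h := hasFDerivAt_intervalIntegral_of_continuous
    (F := fun p τ => Complex.exp (Complex.I * (t : ℂ) * (τ : ℂ)) * f p.1 (Fin.snoc p.2 τ))
    (F' := fun p τ => ∑ s, (Complex.exp (Complex.I * (t : ℂ) * (τ : ℂ)) *
      symbolDeriv s f p.1 (Fin.snoc p.2 τ)) • paramCoord s)
    (by fun_prop) (by fun_prop) (fun p τ => by
      refine ((hasFDerivAt_symbol_snoc hf τ p).const_mul _).congr_fderiv ?_
      simp only [Finset.smul_sum, smul_smul]) (-R) R p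
  refine (h.const_mul (2 * Real.pi : ℂ)⁻¹).congr_fderiv ?_
  have hi : ∀ s ∈ (Finset.univ : Finset (Fin (d + 1) ⊕ Fin d)), IntervalIntegrable
      (fun τ : ℝ => (Complex.exp (Complex.I * (t : ℂ) * (τ : ℂ)) *
        symbolDeriv s f p.1 (Fin.snoc p.2 τ)) • paramCoord s) volume (-R) R := fun s _ =>
    Continuous.intervalIntegrable
      (((by fun_prop : Continuous fun τ : ℝ => Complex.exp (Complex.I * (t : ℂ) * (τ : ℂ))).mul
        ((hc' s).comp (Continuous.prodMk_right p))).smul continuous_const) _ _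
  rw [intervalIntegral.integral_finsetSum hi, Finset.smul_sum]
  refine Finset.sum_congr rfl fun s _ => ?_
  rw [intervalIntegral.integral_smul_const, smul_smul]
  rfl

/-- The oscillatory integral `(2π)⁻¹ ∫ e^{itτ} f(x, (η, τ)) dτ`, as a limit of symmetric
truncations. -/
noncomputable def oscLimit (f : (Fin (d + 1) → ℝ) → (Fin (d + 1) → ℝ) → ℂ) (t : ℝ)
    (p : (Fin (d + 1) → ℝ) × (Fin d → ℝ)) : ℂ :=
  limUnder atTop fun R => truncOsc f t R p

lemma OscBound.uniformCauchySeqOn {k : ℕ} {f : (Fin (d + 1) → ℝ) → (Fin (d + 1) → ℝ) → ℂ}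
    (hf : OscBound k f) (t M : ℝ) :
    UniformCauchySeqOn (fun R => truncOsc f t R) atTop
      {p : (Fin (d + 1) → ℝ) × (Fin d → ℝ) | ‖p.2‖ < M} := by
  obtain ⟨C, hC, h, -⟩ := hf
  obtain ⟨B, hB, hsin⟩ := exists_abs_integral_sin_mul_div_le t
  have key : ∀ p : (Fin (d + 1) → ℝ) × (Fin d → ℝ), ‖p.2‖ < M → ∀ R R', 1 ≤ R → R ≤ R' →
      ‖truncOsc f t R' p - truncOsc f t R p‖ ≤ C * (1 + |M| + B) / R := by
    intro p hp R R' hR hRR'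
    have hR0 : 0 < R := one_pos.trans_le hR
    refine (h p t R R' hR hRR').trans ?_
    rw [mul_div_assoc, add_div _ B]
    refine mul_le_mul_of_nonneg_left (add_le_add ?_ (hsin R R' hR0 hRR')) hC
    exact div_le_div_of_nonneg_right (by linarith [le_abs_self M]) hR0.le
  set K := C * (1 + |M| + B) with hK
  have hK0 : 0 ≤ K := by positivity
  rw [Metric.uniformCauchySeqOn_iff]
  intro ε hε
  have small : ∀ R, max 1 (K / ε + 1) ≤ R → K / R < ε := by
    intro R hR
    have h1 : 1 ≤ R := (le_max_left _ _).trans hR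
    have h2 : K / ε + 1 ≤ R := (le_max_right _ _).trans hR
    rw [div_lt_iff₀ (by linarith), ← div_lt_iff₀' hε]
    linarith
  refine ⟨max 1 (K / ε + 1), fun R hR R' hR' p hp => ?_⟩
  rcases le_total R R' with hle | hle
  · rw [dist_comm, dist_eq_norm]
    exact (key p hp R R' ((le_max_left _ _).trans hR) hle).trans_lt (small R hR)
  · rw [dist_eq_norm]
    exact (key p hp R' R ((le_max_left _ _).trans hR') hle).trans_lt (small R' hR')

lemma OscBound.tendsto {k : ℕ} {f : (Fin (d + 1) → ℝ) → (Fin (d + 1) → ℝ) → ℂ}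
    (hf : OscBound k f) (t : ℝ) (p : (Fin (d + 1) → ℝ) × (Fin d → ℝ)) :
    Tendsto (fun R => truncOsc f t R p) atTop (𝓝 (oscLimit f t p)) := by
  have h := (hf.uniformCauchySeqOn t (‖p.2‖ + 1)).cauchy_map
    (x := p) (by simp)
  exact tendsto_nhds_limUnder (cauchy_map_iff_exists_tendsto.1 h)

lemma OscBound.tendstoUniformlyOn {k : ℕ} {f : (Fin (d + 1) → ℝ) → (Fin (d + 1) → ℝ) → ℂ}
    (hf : OscBound k f) (t M : ℝ) :
    TendstoUniformlyOn (fun R => truncOsc f t R) (oscLimit f t) atTop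
      {p : (Fin (d + 1) → ℝ) × (Fin d → ℝ) | ‖p.2‖ < M} :=
  (hf.uniformCauchySeqOn t M).tendstoUniformlyOn_of_tendsto fun p _ => hf.tendsto t p

lemma OscBound.exists_norm_oscLimit_le {k : ℕ}
    {f : (Fin (d + 1) → ℝ) → (Fin (d + 1) → ℝ) → ℂ} (hf : OscBound k f) :
    ∃ C : ℝ, 0 ≤ C ∧ ∀ p t,
      ‖oscLimit f t p‖ ≤ C * (1 + ∑ i, p.2 i ^ 2) ^ (-(k : ℝ) / 2) := by
  have hf0 := hf
  obtain ⟨C, hC, -, h⟩ := hf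
  exact ⟨C, hC, fun p t => le_of_tendsto (hf0.tendsto t p).norm
    ((eventually_ge_atTop _).mono fun R hR => h p t R hR)⟩

lemma tendstoUniformlyOn_sum_smul_const {ι α β V : Type*} [NormedAddCommGroup V]
    [NormedSpace ℂ V] {l : Filter α} {s : Set β} (S : Finset ι) {u : ι → α → β → ℂ}
    {w : ι → β → ℂ} (h : ∀ i, TendstoUniformlyOn (u i) (w i) l s) (c : ι → V) :
    TendstoUniformlyOn (fun a b => ∑ i ∈ S, u i a b • c i) (fun b => ∑ i ∈ S, w i b • c i) l s := by
  classical
  induction S using Finset.induction_on with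
  | empty =>
    simp only [Finset.sum_empty]
    exact fun v hv => Eventually.of_forall fun _ _ _ => refl_mem_uniformity hv
  | insert i S hi ih =>
    simp only [Finset.sum_insert hi]
    have h1 : TendstoUniformlyOn (fun a b => u i a b • c i) (fun b => w i b • c i) l s :=
      (ContinuousLinearMap.toSpanSingleton ℂ (c i)).uniformContinuous.comp_tendstoUniformlyOn (h i)
    exact h1.add ih

lemma IsOscAmplitude.hasFDerivAt_oscLimit {k : ℕ}
    {f : (Fin (d + 1) → ℝ) → (Fin (d + 1) → ℝ) → ℂ} (hf : IsOscAmplitude k f) (t : ℝ)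
    (p : (Fin (d + 1) → ℝ) × (Fin d → ℝ)) :
    HasFDerivAt (oscLimit f t) (∑ s, oscLimit (symbolDeriv s f) t p • paramCoord s) p := by
  choose l hl using hf.exists_symbolDeriv
  exact hasFDerivAt_of_tendstoUniformlyOn
    (g' := fun p => ∑ s, oscLimit (symbolDeriv s f) t p • paramCoord s)
    (s := {q : (Fin (d + 1) → ℝ) × (Fin d → ℝ) | ‖q.2‖ < ‖p.2‖ + 1})
    (isOpen_lt (by fun_prop) (by fun_prop))
    (tendstoUniformlyOn_sum_smul_const Finset.univ
      (fun s => (hl s).oscBound.tendstoUniformlyOn t (‖p.2‖ + 1)) paramCoord)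
    (fun R q _ => hasFDerivAt_truncOsc hf.contDiff (fun s => (hl s).contDiff) t R q)
    (fun q _ => hf.oscBound.tendsto t q) (by simp)

lemma IsOscAmplitude.contDiff_oscLimit {k : ℕ}
    {f : (Fin (d + 1) → ℝ) → (Fin (d + 1) → ℝ) → ℂ} (hf : IsOscAmplitude k f) (t : ℝ) :
    ContDiff ℝ (⊤ : ℕ∞) (oscLimit f t) := by
  refine contDiff_infty.2 fun n => ?_
  induction n generalizing k f with
  | zero =>
    exact contDiff_zero.2 (continuous_iff_continuousAt.2 fun p =>
      (hf.hasFDerivAt_oscLimit t p).continuousAt)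
  | succ n ih =>
    refine contDiff_succ_iff_hasFDerivAt.2
      ⟨_, ContDiff.sum fun s _ => ?_, hf.hasFDerivAt_oscLimit t⟩
    obtain ⟨l, hl⟩ := hf.exists_symbolDeriv s
    exact (ih hl).smul contDiff_const

lemma IsOscAmplitude.fderiv_oscLimit_left {k : ℕ}
    {f : (Fin (d + 1) → ℝ) → (Fin (d + 1) → ℝ) → ℂ} (hf : IsOscAmplitude k f) (t : ℝ)
    (x : Fin (d + 1) → ℝ) (η : Fin d → ℝ) (i : Fin (d + 1)) :
    fderiv ℝ (fun y => oscLimit f t (y, η)) x (Pi.single i 1) =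
      oscLimit (symbolDeriv (.inl i) f) t (x, η) := by
  rw [fderiv_left_eq (g := fun y ζ => oscLimit f t (y, ζ)) (hf.contDiff_oscLimit t),
    (hf.hasFDerivAt_oscLimit t (x, η)).fderiv]
  simp [Fintype.sum_sum_type, paramCoord, Pi.single_apply, apply_ite Complex.ofReal]

lemma IsOscAmplitude.fderiv_oscLimit_right {k : ℕ}
    {f : (Fin (d + 1) → ℝ) → (Fin (d + 1) → ℝ) → ℂ} (hf : IsOscAmplitude k f) (t : ℝ)
    (x : Fin (d + 1) → ℝ) (η : Fin d → ℝ) (j : Fin d) :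
    fderiv ℝ (fun ζ => oscLimit f t (x, ζ)) η (Pi.single j 1) =
      oscLimit (symbolDeriv (.inr j) f) t (x, η) := by
  rw [fderiv_right_eq (g := fun y ζ => oscLimit f t (y, ζ)) (hf.contDiff_oscLimit t),
    (hf.hasFDerivAt_oscLimit t (x, η)).fderiv]
  simp [Fintype.sum_sum_type, paramCoord, Pi.single_apply, apply_ite Complex.ofReal]

lemma IsOscAmplitude.exists_pderivList_right {k : ℕ}
    {f : (Fin (d + 1) → ℝ) → (Fin (d + 1) → ℝ) → ℂ} (hf : IsOscAmplitude k f)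
    (β : List (Fin d)) :
    ∃ g, IsOscAmplitude (k + β.length) g ∧ ∀ t x,
      pderivList β (fun ζ => oscLimit f t (x, ζ)) = fun ζ => oscLimit g t (x, ζ) := by
  induction β with
  | nil => exact ⟨f, hf, fun t x => rfl⟩
  | cons j β ih =>
    obtain ⟨g, hg, h⟩ := ih
    refine ⟨_, hg.symbolDeriv_inr j, fun t x => ?_⟩
    funext η
    simp only [pderivList, h]
    exact hg.fderiv_oscLimit_right t x η j

lemma IsOscAmplitude.exists_pderivList_left {k : ℕ}
    {f : (Fin (d + 1) → ℝ) → (Fin (d + 1) → ℝ) → ℂ} (hf : IsOscAmplitude k f)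
    (α : List (Fin (d + 1))) :
    ∃ g, IsOscAmplitude k g ∧ ∀ t η,
      pderivList α (fun y => oscLimit f t (y, η)) = fun y => oscLimit g t (y, η) := by
  induction α with
  | nil => exact ⟨f, hf, fun t η => rfl⟩
  | cons i α ih =>
    obtain ⟨g, hg, h⟩ := ih
    refine ⟨_, hg.symbolDeriv_inl i, fun t η => ?_⟩
    funext x
    simp only [pderivList, h]
    exact hg.fderiv_oscLimit_left t x η i

lemma isAxisOdd_of_homogeneous_odd {b : (Fin (d + 1) → ℝ) → (Fin (d + 1) → ℝ) → ℂ}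
    (hb_hom : ∀ (x ξ : Fin (d + 1) → ℝ) (lam : ℝ), 0 < lam →
      1 ≤ euclNorm ξ → 1 ≤ lam * euclNorm ξ → b x (lam • ξ) = (lam : ℂ)⁻¹ * b x ξ)
    (hb_odd : ∀ (x ξ : Fin (d + 1) → ℝ), 1 ≤ euclNorm ξ → b x (-ξ) = -b x ξ) :
    IsAxisOdd b := by
  intro x τ hτ
  have hnorm : ∀ σ : ℝ, euclNorm (Fin.snoc (0 : Fin d → ℝ) σ : Fin (d + 1) → ℝ) = |σ| := by
    intro σ
    rw [euclNorm, Fin.sum_univ_castSucc]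
    simp [Real.sqrt_sq_eq_abs]
  have hsmul : ∀ σ c : ℝ, (Fin.snoc (0 : Fin d → ℝ) (c * σ) : Fin (d + 1) → ℝ) =
      c • (Fin.snoc (0 : Fin d → ℝ) σ : Fin (d + 1) → ℝ) := by
    intro σ c
    have := (snocCLM d).map_smul c (0, σ)
    simpa [snocCLM_apply] using this
  have hpos : ∀ σ : ℝ, 1 ≤ σ → b x (Fin.snoc (0 : Fin d → ℝ) σ) =
      (σ : ℂ)⁻¹ * b x (Fin.snoc (0 : Fin d → ℝ) 1) := by
    intro σ hσ
    have := hb_hom x (Fin.snoc (0 : Fin d → ℝ) 1) σ (by linarith) (by simp [hnorm])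
      (by simpa [hnorm] using hσ)
    rwa [← hsmul, mul_one] at this
  rcases le_or_gt 0 τ with h0 | h0
  · rw [abs_of_nonneg h0] at hτ
    exact hpos τ hτ
  · have h1 := hb_odd x (Fin.snoc (0 : Fin d → ℝ) (-τ)) (by rwa [hnorm, abs_neg])
    rw [abs_of_neg h0] at hτ
    rw [hpos (-τ) hτ, ← neg_one_smul ℝ, ← hsmul, neg_one_mul, neg_neg] at h1
    rw [h1]
    push_cast
    rw [inv_neg]
    ring

end OscillatoryLimit

/-- Let `n = d+1 ≥ 2` and let `a = b + r` be a classical symbol of order `−1` on `ℝⁿ` with odd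
principal symbol (`b` a symbol of order `−1`, essentially homogeneous of degree `−1` and odd
for `‖ξ‖ ≥ 1`; `r` a symbol of order `−2`).  Then the symmetric improper integrals
`A(x,η,t) := lim_{R→∞} (2π)⁻¹ ∫_{−R}^{R} e^{itτ} a(x,(η,τ)) dτ` exist for all `(x,η,t)`,
`A(·,·,t)` is smooth for each `t`, and for all multi-indices `α, β` there is a constant `C`,
independent of `t`, with `|∂_x^α ∂_η^β A(x,η,t)| ≤ C ⟨η⟩^{−|β|}`; in particular the family
`{A(·,·,t)}` is a bounded family of symbols of order `0` on `ℝ^{n−1}`. -/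
theorem boundary_symbol_order_neg_one (d : ℕ) (hd : 1 ≤ d)
    (b r : (Fin (d + 1) → ℝ) → (Fin (d + 1) → ℝ) → ℂ)
    (hb : IsSymbol (-1) b) (hr : IsSymbol (-2) r)
    (hb_hom : ∀ (x ξ : Fin (d + 1) → ℝ) (lam : ℝ), 0 < lam →
      1 ≤ euclNorm ξ → 1 ≤ lam * euclNorm ξ → b x (lam • ξ) = (lam : ℂ)⁻¹ * b x ξ)
    (hb_odd : ∀ (x ξ : Fin (d + 1) → ℝ), 1 ≤ euclNorm ξ → b x (-ξ) = -b x ξ) :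
    ∃ A : (Fin (d + 1) → ℝ) → (Fin d → ℝ) → ℝ → ℂ,
      (∀ (x : Fin (d + 1) → ℝ) (η : Fin d → ℝ) (t : ℝ),
        Tendsto (fun R : ℝ => (2 * Real.pi : ℂ)⁻¹ *
            ∫ τ in (-R)..R, Complex.exp (Complex.I * (t : ℂ) * (τ : ℂ)) *
              (b x (Fin.snoc η τ) + r x (Fin.snoc η τ)))
          atTop (𝓝 (A x η t))) ∧
      (∀ t : ℝ, ContDiff ℝ (⊤ : ℕ∞)
          (fun p : (Fin (d + 1) → ℝ) × (Fin d → ℝ) => A p.1 p.2 t)) ∧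
      (∀ (α : List (Fin (d + 1))) (β : List (Fin d)), ∃ C : ℝ, 0 ≤ C ∧
        ∀ (x : Fin (d + 1) → ℝ) (η : Fin d → ℝ) (t : ℝ),
          ‖mixedPDeriv α β (fun y ζ => A y ζ t) x η‖ ≤
            C * (1 + (∑ i, η i ^ 2)) ^ (-(β.length : ℝ) / 2)) := by
  have hf : IsOscAmplitude 0 (fun x ξ => b x ξ + r x ξ) :=
    ⟨b, r, rfl, by simpa using hb, fun _ => isAxisOdd_of_homogeneous_odd hb_hom hb_odd,
      by simpa using hr⟩
  refine ⟨fun x η t => oscLimit (fun x ξ => b x ξ + r x ξ) t (x, η),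
    fun x η t => hf.oscBound.tendsto t (x, η), fun t => hf.contDiff_oscLimit t, fun α β => ?_⟩
  obtain ⟨g, hg, h⟩ := hf.exists_pderivList_right β
  obtain ⟨g', hg', h'⟩ := hg.exists_pderivList_left α
  obtain ⟨C, hC, hle⟩ := hg'.oscBound.exists_norm_oscLimit_le
  refine ⟨C, hC, fun x η t => ?_⟩
  simpa [mixedPDeriv, h, h'] using hle (x, η) t
end

section
/- Let n ≥ 1, let ξ ∈ ℝⁿ with ξ ≠ 0, and let V₀ ∈ ℝ with V₀ ≥ 0. Write s := ‖ξ‖² and ⟨v, ξ⟩ := Σ_j v_j ξ_j for v ∈ ℂⁿ. Define ℂ-linear maps Σ, T on ℂⁿ × ℂ by Σ(v, p) := ( s·v + ⟨v, ξ⟩·ξ + i·p·ξ , −i·⟨v, ξ⟩ − V₀·p ) and T(w, q) := ( s⁻¹·w − ((V₀+1)/((2V₀+1)·s²))·⟨w, ξ⟩·ξ + (i/((2V₀+1)·s))·q·ξ , −(i/((2V₀+1)·s))·⟨w, ξ⟩ − (2/(2V₀+1))·q ). Then T ∘ Σ = id and Σ ∘ T = id on ℂⁿ × ℂ. (Σ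 is the Agmon–Douglis–Nirenberg principal symbol at ξ of the generalized Stokes operator Ξ_{V,V₀}, and T is its explicit inverse; in particular Ξ_{V,V₀} is ADN-elliptic.) -/
noncomputable section

/-- The bilinear (not sesquilinear) pairing `⟨v, ζ⟩ = Σ_j v_j ζ_j` of `v ∈ ℂⁿ` with `ζ ∈ ℝⁿ`. -/
def pairC {n : ℕ} (v : Fin n → ℂ) (ζ : Fin n → ℝ) : ℂ := ∑ j, v j * (ζ j : ℂ)

/-- The ADN principal symbol `Σ` at `ξ` of the generalized Stokes operator `Ξ_{V,V₀}`:
`Σ(v,p) = ( ‖ξ‖²·v + ⟨v,ξ⟩·ξ + i·p·ξ , −i·⟨v,ξ⟩ − V₀·p )`. -/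
def stokesSymbol {n : ℕ} (V₀ : ℝ) (ξ : Fin n → ℝ) (vp : (Fin n → ℂ) × ℂ) :
    (Fin n → ℂ) × ℂ :=
  (fun j => ((∑ k, ξ k ^ 2 : ℝ) : ℂ) * vp.1 j + pairC vp.1 ξ * (ξ j : ℂ) +
      Complex.I * vp.2 * (ξ j : ℂ),
   -(Complex.I * pairC vp.1 ξ) - (V₀ : ℂ) * vp.2)

/-- The explicit inverse `T` of the ADN principal symbol of the generalized Stokes operator:
`T(w,q) = ( s⁻¹·w − ((V₀+1)/((2V₀+1)s²))·⟨w,ξ⟩·ξ + (i/((2V₀+1)s))·q·ξ ,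
−(i/((2V₀+1)s))·⟨w,ξ⟩ − (2/(2V₀+1))·q )` with `s = ‖ξ‖²`. -/
def stokesSymbolInv {n : ℕ} (V₀ : ℝ) (ξ : Fin n → ℝ) (wq : (Fin n → ℂ) × ℂ) :
    (Fin n → ℂ) × ℂ :=
  (fun j => ((∑ k, ξ k ^ 2 : ℝ) : ℂ)⁻¹ * wq.1 j -
      (((V₀ + 1) / ((2 * V₀ + 1) * (∑ k, ξ k ^ 2) ^ 2) : ℝ) : ℂ) * pairC wq.1 ξ * (ξ j : ℂ) +
      Complex.I * (((2 * V₀ + 1) * (∑ k, ξ k ^ 2) : ℝ) : ℂ)⁻¹ * wq.2 * (ξ j : ℂ),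
   -(Complex.I * (((2 * V₀ + 1) * (∑ k, ξ k ^ 2) : ℝ) : ℂ)⁻¹ * pairC wq.1 ξ) -
      ((2 / (2 * V₀ + 1) : ℝ) : ℂ) * wq.2)

end

/-- Pairing with `ξ` of a combination of `v` and `ξ`. -/
theorem pairC_mul_add_mul {n : ℕ} (c d : ℂ) (v : Fin n → ℂ) (ξ : Fin n → ℝ) :
    pairC (fun j => c * v j + d * (ξ j : ℂ)) ξ =
      c * pairC v ξ + d * ((∑ k, ξ k ^ 2 : ℝ) : ℂ) := by
  simp only [pairC, Complex.ofReal_sum, Complex.ofReal_pow, Finset.mul_sum,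
    ← Finset.sum_add_distrib]
  exact Finset.sum_congr rfl fun j _ => by ring

theorem pairC_stokesSymbol_fst {n : ℕ} (V₀ : ℝ) (ξ : Fin n → ℝ) (vp : (Fin n → ℂ) × ℂ) :
    pairC (stokesSymbol V₀ ξ vp).1 ξ =
      ((∑ k, ξ k ^ 2 : ℝ) : ℂ) * (2 * pairC vp.1 ξ + Complex.I * vp.2) := by
  have h := pairC_mul_add_mul ((∑ k, ξ k ^ 2 : ℝ) : ℂ) (pairC vp.1 ξ + Complex.I * vp.2) vp.1 ξ
  simp only [add_mul, ← add_assoc] at h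
  rw [stokesSymbol, h]
  ring

theorem pairC_stokesSymbolInv_fst {n : ℕ} (V₀ : ℝ) (ξ : Fin n → ℝ) (wq : (Fin n → ℂ) × ℂ) :
    pairC (stokesSymbolInv V₀ ξ wq).1 ξ =
      ((∑ k, ξ k ^ 2 : ℝ) : ℂ)⁻¹ * pairC wq.1 ξ +
        (-((((V₀ + 1) / ((2 * V₀ + 1) * (∑ k, ξ k ^ 2) ^ 2) : ℝ) : ℂ) * pairC wq.1 ξ) +
          Complex.I * (((2 * V₀ + 1) * (∑ k, ξ k ^ 2) : ℝ) : ℂ)⁻¹ * wq.2) *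
          ((∑ k, ξ k ^ 2 : ℝ) : ℂ) := by
  rw [← pairC_mul_add_mul, stokesSymbolInv]
  congr 1
  funext j
  ring

/-- For `ξ ≠ 0` and `V₀ ≥ 0`, the maps `Σ` and `T` on `ℂⁿ × ℂ` are mutually inverse:
`T∘Σ = id` and `Σ∘T = id`.  (`Σ` is the ADN principal symbol at `ξ` of the generalized
Stokes operator `Ξ_{V,V₀}` and `T` its explicit inverse; in particular `Ξ_{V,V₀}` is
ADN-elliptic.) -/
theorem stokes_symbol_inverse (n : ℕ) (hn : 1 ≤ n) (V₀ : ℝ) (hV₀ : 0 ≤ V₀)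
    (ξ : Fin n → ℝ) (hξ : ξ ≠ 0) :
    (∀ vp : (Fin n → ℂ) × ℂ, stokesSymbolInv V₀ ξ (stokesSymbol V₀ ξ vp) = vp) ∧
    (∀ wq : (Fin n → ℂ) × ℂ, stokesSymbol V₀ ξ (stokesSymbolInv V₀ ξ wq) = wq) := by
  have hs : ((∑ k, ξ k ^ 2 : ℝ) : ℂ) ≠ 0 := by
    rw [Complex.ofReal_ne_zero]
    intro h
    refine hξ (funext fun j => ?_)
    have := (Finset.sum_eq_zero_iff_of_nonneg fun k _ => sq_nonneg (ξ k)).1 h j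
      (Finset.mem_univ j)
    simpa using this
  have hD : (2 * (V₀ : ℂ) + 1) ≠ 0 := by
    have : (2 * V₀ + 1) ≠ 0 := by positivity
    exact_mod_cast this
  obtain ⟨D, hDV⟩ : ∃ D : ℂ, D = 2 * (V₀ : ℂ) + 1 := ⟨_, rfl⟩
  have hV : (V₀ : ℂ) = (D - 1) / 2 := by rw [hDV]; ring
  rw [← hDV] at hD
  have hI : Complex.I ^ 2 = -1 := Complex.I_sq
  constructor
  · intro vp
    have h := pairC_stokesSymbol_fst V₀ ξ vp
    rw [stokesSymbolInv, h]
    simp only [stokesSymbol]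
    push_cast at hs ⊢
    rw [← hDV, hV]
    generalize (∑ k, (ξ k : ℂ) ^ 2) = s at hs ⊢
    generalize pairC vp.1 ξ = a
    ext j <;>
    · field_simp
      ring_nf
      simp only [hI]
      ring
  · intro wq
    have h := pairC_stokesSymbolInv_fst V₀ ξ wq
    rw [stokesSymbol, h]
    simp only [stokesSymbolInv]
    push_cast at hs ⊢
    rw [← hDV, hV]
    generalize (∑ k, (ξ k : ℂ) ^ 2) = s at hs ⊢
    generalize pairC wq.1 ξ = a
    ext j <;>
    · field_simp
      ring_nf
      simp only [hI]
      ring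
end

section
/- Let n ≥ 1, V₀ ≥ 0, f := (V₀+1)/(2V₀+1), g := 1/(2V₀+1), and let ν ∈ ℝⁿ with ‖ν‖ = 1. For ξ ∈ ℝⁿ \ {0} define ℂ-linear endomorphisms of ℂⁿ by A(ξ)v := ‖ξ‖⁻²·v − f·‖ξ‖⁻⁴·⟨v, ξ⟩·ξ, D(ξ)v := −(i/2)·(⟨ξ, ν⟩·v + ⟨v, ξ⟩·ν), B(ξ)v := i·g·‖ξ‖⁻²·⟨v, ν⟩·ξ, and M(ξ)v := i·‖ξ‖⁻²·( ⟨ξ, ν⟩·v + ⟨v, ξ⟩·ν − 2f·⟨ξ, ν⟩·‖ξ‖⁻²·⟨v, ξ⟩·ξ + g·⟨v, ν⟩·ξ ). Then: (a) −2·A(ξ) ∘ D(ξ) + B(ξ) = M(ξ) for every ξ ≠ 0; and (b) for every w ∈ ℝⁿ with ⟨w, ν⟩ = 0, the operator-valued function t ↦ t · M(w − t·ν) converges in the norm of End(ℂⁿ) to −i·id both as t → +∞ and as t → −∞. (Thus the jump coefficient of the symbol of the double layer potential of the generalized Stokes operator equals −i.) -/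
open MeasureTheory Filter Topology

noncomputable section

/-- The bilinear pairing `v ↦ ⟨v, ζ⟩ = Σ_j v_j ζ_j` with `ζ ∈ ℝⁿ`, as a `ℂ`-linear functional. -/
def pairLC {n : ℕ} (ζ : Fin n → ℝ) : (Fin n → ℂ) →ₗ[ℂ] ℂ where
  toFun v := ∑ j, v j * (ζ j : ℂ)
  map_add' v w := by simp [add_mul, Finset.sum_add_distrib]
  map_smul' c v := by simp [Finset.mul_sum, mul_assoc]

/-- The rank-one endomorphism `u ⊗ ζ♭` of `ℂⁿ` given by `v ↦ ⟨v, ζ⟩·u`, for `u, ζ ∈ ℝⁿ`. -/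
def rankOneC {n : ℕ} (u ζ : Fin n → ℝ) : (Fin n → ℂ) →L[ℂ] (Fin n → ℂ) :=
  LinearMap.toContinuousLinearMap ((pairLC ζ).smulRight fun j => (u j : ℂ))

/-- The real dot product on `ℝⁿ`. -/
def rdot {n : ℕ} (ξ ν : Fin n → ℝ) : ℝ := ∑ j, ξ j * ν j

/-- The order `−2` principal symbol `A(ξ)` of the velocity block `𝒜` of `Ξ⁻¹`:
`A(ξ)v = ‖ξ‖⁻²·v − f·‖ξ‖⁻⁴·⟨v,ξ⟩·ξ` with `f = (V₀+1)/(2V₀+1)`. -/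
def Asymb {n : ℕ} (V₀ : ℝ) (ξ : Fin n → ℝ) : (Fin n → ℂ) →L[ℂ] (Fin n → ℂ) :=
  (((∑ j, ξ j ^ 2)⁻¹ : ℝ) : ℂ) • ContinuousLinearMap.id ℂ (Fin n → ℂ) -
    ((((V₀ + 1) / (2 * V₀ + 1)) * (((∑ j, ξ j ^ 2) ^ 2)⁻¹) : ℝ) : ℂ) • rankOneC ξ ξ

/-- The order `1` principal symbol `D(ξ)` of the adjoint `D_ν*` of the conormal deformation
operator: `D(ξ)v = −(i/2)(⟨ξ,ν⟩·v + ⟨v,ξ⟩·ν)`. -/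
def Dsymb {n : ℕ} (ν ξ : Fin n → ℝ) : (Fin n → ℂ) →L[ℂ] (Fin n → ℂ) :=
  (-(Complex.I / 2)) •
    (((rdot ξ ν : ℝ) : ℂ) • ContinuousLinearMap.id ℂ (Fin n → ℂ) + rankOneC ν ξ)

/-- The principal symbol `B(ξ)` of the pressure-coupling block applied to `ν♭`:
`B(ξ)v = i·g·‖ξ‖⁻²·⟨v,ν⟩·ξ` with `g = 1/(2V₀+1)`. -/
def Bsymb {n : ℕ} (V₀ : ℝ) (ν ξ : Fin n → ℝ) : (Fin n → ℂ) →L[ℂ] (Fin n → ℂ) :=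
  (Complex.I * (((1 / (2 * V₀ + 1)) * (∑ j, ξ j ^ 2)⁻¹ : ℝ) : ℂ)) • rankOneC ξ ν

/-- The order `−1` principal symbol `M(ξ)` of the operator `P = −2𝒜 D_ν* + ℬ ν♯` defining
the double layer velocity potential:
`M(ξ)v = i‖ξ‖⁻²( ⟨ξ,ν⟩v + ⟨v,ξ⟩ν − 2f⟨ξ,ν⟩‖ξ‖⁻²⟨v,ξ⟩ξ + g⟨v,ν⟩ξ )`. -/
def Msymb {n : ℕ} (V₀ : ℝ) (ν ξ : Fin n → ℝ) : (Fin n → ℂ) →L[ℂ] (Fin n → ℂ) :=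
  (Complex.I * (((∑ j, ξ j ^ 2)⁻¹ : ℝ) : ℂ)) •
    (((rdot ξ ν : ℝ) : ℂ) • ContinuousLinearMap.id ℂ (Fin n → ℂ) + rankOneC ν ξ -
      ((2 * ((V₀ + 1) / (2 * V₀ + 1)) * rdot ξ ν * (∑ j, ξ j ^ 2)⁻¹ : ℝ) : ℂ) • rankOneC ξ ξ +
      (((1 / (2 * V₀ + 1)) : ℝ) : ℂ) • rankOneC ξ ν)

end

theorem rankOneC_apply {n : ℕ} (u ζ : Fin n → ℝ) (v : Fin n → ℂ) (k : Fin n) :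
    rankOneC u ζ v k = (∑ j, v j * (ζ j : ℂ)) * (u k : ℂ) := rfl

theorem rankOneC_sub_smul_left {n : ℕ} (u u' ζ : Fin n → ℝ) (t : ℝ) :
    rankOneC (u - t • u') ζ = rankOneC u ζ - (t : ℂ) • rankOneC u' ζ := by
  ext v k
  simp [rankOneC_apply]
  ring

theorem rankOneC_sub_smul_right {n : ℕ} (u ζ ζ' : Fin n → ℝ) (t : ℝ) :
    rankOneC u (ζ - t • ζ') = rankOneC u ζ - (t : ℂ) • rankOneC u ζ' := by
  ext v k
  have h : ∑ j, v j * (((ζ - t • ζ') j : ℝ) : ℂ)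
      = ∑ j, v j * (ζ j : ℂ) - (t : ℂ) * ∑ j, v j * (ζ' j : ℂ) := by
    rw [Finset.mul_sum, ← Finset.sum_sub_distrib]
    refine Finset.sum_congr rfl fun j _ => ?_
    simp
    ring
  rw [rankOneC_apply, h]
  simp only [rankOneC_apply, sub_apply, smul_apply, Pi.sub_apply, Pi.smul_apply, smul_eq_mul]
  ring

theorem rankOneC_comp_rankOneC {n : ℕ} (u ζ u' ζ' : Fin n → ℝ) :
    (rankOneC u ζ).comp (rankOneC u' ζ') = ((rdot ζ u' : ℝ) : ℂ) • rankOneC u ζ' := by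
  ext v k
  have h (c : ℂ) : ∑ j, c * (u' j : ℂ) * (ζ j : ℂ) = c * ((rdot ζ u' : ℝ) : ℂ) := by
    rw [rdot, Complex.ofReal_sum, Finset.mul_sum]
    refine Finset.sum_congr rfl fun j _ => ?_
    push_cast
    ring
  simp only [ContinuousLinearMap.comp_apply, rankOneC_apply, smul_apply,
    Pi.smul_apply, smul_eq_mul, h]
  ring

theorem neg_two_smul_Asymb_comp_Dsymb_add_Bsymb {n : ℕ} (V₀ : ℝ) (ν ξ : Fin n → ℝ) :
    (-2 : ℂ) • (Asymb V₀ ξ).comp (Dsymb ν ξ) + Bsymb V₀ ν ξ = Msymb V₀ ν ξ := by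
  simp only [Asymb, Dsymb, Bsymb, Msymb, ContinuousLinearMap.sub_comp,
    ContinuousLinearMap.comp_add, ContinuousLinearMap.smul_comp, ContinuousLinearMap.comp_smul,
    ContinuousLinearMap.id_comp, ContinuousLinearMap.comp_id, rankOneC_comp_rankOneC]
  push_cast
  module

theorem rdot_sub_smul_self {n : ℕ} {ν w : Fin n → ℝ} (hν : ∑ j, ν j ^ 2 = 1)
    (hw : rdot w ν = 0) (t : ℝ) : rdot (w - t • ν) ν = -t := by
  have h : rdot (w - t • ν) ν = rdot w ν - t * ∑ j, ν j ^ 2 := by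
    rw [rdot, rdot, Finset.mul_sum, ← Finset.sum_sub_distrib]
    refine Finset.sum_congr rfl fun j _ => ?_
    simp
    ring
  rw [h, hν, hw]
  ring

theorem sum_sq_sub_smul {n : ℕ} {ν w : Fin n → ℝ} (hν : ∑ j, ν j ^ 2 = 1)
    (hw : rdot w ν = 0) (t : ℝ) :
    ∑ j, (w - t • ν) j ^ 2 = ∑ j, w j ^ 2 + t ^ 2 := by
  have h : ∑ j, (w - t • ν) j ^ 2
      = ∑ j, w j ^ 2 - 2 * t * rdot w ν + t ^ 2 * ∑ j, ν j ^ 2 := by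
    rw [rdot, Finset.mul_sum, Finset.mul_sum, ← Finset.sum_sub_distrib,
      ← Finset.sum_add_distrib]
    refine Finset.sum_congr rfl fun j _ => ?_
    simp
    ring
  rw [h, hν, hw]
  ring

/-- The value of `t • M(w - t • ν)` for `w ⊥ ν`, where `a = t / ‖w - t • ν‖ ^ 2` and
`b = t ^ 2 / ‖w - t • ν‖ ^ 2`. -/
noncomputable def scaledMsymb {n : ℕ} (V₀ : ℝ) (ν w : Fin n → ℝ) (a b : ℂ) :
    (Fin n → ℂ) →L[ℂ] (Fin n → ℂ) :=
  Complex.I • (-b • ContinuousLinearMap.id ℂ (Fin n → ℂ) + a • rankOneC ν w - b • rankOneC ν ν +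
    (2 * ((V₀ + 1) / (2 * V₀ + 1)) : ℂ) •
      (a ^ 2 • rankOneC w w - (a * b) • (rankOneC w ν + rankOneC ν w) + b ^ 2 • rankOneC ν ν) +
    (1 / (2 * V₀ + 1) : ℂ) • (a • rankOneC w ν - b • rankOneC ν ν))

theorem smul_Msymb_sub_smul {n : ℕ} (V₀ : ℝ) {ν w : Fin n → ℝ} (hν : ∑ j, ν j ^ 2 = 1)
    (hw : rdot w ν = 0) (t : ℝ) :
    (t : ℂ) • Msymb V₀ ν (w - t • ν) =
      scaledMsymb V₀ ν w ((t * (∑ j, w j ^ 2 + t ^ 2)⁻¹ : ℝ) : ℂ)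
        ((t ^ 2 * (∑ j, w j ^ 2 + t ^ 2)⁻¹ : ℝ) : ℂ) := by
  simp only [Msymb, scaledMsymb, rdot_sub_smul_self hν hw, sum_sq_sub_smul hν hw,
    rankOneC_sub_smul_left, rankOneC_sub_smul_right]
  generalize (∑ j, w j ^ 2 + t ^ 2)⁻¹ = r
  push_cast
  module

theorem scaledMsymb_zero_one {n : ℕ} {V₀ : ℝ} (hV₀ : 2 * V₀ + 1 ≠ 0) (ν w : Fin n → ℝ) :
    scaledMsymb V₀ ν w 0 1 = (-Complex.I) • ContinuousLinearMap.id ℂ (Fin n → ℂ) := by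
  have hV : (2 * V₀ + 1 : ℂ) ≠ 0 := mod_cast hV₀
  have h : (2 * ((V₀ + 1) / (2 * V₀ + 1)) : ℂ) = 1 + 1 / (2 * V₀ + 1) := by
    field_simp
    ring
  rw [scaledMsymb, h]
  module

theorem tendsto_sq_mul_inv_add_sq {l : Filter ℝ} (hl : Tendsto (fun t : ℝ => t⁻¹) l (𝓝 0))
    (hl₀ : ∀ᶠ t in l, t ≠ 0) (c : ℝ) :
    Tendsto (fun t : ℝ => t ^ 2 * (c + t ^ 2)⁻¹) l (𝓝 1) := by
  have h : Tendsto (fun t : ℝ => (c * t⁻¹ ^ 2 + 1)⁻¹) l (𝓝 1) := by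
    simpa using (((hl.pow 2).const_mul c).add_const 1).inv₀ (by simp)
  refine h.congr' ?_
  filter_upwards [hl₀] with t ht
  rw [show c + t ^ 2 = t ^ 2 * (c * t⁻¹ ^ 2 + 1) by field_simp, mul_inv,
    mul_inv_cancel_left₀ (pow_ne_zero 2 ht)]

theorem tendsto_mul_inv_add_sq {l : Filter ℝ} (hl : Tendsto (fun t : ℝ => t⁻¹) l (𝓝 0))
    (hl₀ : ∀ᶠ t in l, t ≠ 0) (c : ℝ) :
    Tendsto (fun t : ℝ => t * (c + t ^ 2)⁻¹) l (𝓝 0) := by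
  have h := hl.mul (tendsto_sq_mul_inv_add_sq hl hl₀ c)
  rw [zero_mul] at h
  refine h.congr' ?_
  filter_upwards [hl₀] with t ht
  rw [pow_two t, mul_assoc, inv_mul_cancel_left₀ ht]

theorem tendsto_smul_Msymb_sub_smul {n : ℕ} {V₀ : ℝ} (hV₀ : 2 * V₀ + 1 ≠ 0)
    {ν w : Fin n → ℝ} (hν : ∑ j, ν j ^ 2 = 1) (hw : rdot w ν = 0) {l : Filter ℝ}
    (hl : Tendsto (fun t : ℝ => t⁻¹) l (𝓝 0)) (hl₀ : ∀ᶠ t in l, t ≠ 0) :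
    Tendsto (fun t : ℝ => (t : ℂ) • Msymb V₀ ν (w - t • ν)) l
      (𝓝 ((-Complex.I) • ContinuousLinearMap.id ℂ (Fin n → ℂ))) := by
  have hF : Continuous fun p : ℝ × ℝ => scaledMsymb V₀ ν w (p.1 : ℂ) (p.2 : ℂ) := by
    unfold scaledMsymb
    fun_prop
  have h := (hF.tendsto (0, 1)).comp
    ((tendsto_mul_inv_add_sq hl hl₀ (∑ j, w j ^ 2)).prodMk_nhds
      (tendsto_sq_mul_inv_add_sq hl hl₀ (∑ j, w j ^ 2)))
  simp only [Complex.ofReal_zero, Complex.ofReal_one, scaledMsymb_zero_one hV₀] at h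
  exact h.congr fun t => (smul_Msymb_sub_smul V₀ hν hw t).symm

/-- With `V₀ ≥ 0` and `ν` a unit vector: (a) `−2·A(ξ)∘D(ξ) + B(ξ) = M(ξ)` for every `ξ ≠ 0`;
(b) for every `w ⊥ ν`, `t·M(w − t·ν) → −i·id` in the norm of `End(ℂⁿ)` as `t → ±∞`.  (Thus
the jump coefficient of the symbol of the double layer potential of the generalized Stokes
operator equals `−i`.) -/
theorem double_layer_symbol_and_jump_coefficient (n : ℕ) (hn : 1 ≤ n)
    (V₀ : ℝ) (hV₀ : 0 ≤ V₀) (ν : Fin n → ℝ) (hν : ∑ j, ν j ^ 2 = 1) :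
    (∀ ξ : Fin n → ℝ, ξ ≠ 0 →
      (-2 : ℂ) • (Asymb V₀ ξ).comp (Dsymb ν ξ) + Bsymb V₀ ν ξ = Msymb V₀ ν ξ) ∧
    (∀ w : Fin n → ℝ, rdot w ν = 0 →
      Tendsto (fun t : ℝ => (t : ℂ) • Msymb V₀ ν (w - t • ν)) atTop
        (𝓝 ((-Complex.I) • ContinuousLinearMap.id ℂ (Fin n → ℂ))) ∧
      Tendsto (fun t : ℝ => (t : ℂ) • Msymb V₀ ν (w - t • ν)) atBot
        (𝓝 ((-Complex.I) • ContinuousLinearMap.id ℂ (Fin n → ℂ)))) := by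
  have hV : 2 * V₀ + 1 ≠ 0 := by positivity
  exact ⟨fun ξ _ => neg_two_smul_Asymb_comp_Dsymb_add_Bsymb V₀ ν ξ, fun w hw =>
    ⟨tendsto_smul_Msymb_sub_smul hV hν hw tendsto_inv_atTop_zero (eventually_ne_atTop 0),
      tendsto_smul_Msymb_sub_smul hV hν hw tendsto_inv_atBot_zero (eventually_ne_atBot 0)⟩⟩
end
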